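/- arXiv:1602.04577 — 2 statements merged into one kernel-verified Lean document; each statement's English description precedes it below -/
import Mathlib

section
/- Let n ≥ 2 be an integer and α ∈ (0,1) ∪ (1,∞), and consider a finite joint source with X-alphabet of size n; set h = ∑_{y∈Y} q_y·H(p_y) and E = ∑_{y∈Y} q_y·‖p_y‖_α. (a) If h' ∈ [0, ln n] satisfies L_min^α(h') = E, then h ≤ h' when α ∈ (0,1), and h ≥ h' when α > 1. (b) If n ≥ 3, α ∈ [1/2, 1) ∪ (1, ∞), p* ∈ (0, 1/n) satisfies the tangency equation, and h'' ∈ [0, ln n] satisfies L_max^α(h'') = E, then h ≥ h'' when α ∈ [1/2, 1), and h ≤ h'' when α > 1. -/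
open Real

/-- Shannon entropy (natural log, with `0 * log 0 = 0` since `Real.log 0 = 0`). -/
noncomputable def shannonEntropy {n : ℕ} (p : Fin n → ℝ) : ℝ :=
  -∑ i, p i * Real.log (p i)

/-- ℓ_α-norm of a vector (real power). -/
noncomputable def lNorm {n : ℕ} (α : ℝ) (p : Fin n → ℝ) : ℝ :=
  (∑ i, p i ^ α) ^ (1 / α)

/-- `p` is an `n`-ary probability vector. -/
def IsProbVec {n : ℕ} (p : Fin n → ℝ) : Prop :=
  (∀ i, 0 ≤ p i) ∧ ∑ i, p i = 1

/-- The vector `v_n(q)`: first entry `1 - (n-1)q`, the other `n-1` entries equal `q`. -/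
noncomputable def vVec (n : ℕ) (q : ℝ) : Fin n → ℝ :=
  fun i => if (i : ℕ) = 0 then 1 - ((n : ℝ) - 1) * q else q

/-- The vector `w_n(r)`: first `⌊1/r⌋` entries equal `r`, the next entry is
`1 - ⌊1/r⌋·r`, the remaining entries are `0`. -/
noncomputable def wVec (n : ℕ) (r : ℝ) : Fin n → ℝ :=
  fun i => if (i : ℕ) < ⌊1 / r⌋₊ then r
           else if (i : ℕ) = ⌊1 / r⌋₊ then 1 - (⌊1 / r⌋₊ : ℝ) * r
           else 0

/-- `L_min^α(h) = λ·m^(1/α−1) + (1−λ)·(m+1)^(1/α−1)` where `m = ⌊e^h⌋` and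
`λ = (ln(m+1) − h)/(ln(m+1) − ln m)`. -/
noncomputable def Lmin (α h : ℝ) : ℝ :=
  ((Real.log ((⌊Real.exp h⌋₊ : ℝ) + 1) - h) /
      (Real.log ((⌊Real.exp h⌋₊ : ℝ) + 1) - Real.log (⌊Real.exp h⌋₊ : ℝ))) *
    (⌊Real.exp h⌋₊ : ℝ) ^ (1 / α - 1) +
  (1 - (Real.log ((⌊Real.exp h⌋₊ : ℝ) + 1) - h) /
      (Real.log ((⌊Real.exp h⌋₊ : ℝ) + 1) - Real.log (⌊Real.exp h⌋₊ : ℝ))) *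
    ((⌊Real.exp h⌋₊ : ℝ) + 1) ^ (1 / α - 1)

/-- `H_{v_n}(p) = H(v_n(p))`. -/
noncomputable def Hv (n : ℕ) (p : ℝ) : ℝ := shannonEntropy (vVec n p)

/-- The derivative of `‖v_n(p)‖_α` with respect to `H_{v_n}(p)`. -/
noncomputable def Dva (n : ℕ) (α p : ℝ) : ℝ :=
  (((n : ℝ) - 1) * p ^ α + (1 - ((n : ℝ) - 1) * p) ^ α) ^ (1 / α - 1) *
    ((p ^ (α - 1) - (1 - ((n : ℝ) - 1) * p) ^ (α - 1)) /
      (Real.log (1 - ((n : ℝ) - 1) * p) - Real.log p))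

/-- The tangency equation `(ln n − H_{v_n}(p))·D_{n,α}(p) = n^{1/α−1} − ‖v_n(p)‖_α`. -/
def TangencyEq (n : ℕ) (α p : ℝ) : Prop :=
  (Real.log n - Hv n p) * Dva n α p = (n : ℝ) ^ (1 / α - 1) - lNorm α (vVec n p)


/-- Weighted combination of the norm and the negative entropy. -/
noncomputable def FF {n : ℕ} (a b α : ℝ) (p : Fin n → ℝ) : ℝ :=
  a * lNorm α p + b * ∑ i, p i * Real.log (p i)

lemma second_order_test (f f1 : ℝ → ℝ) (f2 : ℝ) (hmin : IsLocalMin f 0)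
    (h1 : ∀ᶠ t in nhds (0:ℝ), HasDerivAt f (f1 t) t) (h2 : HasDerivAt f1 f2 0) :
    f1 0 = 0 ∧ 0 ≤ f2 := by
  have h10 : f1 0 = 0 := hmin.hasDerivAt_eq_zero h1.self_of_nhds
  refine ⟨h10, ?_⟩
  by_contra hneg
  push Not at hneg
  have hd : deriv f =ᶠ[nhds 0] f1 := h1.mono (fun t ht => ht.deriv)
  have hdd : deriv (deriv f) 0 = f2 := by
    rw [hd.deriv_eq]; exact h2.deriv
  have hmax : IsLocalMax f 0 := by
    apply isLocalMax_of_deriv_deriv_neg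
    · rw [hdd]; exact hneg
    · rw [hd.self_of_nhds]; exact h10
    · exact h1.self_of_nhds.continuousAt
  have hc : f =ᶠ[nhds 0] fun _ => f 0 := by
    filter_upwards [hmin, hmax] with t h h'
    exact le_antisymm h' h
  have hd0 : deriv f =ᶠ[nhds 0] fun _ => 0 := by
    have := hc.deriv
    refine this.trans ?_
    simp
  have : deriv (deriv f) 0 = 0 := by rw [hd0.deriv_eq]; simp
  linarith

lemma line_deriv {n : ℕ} (a b α : ℝ) (hα : 0 < α) (x d : Fin n → ℝ) (t : ℝ)
    (hx : ∀ i, d i ≠ 0 → 0 < x i + t * d i) (hS : 0 < ∑ i, (x i + t * d i) ^ α) :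
    HasDerivAt (fun t => FF a b α (fun i => x i + t * d i))
      (a * (∑ i, (x i + t * d i) ^ α) ^ (1 / α - 1) * ∑ i, d i * (x i + t * d i) ^ (α - 1)
        + b * ∑ i, d i * (Real.log (x i + t * d i) + 1)) t := by
  have hl : ∀ i, HasDerivAt (fun t => x i + t * d i) (d i) t := fun i => by
    simpa using ((hasDerivAt_id t).mul_const (d i)).const_add (x i)
  have h1 : ∀ i, HasDerivAt (fun t => (x i + t * d i) ^ α)
      (d i * α * (x i + t * d i) ^ (α - 1)) t := fun i => by
    by_cases h : d i = 0
    · simp only [h, mul_zero, add_zero, zero_mul]; exact hasDerivAt_const _ _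
    · exact (hl i).rpow_const (Or.inl (hx i h).ne')
  have h2 : ∀ i, HasDerivAt (fun t => (x i + t * d i) * Real.log (x i + t * d i))
      (d i * (Real.log (x i + t * d i) + 1)) t := fun i => by
    by_cases h : d i = 0
    · simp only [h, mul_zero, add_zero, zero_mul]; exact hasDerivAt_const _ _
    · have hp := hx i h
      have := (hl i).mul ((hl i).log hp.ne')
      refine HasDerivAt.congr_deriv this ?_
      generalize x i + t * d i = X at hp ⊢
      field_simp
  have hs1 := HasDerivAt.fun_sum (u := Finset.univ) (fun i _ => h1 i)
  have hs2 := HasDerivAt.fun_sum (u := Finset.univ) (fun i _ => h2 i)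
  have := ((hs1.rpow_const (p := 1 / α) (Or.inl hS.ne')).const_mul a).add (hs2.const_mul b)
  refine HasDerivAt.congr_deriv this ?_
  have : ∑ i, d i * α * (x i + t * d i) ^ (α - 1) = α * ∑ i, d i * (x i + t * d i) ^ (α - 1) := by
    rw [Finset.mul_sum]; exact Finset.sum_congr rfl (fun i _ => by ring)
  rw [this]
  generalize (∑ i, (x i + t * d i) ^ α) ^ (1 / α - 1) = P
  generalize ∑ i, d i * (x i + t * d i) ^ (α - 1) = Q
  congr 1
  field_simp

lemma line_deriv2 {n : ℕ} (a b α : ℝ) (hα : 0 < α) (x d : Fin n → ℝ)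
    (hx : ∀ i, d i ≠ 0 → 0 < x i) (hS : 0 < ∑ i, (x i) ^ α) :
    HasDerivAt (fun t => a * (∑ i, (x i + t * d i) ^ α) ^ (1 / α - 1) *
        ∑ i, d i * (x i + t * d i) ^ (α - 1) + b * ∑ i, d i * (Real.log (x i + t * d i) + 1))
      (a * (1 - α) * (∑ i, (x i) ^ α) ^ (1 / α - 2) * (∑ i, d i * (x i) ^ (α - 1)) ^ 2
       + a * (α - 1) * (∑ i, (x i) ^ α) ^ (1 / α - 1) * (∑ i, d i ^ 2 * (x i) ^ (α - 2))
       + b * ∑ i, d i ^ 2 / x i) 0 := by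
  have hl : ∀ i, HasDerivAt (fun t : ℝ => x i + t * d i) (d i) 0 := fun i => by
    simpa using ((hasDerivAt_id (0:ℝ)).mul_const (d i)).const_add (x i)
  have h1 : ∀ i, HasDerivAt (fun t : ℝ => (x i + t * d i) ^ α)
      (d i * α * (x i) ^ (α - 1)) 0 := fun i => by
    by_cases h : d i = 0
    · simp only [h, mul_zero, add_zero, zero_mul]; exact hasDerivAt_const _ _
    · simpa using (hl i).rpow_const (p := α) (Or.inl (by simpa using (hx i h).ne'))
  have h1' : ∀ i, HasDerivAt (fun t : ℝ => d i * (x i + t * d i) ^ (α - 1))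
      (d i ^ 2 * (α - 1) * (x i) ^ (α - 2)) 0 := fun i => by
    by_cases h : d i = 0
    · simp only [h, mul_zero, add_zero, zero_mul]
      simpa using hasDerivAt_const (0:ℝ) (0:ℝ)
    · have := ((hl i).rpow_const (p := α - 1) (Or.inl (by simpa using (hx i h).ne'))).const_mul (d i)
      refine HasDerivAt.congr_deriv this ?_
      rw [show α - 1 - 1 = α - 2 by ring]; simp; ring
  have h2 : ∀ i, HasDerivAt (fun t : ℝ => d i * (Real.log (x i + t * d i) + 1))
      (d i ^ 2 / x i) 0 := fun i => by
    by_cases h : d i = 0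
    · simp only [h, mul_zero, add_zero, zero_mul]
      simpa using hasDerivAt_const (0:ℝ) (0:ℝ)
    · have := (((hl i).log (by simpa using (hx i h).ne')).add_const 1).const_mul (d i)
      refine HasDerivAt.congr_deriv this ?_
      simp; ring
  have hs1 := HasDerivAt.fun_sum (u := Finset.univ) (fun i _ => h1 i)
  have hs1' := HasDerivAt.fun_sum (u := Finset.univ) (fun i _ => h1' i)
  have hs2 := HasDerivAt.fun_sum (u := Finset.univ) (fun i _ => h2 i)
  have := (((hs1.rpow_const (p := 1 / α - 1) (Or.inl (by simpa using hS.ne'))).const_mul a).mul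
    hs1').add (hs2.const_mul b)
  refine HasDerivAt.congr_deriv this ?_
  have e1 : ∑ i, d i * α * (x i) ^ (α - 1) = α * ∑ i, d i * (x i) ^ (α - 1) := by
    rw [Finset.mul_sum]; exact Finset.sum_congr rfl (fun i _ => by ring)
  have e2 : ∑ i, d i ^ 2 * (α - 1) * (x i) ^ (α - 2)
      = (α - 1) * ∑ i, d i ^ 2 * (x i) ^ (α - 2) := by
    rw [Finset.mul_sum]; exact Finset.sum_congr rfl (fun i _ => by ring)
  rw [e1, e2]
  simp only [zero_mul, add_zero]
  rw [show 1 / α - 1 - 1 = 1 / α - 2 by ring]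
  field_simp

lemma sum_rpow_pos {n : ℕ} (α : ℝ) (p : Fin n → ℝ) (hp : IsProbVec p) :
    0 < ∑ i, p i ^ α := by
  obtain ⟨i, hi⟩ : ∃ i, 0 < p i := by
    by_contra h
    push Not at h
    have := Finset.sum_nonpos (s := Finset.univ) (fun i _ => h i)
    rw [hp.2] at this; linarith
  exact Finset.sum_pos' (fun j _ => Real.rpow_nonneg (hp.1 j) _)
    ⟨i, Finset.mem_univ _, Real.rpow_pos_of_pos hi _⟩

lemma crit {n : ℕ} (a b α : ℝ) (hα : 0 < α) (p : Fin n → ℝ) (hp : IsProbVec p)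
    (hmin : ∀ p' : Fin n → ℝ, IsProbVec p' → FF a b α p ≤ FF a b α p')
    (d : Fin n → ℝ) (hd : ∑ i, d i = 0) (hd0 : ∀ i, d i ≠ 0 → 0 < p i) :
    a * (∑ i, p i ^ α) ^ (1 / α - 1) * (∑ i, d i * p i ^ (α - 1))
      + b * ∑ i, d i * Real.log (p i) = 0 ∧
    0 ≤ a * (1 - α) * (∑ i, (p i) ^ α) ^ (1 / α - 2) * (∑ i, d i * (p i) ^ (α - 1)) ^ 2
       + a * (α - 1) * (∑ i, (p i) ^ α) ^ (1 / α - 1) * (∑ i, d i ^ 2 * (p i) ^ (α - 2))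
       + b * ∑ i, d i ^ 2 / p i := by
  have hev : ∀ᶠ t in nhds (0:ℝ), ∀ i, d i ≠ 0 → 0 < p i + t * d i := by
    rw [Filter.eventually_all]
    intro i
    by_cases h : d i = 0
    · simp [h]
    · have hc : ContinuousAt (fun t : ℝ => p i + t * d i) 0 := by fun_prop
      have : ∀ᶠ t in nhds (0:ℝ), 0 < p i + t * d i :=
        hc.eventually (lt_mem_nhds (by simpa using hd0 i h))
      exact this.mono (fun t ht _ => ht)
  have hpv : ∀ᶠ t in nhds (0:ℝ), IsProbVec (fun i => p i + t * d i) := by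
    filter_upwards [hev] with t ht
    refine ⟨fun i => ?_, ?_⟩
    · by_cases h : d i = 0
      · simpa [h] using hp.1 i
      · exact (ht i h).le
    · rw [Finset.sum_add_distrib, ← Finset.mul_sum, hd, hp.2]; simp
  have key := second_order_test (fun t => FF a b α (fun i => p i + t * d i)) _ _
    (by
      filter_upwards [hpv] with t ht
      simpa using hmin _ ht)
    (by
      filter_upwards [hev, hpv] with t h1 h2
      exact line_deriv a b α hα p d t h1 (sum_rpow_pos α _ h2))
    (line_deriv2 a b α hα p d hd0 (sum_rpow_pos α _ hp))
  refine ⟨?_, key.2⟩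
  have := key.1
  simp only [zero_mul, add_zero, mul_add, Finset.sum_add_distrib, mul_one, hd] at this
  simpa using this

lemma exists_min {n : ℕ} (hn : 0 < n) (a b α : ℝ) (hα : 0 < α) :
    ∃ p : Fin n → ℝ, IsProbVec p ∧ ∀ p' : Fin n → ℝ, IsProbVec p' → FF a b α p ≤ FF a b α p' := by
  have hc : Continuous (fun p : Fin n → ℝ => FF a b α p) := by
    unfold FF lNorm
    have h1 : ∀ i : Fin n, Continuous (fun p : Fin n → ℝ => p i ^ α) := fun i =>
      (continuous_apply i).rpow_const (fun _ => Or.inr hα.le)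
    have h2 : ∀ i : Fin n, Continuous (fun p : Fin n → ℝ => p i * Real.log (p i)) := fun i =>
      Real.continuous_mul_log.comp (continuous_apply i)
    have h3 : Continuous (fun p : Fin n → ℝ => (∑ i, p i ^ α) ^ (1 / α)) :=
      (continuous_finsetSum _ (fun i _ => h1 i)).rpow_const
        (fun _ => Or.inr (by positivity))
    exact (h3.const_mul a).add ((continuous_finsetSum _ (fun i _ => h2 i)).const_mul b)
  have : Nonempty (Fin n) := ⟨⟨0, hn⟩⟩
  obtain ⟨p, hp, hm⟩ := (isCompact_stdSimplex ℝ (Fin n)).exists_isMinOn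
    ⟨_, single_mem_stdSimplex ℝ (⟨0, hn⟩ : Fin n)⟩ hc.continuousOn
  exact ⟨p, hp, fun p' hp' => hm hp'⟩


lemma sum_form {n : ℕ} (R : Finset (Fin n)) (j : Fin n) (hj : j ∉ R) (φ : Fin n → ℝ) (u v : ℝ)
    (hu : φ j = u) (hv : ∀ l ∈ R, φ l = v) (h0 : ∀ l, l ≠ j → l ∉ R → φ l = 0) :
    ∑ l, φ l = u + R.card * v := by
  rw [← Finset.sum_subset (Finset.subset_univ (insert j R))
    (fun l _ hl => by
      rw [Finset.mem_insert, not_or] at hl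
      exact h0 l hl.1 hl.2), Finset.sum_insert hj, hu, Finset.sum_congr rfl hv]
  simp

lemma log_ineq1 (v : ℝ) (hv : 1 ≤ v) : 2 * (v - 1) ≤ (v + 1) * Real.log v := by
  have hm : MonotoneOn (fun v : ℝ => (v + 1) * Real.log v - 2 * (v - 1)) (Set.Ici 1) := by
    apply monotoneOn_of_deriv_nonneg (convex_Ici 1)
    · apply ContinuousOn.sub
      · apply ContinuousOn.mul (by fun_prop)
        exact Real.continuousOn_log.mono (fun x hx => by
          have : (1:ℝ) ≤ x := hx
          simp; linarith)
      · fun_prop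
    · intro x hx
      rw [interior_Ici] at hx
      have : (0:ℝ) < x := lt_trans one_pos hx
      exact DifferentiableAt.differentiableWithinAt (by fun_prop (disch := exact this.ne'))
    · intro x hx
      rw [interior_Ici] at hx
      have h0 : (0:ℝ) < x := lt_trans one_pos hx
      have hd : HasDerivAt (fun v : ℝ => (v + 1) * Real.log v - 2 * (v - 1))
          ((1 * Real.log x + (x + 1) * x⁻¹) - 2 * 1) x :=
        (((hasDerivAt_id x).add_const 1).mul (Real.hasDerivAt_log h0.ne')).sub
          (((hasDerivAt_id x).sub_const 1).const_mul 2)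
      rw [hd.deriv]
      have := Real.one_sub_inv_le_log_of_pos h0
      have e : (x + 1) * x⁻¹ = 1 + x⁻¹ := by field_simp
      rw [e]; linarith
  have := hm (Set.mem_Ici.2 le_rfl) (Set.mem_Ici.2 hv) hv
  simp at this
  linarith

lemma log_ineq2 (v : ℝ) (h0 : 0 < v) (hv : v ≤ 1) : 0 ≤ 1 / v - v + 2 * Real.log v := by
  have h1 : 0 ≤ -Real.log v := by have := Real.log_nonpos h0.le hv; linarith
  have := Real.self_le_sinh_iff.2 h1
  rw [Real.sinh_eq, neg_neg, Real.exp_log h0, Real.exp_neg, Real.exp_log h0] at this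
  rw [one_div]; linarith

lemma log_ineq3 (v : ℝ) (h0 : 0 < v) (hv : v ≠ 1) : 0 < 1 / v - 1 + Real.log v := by
  have := Real.log_lt_sub_one_of_pos (x := 1 / v) (by positivity) (by
    intro h; apply hv; field_simp at h; exact h.symm)
  rw [Real.log_div one_ne_zero h0.ne', Real.log_one] at this
  linarith

lemma convex_pair (α c T x y : ℝ) (hα : α ≠ 1) (hT : 0 < T) (hx : 0 < x) (hxy : x < y)
    (h : T * x ^ (α - 1) + c * Real.log x = T * y ^ (α - 1) + c * Real.log y) :
    T * (α - 1) * x ^ (α - 1) + c < 0 ∧ 0 < T * (α - 1) * y ^ (α - 1) + c := by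
  have hy : 0 < y := hx.trans hxy
  have hL : 0 < Real.log y - Real.log x := sub_pos.2 (Real.log_lt_log hx hxy)
  have ha : α - 1 ≠ 0 := sub_ne_zero.2 hα
  rw [Real.rpow_def_of_pos hx, Real.rpow_def_of_pos hy] at *
  set X := Real.log x
  set Y := Real.log y
  have hne : X * (α - 1) ≠ Y * (α - 1) := by
    intro h; have := mul_right_cancel₀ ha h; linarith
  have e1 : Real.exp (X * (α - 1)) * ((Y - X) * (α - 1)) <
      Real.exp (Y * (α - 1)) - Real.exp (X * (α - 1)) := by
    have := Real.add_one_lt_exp (x := Y * (α - 1) - X * (α - 1)) (sub_ne_zero.2 hne.symm)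
    rw [Real.exp_sub, lt_div_iff₀ (Real.exp_pos _)] at this
    linarith
  have e2 : Real.exp (Y * (α - 1)) - Real.exp (X * (α - 1)) <
      Real.exp (Y * (α - 1)) * ((Y - X) * (α - 1)) := by
    have := Real.add_one_lt_exp (x := X * (α - 1) - Y * (α - 1)) (sub_ne_zero.2 hne)
    rw [Real.exp_sub, lt_div_iff₀ (Real.exp_pos _)] at this
    linarith
  have f1 := mul_lt_mul_of_pos_left e1 hT
  have f2 := mul_lt_mul_of_pos_left e2 hT
  constructor
  · by_contra hc
    push Not at hc
    have := mul_nonneg hc hL.le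
    linarith
  · by_contra hc
    push Not at hc
    have := mul_nonneg (neg_nonneg.2 hc) hL.le
    linarith

lemma crit_pair {n : ℕ} (a b α : ℝ) (hα : 0 < α) (p : Fin n → ℝ) (hp : IsProbVec p)
    (hmin : ∀ p' : Fin n → ℝ, IsProbVec p' → FF a b α p ≤ FF a b α p')
    (i j : Fin n) (hij : i ≠ j) (hi : 0 < p i) (hj : 0 < p j) :
    a * ((∑ i, p i ^ α) ^ (1 / α - 1) * p i ^ (α - 1)) + b * Real.log (p i) =
      a * ((∑ i, p i ^ α) ^ (1 / α - 1) * p j ^ (α - 1)) + b * Real.log (p j) ∧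
    (p i = p j → 0 ≤ a * ((∑ i, p i ^ α) ^ (1 / α - 1) * (α - 1) * p i ^ (α - 1)) + b) := by
  set d : Fin n → ℝ := fun l => if l = j then -1 else if l = i then 1 else 0 with hd
  have hdj : d j = -1 := by simp [hd]
  have hdi : d i = 1 := by simp [hd, hij]
  have hdl : ∀ l, l ≠ j → l ∉ ({i} : Finset (Fin n)) → d l = 0 := by
    intro l h1 h2
    simp only [Finset.mem_singleton] at h2
    simp [hd, h1, h2]
  have hjn : j ∉ ({i} : Finset (Fin n)) := by simpa using hij.symm
  have key : ∀ φ : Fin n → ℝ, ∀ u v, φ j = u → φ i = v → (∀ l, d l = 0 → φ l = 0) →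
      ∑ l, φ l = u + v := by
    intro φ u v h1 h2 h3
    rw [sum_form {i} j hjn φ u v h1 (by simpa using h2) (fun l h h' => h3 l (hdl l h h'))]
    simp
  obtain ⟨c1, c2⟩ := crit a b α hα p hp hmin d
    (by rw [key d (-1) 1 hdj hdi (fun l h => h)]; norm_num)
    (by
      intro l hl
      by_cases h1 : l = j
      · rwa [h1]
      · by_cases h2 : l = i
        · rwa [h2]
        · exact absurd (hdl l h1 (by simpa using h2)) hl)
  have s1 : ∑ l, d l * p l ^ (α - 1) = -p j ^ (α - 1) + p i ^ (α - 1) :=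
    key _ _ _ (by simp [hdj]) (by simp [hdi]) (fun l h => by simp [h])
  have s2 : ∑ l, d l * Real.log (p l) = -Real.log (p j) + Real.log (p i) :=
    key _ _ _ (by simp [hdj]) (by simp [hdi]) (fun l h => by simp [h])
  have s3 : ∑ l, d l ^ 2 * p l ^ (α - 2) = p j ^ (α - 2) + p i ^ (α - 2) :=
    key _ _ _ (by simp [hdj]) (by simp [hdi]) (fun l h => by simp [h])
  have s4 : ∑ l, d l ^ 2 / p l = 1 / p j + 1 / p i :=
    key _ _ _ (by simp [hdj]) (by simp [hdi]) (fun l h => by simp [h])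
  rw [s1, s2] at c1
  rw [s1, s3, s4] at c2
  refine ⟨by linear_combination c1, fun h => ?_⟩
  rw [← h] at c2
  have e : p i ^ (α - 2) = p i ^ (α - 1) / p i := by
    rw [← Real.rpow_sub_one hi.ne']; congr 1; ring
  rw [e] at c2
  have : 0 ≤ (2 / p i) * (a * ((∑ i, p i ^ α) ^ (1 / α - 1) * (α - 1) * p i ^ (α - 1)) + b) := by
    convert c2 using 1; ring
  exact nonneg_of_mul_nonneg_right this (by positivity)

lemma no_mixed (α c k r s S : ℝ) (hα : 0 < α) (hα1 : α ≠ 1) (hk : 1 ≤ k) (hs : 0 < s) (hrs : s < r)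
    (hsum : k * r + s = 1) (hS : S = s ^ α + k * r ^ α)
    (h1 : S ^ (1 / α - 1) * (s ^ (α - 1) - r ^ (α - 1)) + c * (Real.log s - Real.log r) = 0)
    (h2 : 0 ≤ (1 - α) * S ^ (1 / α - 2) * (s ^ (α - 1) - r ^ (α - 1)) ^ 2 +
      (α - 1) * S ^ (1 / α - 1) * (s ^ (α - 2) + r ^ (α - 2) / k) + c * (1 / s + 1 / (k * r))) :
    False := by
  have hr : 0 < r := hs.trans hrs
  have hk0 : 0 < k := by linarith
  have hX : 0 < s ^ (α - 1) := Real.rpow_pos_of_pos hs _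
  have hY : 0 < r ^ (α - 1) := Real.rpow_pos_of_pos hr _
  have es : s ^ α = s * s ^ (α - 1) := by rw [Real.rpow_sub_one hs.ne']; field_simp
  have er : r ^ α = r * r ^ (α - 1) := by rw [Real.rpow_sub_one hr.ne']; field_simp
  have es2 : s ^ (α - 2) = s ^ (α - 1) / s := by
    rw [← Real.rpow_sub_one hs.ne']; congr 1; ring
  have er2 : r ^ (α - 2) = r ^ (α - 1) / r := by
    rw [← Real.rpow_sub_one hr.ne']; congr 1; ring
  have hL : 0 < Real.log r - Real.log s := sub_pos.2 (Real.log_lt_log hs hrs)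
  have hlogX : Real.log (s ^ (α - 1)) = (α - 1) * Real.log s := Real.log_rpow hs _
  have hlogY : Real.log (r ^ (α - 1)) = (α - 1) * Real.log r := Real.log_rpow hr _
  have hvz : 1 < α → s ^ (α - 1) < r ^ (α - 1) := fun h =>
    Real.rpow_lt_rpow hs.le hrs (by linarith)
  have hvz' : α < 1 → r ^ (α - 1) < s ^ (α - 1) := fun h =>
    Real.rpow_lt_rpow_of_neg hs hrs (by linarith)
  have hvz2 : s ^ α < r ^ α := Real.rpow_lt_rpow hs.le hrs hα
  rw [es, er] at hS hvz2
  have hSpos : 0 < S := by rw [hS]; positivity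
  have eS : S ^ (1 / α - 2) = S ^ (1 / α - 1) / S := by
    rw [← Real.rpow_sub_one hSpos.ne']; congr 1; ring
  have hT : 0 < S ^ (1 / α - 1) := Real.rpow_pos_of_pos hSpos _
  rw [es2, er2, eS] at h2
  generalize S ^ (1 / α - 1) = T at *
  generalize s ^ (α - 1) = X at *
  generalize r ^ (α - 1) = Y at *
  set L := Real.log r - Real.log s with hLdef
  have hc : c * L = T * (X - Y) := by rw [hLdef]; linarith
  have main : (1 - α) * L * (X * Y) ≤ S * (X - Y) := by
    have h3 := mul_nonneg h2 (by positivity : 0 ≤ S * L / T * (k * r * s))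
    have e : ((1 - α) * (T / S) * (X - Y) ^ 2 + (α - 1) * T * (X / s + Y / r / k) +
      c * (1 / s + 1 / (k * r))) * (S * L / T * (k * r * s)) =
      (1 - α) * L * ((X - Y) ^ 2 * (k * r * s) - S * (X * k * r + Y * s)) +
        S / T * (c * L) * (k * r + s) := by
      field_simp
      ring
    rw [e, hc, hsum] at h3
    have e2 : (X - Y) ^ 2 * (k * r * s) - S * (X * k * r + Y * s) = - (X * Y) * (k * r + s) ^ 2 := by
      rw [hS]; ring
    have e3 : S / T * (T * (X - Y)) = S * (X - Y) := by field_simp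
    rw [e2, e3, hsum] at h3
    linarith
  have hv : 0 < X / Y := by positivity
  have hlv : Real.log (X / Y) = (1 - α) * L := by
    rw [Real.log_div hX.ne' hY.ne', hlogX, hlogY, hLdef]; ring
  have main2 : Real.log (X / Y) ≤ s * (X / Y - 1) + k * r * (1 - 1 / (X / Y)) := by
    rw [hlv]
    have : s * (X / Y - 1) + k * r * (1 - 1 / (X / Y)) = S * (X - Y) / (X * Y) := by
      rw [hS]; field_simp
    rw [this, le_div_iff₀ (by positivity)]
    exact main
  have hv1 : X / Y ≠ 1 := by
    rw [Ne, div_eq_one_iff_eq hY.ne']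
    rcases lt_or_gt_of_ne hα1 with h | h
    · exact (hvz' h).ne'
    · exact (hvz h).ne
  have hM := log_ineq3 _ hv hv1
  have main3 : k * r * (1 / (X / Y) - 1 + Real.log (X / Y)) ≤
      s * (X / Y - 1 - Real.log (X / Y)) := by
    have : Real.log (X / Y) = (k * r + s) * Real.log (X / Y) := by rw [hsum]; ring
    linarith
  have hkr : r * (1 / (X / Y) - 1 + Real.log (X / Y)) ≤
      k * r * (1 / (X / Y) - 1 + Real.log (X / Y)) := by
    apply mul_le_mul_of_nonneg_right _ hM.le
    nlinarith
  rcases lt_or_gt_of_ne hα1 with h | h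
  · have hv2 : 1 < X / Y := by rw [one_lt_div hY]; exact hvz' h
    have hzv : s * (X / Y) < r := by
      rw [mul_div_assoc', div_lt_iff₀ hY]; exact hvz2
    have h5 := mul_lt_mul_of_pos_right hzv hM
    have h6 := log_ineq1 _ hv2.le
    have h7 := mul_le_mul_of_nonneg_left h6 hs.le
    have h8 : s * (X / Y) * (1 / (X / Y) - 1 + Real.log (X / Y)) =
      s * (1 - X / Y + X / Y * Real.log (X / Y)) := by
      generalize X / Y = v at *
      field_simp
    linarith
  · have hv2 : X / Y < 1 := by rw [div_lt_one hY]; exact hvz h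
    have h5 := mul_lt_mul_of_pos_right hrs hM
    have h6 := log_ineq2 _ hv hv2.le
    have h7 := mul_le_mul_of_nonneg_left h6 hs.le
    linarith

lemma lemA {n : ℕ} (hn : 0 < n) (α c : ℝ) (hα : 0 < α) (hα1 : α ≠ 1) :
    ∃ k : ℕ, 1 ≤ k ∧ ∀ p : Fin n → ℝ, IsProbVec p →
      (k : ℝ) ^ (1 / α - 1) - c * Real.log k ≤ lNorm α p - c * shannonEntropy p := by
  obtain ⟨p, hp, hmin⟩ := exists_min hn 1 c α hα
  suffices h : ∃ k : ℕ, 1 ≤ k ∧ (k : ℝ) ^ (1 / α - 1) - c * Real.log k = FF 1 c α p by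
    obtain ⟨k, hk, hk2⟩ := h
    refine ⟨k, hk, fun p' hp' => ?_⟩
    rw [hk2]
    refine (hmin p' hp').trans (le_of_eq ?_)
    unfold FF shannonEntropy; ring
  have hSpos := sum_rpow_pos α p hp
  have hT : 0 < (∑ i, p i ^ α) ^ (1 / α - 1) := Real.rpow_pos_of_pos hSpos _
  obtain ⟨i0, hi0⟩ : ∃ i, 0 < p i := by
    by_contra h
    push Not at h
    have := Finset.sum_nonpos (s := Finset.univ) (fun i _ => h i)
    rw [hp.2] at this; linarith
  have hzero : ∀ l, ¬ 0 < p l → p l = 0 := fun l h => le_antisymm (not_lt.1 h) (hp.1 l)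
  by_cases heq : ∀ i j, 0 < p i → 0 < p j → p i = p j
  · set R := Finset.univ.filter (fun l => 0 < p l ∧ l ≠ i0) with hR
    have hnot : i0 ∉ R := by simp [hR]
    have key : ∀ φ : ℝ → ℝ, φ 0 = 0 → ∑ l, φ (p l) = ((R.card + 1 : ℕ) : ℝ) * φ (p i0) := by
      intro φ h0
      rw [sum_form R i0 hnot (fun l => φ (p l)) (φ (p i0)) (φ (p i0)) rfl]
      · push_cast; ring
      · intro l hl
        simp only [hR, Finset.mem_filter] at hl
        show φ (p l) = φ (p i0)
        rw [heq l i0 hl.2.1 hi0]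
      · intro l h1 h2
        simp only [hR, Finset.mem_filter, Finset.mem_univ, true_and, not_and_or, h1,
          not_true_eq_false, not_false_eq_true, Ne, or_false] at h2
        show φ (p l) = 0
        rw [hzero l h2, h0]
    have hk1 := key (fun x => x) rfl
    rw [hp.2] at hk1
    have hk2 := key (fun x => x ^ α) (Real.zero_rpow hα.ne')
    have hk3 := key (fun x => x * Real.log x) (by simp)
    refine ⟨R.card + 1, by omega, ?_⟩
    have hkpos : (0:ℝ) < ((R.card + 1 : ℕ) : ℝ) := by positivity
    generalize ((R.card + 1 : ℕ) : ℝ) = k at *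
    have hpi : p i0 = k⁻¹ := by field_simp; linarith
    unfold FF lNorm
    rw [hk2, hk3, hpi, Real.log_inv, Real.inv_rpow hkpos.le, ← Real.rpow_neg hkpos.le,
      ← Real.rpow_one_add' hkpos.le (by intro h; apply hα1; linarith), ← Real.rpow_mul hkpos.le]
    have e1 : (1 + -α) * (1 / α) = 1 / α - 1 := by field_simp; ring
    rw [e1]
    field_simp
    ring
  · exfalso
    have : ∃ i j, 0 < p j ∧ p j < p i := by
      push Not at heq
      obtain ⟨i, j, h1, h2, h3⟩ := heq
      rcases lt_or_gt_of_ne h3 with h | h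
      · exact ⟨j, i, h1, h⟩
      · exact ⟨i, j, h2, h⟩
    obtain ⟨i, j, hj, hji⟩ := this
    have hi := hj.trans hji
    have cp := crit_pair 1 c α hα p hp hmin
    have hpair : ∀ x y, 0 < p x → p x < p y →
        (∑ i, p i ^ α) ^ (1 / α - 1) * (α - 1) * (p x) ^ (α - 1) + c < 0 ∧
        0 < (∑ i, p i ^ α) ^ (1 / α - 1) * (α - 1) * (p y) ^ (α - 1) + c := by
      intro x y hx hxy
      apply convex_pair α c _ _ _ hα1 hT hx hxy
      have := (cp x y (by rintro rfl; exact lt_irrefl _ hxy) hx (hx.trans hxy)).1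
      linarith
    have huniq : ∀ l, 0 < p l → l ≠ j → p l = p i := by
      intro l hl hlj
      rcases lt_trichotomy (p l) (p j) with h | h | h
      · have := (hpair l j hl h).2
        have := (hpair j i hj hji).1
        linarith
      · have := (cp l j hlj hl hj).2 h
        rw [h] at this
        have := (hpair j i hj hji).1
        linarith
      · rcases lt_trichotomy (p l) (p i) with h' | h' | h'
        · have := (hpair l i hl h').1
          have := (hpair j l hj h).2
          linarith
        · exact h'
        · have := (hpair i l hi h').1
          have := (hpair j i hj hji).2
          linarith
    set R := Finset.univ.filter (fun l => 0 < p l ∧ l ≠ j) with hR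
    have hnot : j ∉ R := by simp [hR]
    have hRmem : ∀ l ∈ R, p l = p i := by
      intro l hl
      simp only [hR, Finset.mem_filter] at hl
      exact huniq l hl.2.1 hl.2.2
    have hoff : ∀ l, l ≠ j → l ∉ R → p l = 0 := by
      intro l h1 h2
      simp only [hR, Finset.mem_filter, Finset.mem_univ, true_and, not_and_or, h1,
          not_true_eq_false, not_false_eq_true, Ne, or_false] at h2
      exact hzero l h2
    have hiR : i ∈ R := by
      simp only [hR, Finset.mem_filter, Finset.mem_univ, true_and]
      exact ⟨hi, by rintro rfl; exact lt_irrefl _ hji⟩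
    have hk : (1:ℝ) ≤ R.card := by
      exact_mod_cast Finset.card_pos.2 ⟨i, hiR⟩
    have hk0 : (0:ℝ) < R.card := by linarith
    set k : ℝ := (R.card : ℝ) with hkdef
    set d : Fin n → ℝ := fun l => if l = j then 1 else if l ∈ R then -(1 / k) else 0 with hd
    have hdj : d j = 1 := by simp [hd]
    have hdR : ∀ l ∈ R, d l = -(1 / k) := by
      intro l hl
      have : l ≠ j := by rintro rfl; exact hnot hl
      simp [hd, this, hl]
    have hdo : ∀ l, l ≠ j → l ∉ R → d l = 0 := by
      intro l h1 h2; simp [hd, h1, h2]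
    have s0 : ∑ l, d l = 0 := by
      rw [sum_form R j hnot d _ _ hdj hdR hdo]; field_simp; ring
    have ssum : ∑ l, p l = p j + k * p i := sum_form R j hnot _ _ _ rfl hRmem hoff
    have sS : ∑ l, p l ^ α = p j ^ α + k * p i ^ α :=
      sum_form R j hnot _ _ _ rfl (fun l hl => by rw [hRmem l hl])
        (fun l h1 h2 => by rw [hoff l h1 h2, Real.zero_rpow hα.ne'])
    obtain ⟨c1, c2⟩ := crit 1 c α hα p hp hmin d s0 (by
      intro l hl
      by_cases h1 : l = j
      · rwa [h1]
      · by_cases h2 : l ∈ R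
        · rw [hRmem l h2]; exact hi
        · exact absurd (hdo l h1 h2) hl)
    have s1 : ∑ l, d l * p l ^ (α - 1) = p j ^ (α - 1) + k * (-(1 / k) * p i ^ (α - 1)) :=
      sum_form R j hnot _ _ _ (by simp [hdj]) (fun l hl => by rw [hRmem l hl, hdR l hl])
        (fun l h1 h2 => by simp [hdo l h1 h2])
    have s2 : ∑ l, d l * Real.log (p l) = Real.log (p j) + k * (-(1 / k) * Real.log (p i)) :=
      sum_form R j hnot _ _ _ (by simp [hdj]) (fun l hl => by rw [hRmem l hl, hdR l hl])
        (fun l h1 h2 => by simp [hdo l h1 h2])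
    have s3 : ∑ l, d l ^ 2 * p l ^ (α - 2) = p j ^ (α - 2) + k * ((-(1 / k)) ^ 2 * p i ^ (α - 2)) :=
      sum_form R j hnot _ _ _ (by simp [hdj]) (fun l hl => by rw [hRmem l hl, hdR l hl])
        (fun l h1 h2 => by simp [hdo l h1 h2])
    have s4 : ∑ l, d l ^ 2 / p l = 1 / p j + k * ((-(1 / k)) ^ 2 / p i) :=
      sum_form R j hnot _ _ _ (by simp [hdj]) (fun l hl => by rw [hRmem l hl, hdR l hl])
        (fun l h1 h2 => by simp [hdo l h1 h2])
    have e : ∀ x : ℝ, k * (-(1 / k) * x) = -x := fun x => by field_simp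
    have e' : ∀ x : ℝ, k * ((-(1 / k)) ^ 2 * x) = x / k := fun x => by field_simp
    have e'' : k * ((-(1 / k)) ^ 2 / p i) = 1 / (k * p i) := by field_simp
    rw [s1, s2, e, e] at c1
    rw [s1, s3, s4, e, e', e''] at c2
    refine no_mixed α c k (p i) (p j) (∑ l, p l ^ α) hα hα1 hk hj hji
      (by rw [← hp.2, ssum]; ring) sS (by linarith) ?_
    refine c2.trans (le_of_eq ?_)
    ring


lemma chord (β : ℝ) (m k : ℕ) (hm : 1 ≤ m) (hk : 1 ≤ k) (c : ℝ)
    (hc : c = (((m : ℝ) + 1) ^ β - (m : ℝ) ^ β) / (Real.log ((m : ℝ) + 1) - Real.log m)) :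
    (m : ℝ) ^ β - c * Real.log m ≤ (k : ℝ) ^ β - c * Real.log k := by
  have hm0 : (0:ℝ) < m := by exact_mod_cast hm
  have hk0 : (0:ℝ) < k := by exact_mod_cast hk
  have hm10 : (0:ℝ) < (m:ℝ) + 1 := by positivity
  have hconv : ConvexOn ℝ Set.univ (fun t : ℝ => Real.exp (t * β)) := by
    have := convexOn_exp.comp_linearMap (LinearMap.mulRight ℝ β)
    simpa [Function.comp_def] using this
  rw [Real.rpow_def_of_pos hm0, Real.rpow_def_of_pos hm10] at hc
  rw [Real.rpow_def_of_pos hm0, Real.rpow_def_of_pos hk0]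
  have hlm : Real.log m < Real.log ((m:ℝ) + 1) := Real.log_lt_log hm0 (by linarith)
  have hL : 0 < Real.log ((m:ℝ) + 1) - Real.log m := sub_pos.2 hlm
  have hceq : c * (Real.log ((m:ℝ) + 1) - Real.log m) =
      Real.exp (Real.log ((m:ℝ) + 1) * β) - Real.exp (Real.log m * β) := by
    rw [hc]; field_simp
  rcases lt_trichotomy k m with h | h | h
  · have hlk : Real.log k < Real.log m := Real.log_lt_log hk0 (by exact_mod_cast h)
    have := hconv.slope_mono_adjacent (Set.mem_univ (Real.log k))
      (Set.mem_univ (Real.log ((m:ℝ) + 1))) hlk hlm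
    rw [← hc, div_le_iff₀ (sub_pos.2 hlk)] at this
    linarith
  · rw [h]
  · rcases eq_or_lt_of_le (Nat.succ_le_of_lt h) with h' | h'
    · have : (k:ℝ) = (m:ℝ) + 1 := by rw [← h']; push_cast; ring
      rw [this]; linarith
    · have hlk : Real.log ((m:ℝ) + 1) < Real.log k := Real.log_lt_log hm10 (by exact_mod_cast h')
      have := hconv.slope_mono_adjacent (Set.mem_univ (Real.log m))
        (Set.mem_univ (Real.log k)) hlm hlk
      rw [← hc, le_div_iff₀ (sub_pos.2 hlk)] at this
      linarith

lemma partA (n : ℕ) (hn : 2 ≤ n) (α : ℝ) (hα : 0 < α) (hα1 : α ≠ 1)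
    (m : ℕ) (q : Fin m → ℝ) (p : Fin m → Fin n → ℝ)
    (hq0 : ∀ y, 0 ≤ q y) (hq1 : ∑ y, q y = 1) (hp : ∀ y, IsProbVec (p y))
    (h' : ℝ) (hh' : 0 ≤ h') (hL : Lmin α h' = ∑ y, q y * lNorm α (p y)) :
      (α < 1 → ∑ y, q y * shannonEntropy (p y) ≤ h') ∧
      (1 < α → h' ≤ ∑ y, q y * shannonEntropy (p y)) := by
  unfold Lmin at hL
  have hM : 1 ≤ ⌊Real.exp h'⌋₊ := by
    rw [Nat.one_le_floor_iff]; exact Real.one_le_exp hh'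
  generalize ⌊Real.exp h'⌋₊ = M at hL hM
  have hm0 : (0:ℝ) < M := by exact_mod_cast hM
  have hm10 : (0:ℝ) < (M:ℝ) + 1 := by positivity
  have hlm : Real.log M < Real.log ((M:ℝ) + 1) := Real.log_lt_log hm0 (by linarith)
  have hL0 : 0 < Real.log ((M:ℝ) + 1) - Real.log M := sub_pos.2 hlm
  obtain ⟨c, hc⟩ : ∃ c, c = (((M : ℝ) + 1) ^ (1 / α - 1) - (M : ℝ) ^ (1 / α - 1)) /
    (Real.log ((M : ℝ) + 1) - Real.log M) := ⟨_, rfl⟩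
  obtain ⟨k, hk, hk2⟩ := lemA (n := n) (by omega) α c hα hα1
  have hch := chord (1 / α - 1) M k hM hk c hc
  have hsum : ∑ y, q y * ((M : ℝ) ^ (1 / α - 1) - c * Real.log M) ≤
      ∑ y, q y * (lNorm α (p y) - c * shannonEntropy (p y)) :=
    Finset.sum_le_sum (fun y _ => mul_le_mul_of_nonneg_left (hch.trans (hk2 _ (hp y))) (hq0 y))
  have e1 : ∑ y, q y * (lNorm α (p y) - c * shannonEntropy (p y)) =
      ∑ y, q y * lNorm α (p y) - c * ∑ y, q y * shannonEntropy (p y) := by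
    rw [Finset.mul_sum, ← Finset.sum_sub_distrib]
    exact Finset.sum_congr rfl (fun y _ => by ring)
  rw [← Finset.sum_mul, hq1, e1, ← hL] at hsum
  have e2 : (Real.log ((M:ℝ) + 1) - h') / (Real.log ((M:ℝ) + 1) - Real.log M) *
      (M:ℝ) ^ (1 / α - 1) + (1 - (Real.log ((M:ℝ) + 1) - h') /
      (Real.log ((M:ℝ) + 1) - Real.log M)) * ((M:ℝ) + 1) ^ (1 / α - 1) =
      (M:ℝ) ^ (1 / α - 1) + c * (h' - Real.log M) := by
    rw [hc]
    generalize (M:ℝ) ^ (1 / α - 1) = A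
    generalize ((M:ℝ) + 1) ^ (1 / α - 1) = B
    field_simp
    ring
  rw [e2] at hsum
  have fin : 0 ≤ c * (h' - ∑ y, q y * shannonEntropy (p y)) := by linarith
  constructor
  · intro h1
    have hb : 0 < 1 / α - 1 := by rw [sub_pos, lt_div_iff₀ hα]; linarith
    have hcpos : 0 < c := by
      rw [hc]; exact div_pos (sub_pos.2 (Real.rpow_lt_rpow hm0.le (by linarith) hb)) hL0
    linarith [nonneg_of_mul_nonneg_right fin hcpos]
  · intro h1
    have hb : 1 / α - 1 < 0 := by rw [sub_neg, div_lt_iff₀ hα]; linarith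
    have hcneg : c < 0 := by
      rw [hc]
      exact div_neg_of_neg_of_pos
        (sub_neg.2 (Real.rpow_lt_rpow_of_neg hm0 (by linarith) hb)) hL0
    nlinarith


lemma vsum (n : ℕ) (hn : 2 ≤ n) (s : ℝ) (φ : ℝ → ℝ) :
    ∑ l, φ (vVec n s l) = φ (1 - ((n:ℝ) - 1) * s) + ((n:ℝ) - 1) * φ s := by
  have h := sum_form (Finset.univ.erase (⟨0, by omega⟩ : Fin n)) ⟨0, by omega⟩
    (Finset.notMem_erase _ _) (fun l => φ (vVec n s l)) (φ (1 - ((n:ℝ) - 1) * s)) (φ s)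
    (by simp [vVec]) (by
      intro l hl
      have : (l : ℕ) ≠ 0 := fun h => (Finset.mem_erase.1 hl).1 (Fin.ext h)
      simp [vVec, this]) (by
      intro l h1 h2
      exact absurd (Finset.mem_erase.2 ⟨h1, Finset.mem_univ _⟩) h2)
  rw [h, Finset.card_erase_of_mem (Finset.mem_univ _)]
  simp only [Finset.card_univ, Fintype.card_fin]
  rw [Nat.cast_sub (by omega)]
  simp

lemma FF_v (n : ℕ) (hn : 2 ≤ n) (a b α s : ℝ) (p : Fin n → ℝ) (i : Fin n)
    (hi : p i = 1 - ((n:ℝ) - 1) * s) (h : ∀ l, l ≠ i → p l = s) :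
    FF a b α p = FF a b α (vVec n s) := by
  have key : ∀ φ : ℝ → ℝ, ∑ l, φ (p l) = ∑ l, φ (vVec n s l) := by
    intro φ
    rw [vsum n hn, sum_form (Finset.univ.erase i) i
      (Finset.notMem_erase _ _) (fun l => φ (p l)) (φ (1 - ((n:ℝ) - 1) * s)) (φ s)
      (by simp [hi]) (by
        intro l hl
        simp [h l (Finset.mem_erase.1 hl).1]) (by
        intro l h1 h2
        exact absurd (Finset.mem_erase.2 ⟨h1, Finset.mem_univ _⟩) h2),
      Finset.card_erase_of_mem (Finset.mem_univ _)]
    simp only [Finset.card_univ, Fintype.card_fin]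
    rw [Nat.cast_sub (by omega)]
    simp
  unfold FF lNorm
  rw [key (fun x => x ^ α), key (fun x => x * Real.log x)]

lemma max_pos {n : ℕ} (α c : ℝ) (hα : 0 < α)
    (hc : (α < 1 ∧ 0 < c) ∨ (1 < α ∧ c < 0)) (p : Fin n → ℝ) (hp : IsProbVec p)
    (hmin : ∀ p' : Fin n → ℝ, IsProbVec p' → FF (-1) (-c) α p ≤ FF (-1) (-c) α p') :
    ∀ i, 0 < p i := by
  intro i
  by_contra hi
  have hi : p i = 0 := le_antisymm (not_lt.1 hi) (hp.1 i)
  obtain ⟨j, hj⟩ : ∃ i, 0 < p i := by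
    by_contra h
    push Not at h
    have := Finset.sum_nonpos (s := Finset.univ) (fun i _ => h i)
    rw [hp.2] at this; linarith
  have hij : i ≠ j := by rintro rfl; linarith
  set d : Fin n → ℝ := fun l => if l = j then -1 else if l = i then 1 else 0 with hd
  have hdj : d j = -1 := by simp [hd]
  have hdi : d i = 1 := by simp [hd, hij]
  have hdl : ∀ l, l ≠ j → l ∉ ({i} : Finset (Fin n)) → d l = 0 := by
    intro l h1 h2
    simp only [Finset.mem_singleton] at h2
    simp [hd, h1, h2]
  have hjn : j ∉ ({i} : Finset (Fin n)) := by simpa using hij.symm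
  have key : ∀ φ : Fin n → ℝ, ∀ u v, φ j = u → φ i = v → (∀ l, d l = 0 → φ l = 0) →
      ∑ l, φ l = u + v := by
    intro φ u v h1 h2 h3
    rw [sum_form {i} j hjn φ u v h1 (by simpa using h2) (fun l h h' => h3 l (hdl l h h'))]
    simp
  have hcase : ∀ l, d l ≠ 0 → l = j ∨ l = i := by
    intro l hl
    by_contra h
    push Not at h
    exact hl (hdl l h.1 (by simpa using h.2))
  have hdsum : ∑ l, d l = 0 := by
    rw [key d (-1) 1 hdj hdi (fun l h => h)]; norm_num
  set f : ℝ → ℝ := fun t => FF (-1) (-c) α (fun l => p l + t * d l) with hf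
  set T : ℝ → ℝ := fun t => (∑ l, (p l + t * d l) ^ α) ^ (1 / α - 1) with hTdef
  have hpv : ∀ t, 0 ≤ t → t < p j → IsProbVec (fun l => p l + t * d l) := by
    intro t h0 h1
    refine ⟨fun l => ?_, ?_⟩
    · by_cases h : d l = 0
      · simpa [h] using hp.1 l
      · rcases hcase l h with rfl | rfl
        · show 0 ≤ p l + t * d l
          rw [hdj]; linarith
        · show 0 ≤ p l + t * d l
          rw [hdi]; linarith [hp.1 l]
    · rw [Finset.sum_add_distrib, ← Finset.mul_sum, hdsum, hp.2]; simp
  have hder : ∀ t, 0 < t → t < p j → HasDerivAt f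
      (-T t * (t ^ (α - 1) - (p j - t) ^ (α - 1)) - c * (Real.log t - Real.log (p j - t))) t := by
    intro t h0 h1
    have := line_deriv (-1) (-c) α hα p d t (by
      intro l hl
      rcases hcase l hl with rfl | rfl
      · rw [hdj]; linarith
      · rw [hdi, hi]; linarith) (sum_rpow_pos α _ (hpv t h0.le h1))
    refine HasDerivAt.congr_deriv this ?_
    rw [key (fun l => d l * (p l + t * d l) ^ (α - 1)) (-(p j - t) ^ (α - 1)) (t ^ (α - 1))
      (by simp [hdj, sub_eq_add_neg]) (by simp [hdi, hi]) (fun l h => by simp [h]),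
      key (fun l => d l * (Real.log (p l + t * d l) + 1)) (-(Real.log (p j - t) + 1))
        (Real.log t + 1)
      (by simp [hdj, sub_eq_add_neg]) (by simp [hdi, hi]) (fun l h => by simp [h])]
    simp only [hTdef]
    ring
  have hT0 : 0 < T 0 := by
    simp only [hTdef, zero_mul, add_zero]
    exact Real.rpow_pos_of_pos (sum_rpow_pos α p hp) _
  have hScont : Continuous (fun t : ℝ => ∑ l, (p l + t * d l) ^ α) := by
    refine continuous_finsetSum _ (fun l _ => ?_)
    exact Continuous.rpow_const (by fun_prop) (fun _ => Or.inr hα.le)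
  have hTc : Filter.Tendsto T (nhdsWithin 0 (Set.Ioi 0)) (nhds (T 0)) := by
    have : ContinuousAt T 0 := by
      apply ContinuousAt.rpow_const hScont.continuousAt
      left
      simpa using (sum_rpow_pos α p hp).ne'
    exact this.tendsto.mono_left nhdsWithin_le_nhds
  have hlogc : Filter.Tendsto (fun t => Real.log (p j - t)) (nhdsWithin 0 (Set.Ioi 0))
      (nhds (Real.log (p j))) := by
    have : ContinuousAt (fun t => Real.log (p j - t)) 0 := by
      apply ContinuousAt.log (by fun_prop); simpa using hj.ne'
    have := this.tendsto.mono_left (nhdsWithin_le_nhds (s := Set.Ioi 0))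
    simpa using this
  have hpowc : Filter.Tendsto (fun t => (p j - t) ^ (α - 1)) (nhdsWithin 0 (Set.Ioi 0))
      (nhds (p j ^ (α - 1))) := by
    have : ContinuousAt (fun t => (p j - t) ^ (α - 1)) 0 := by
      apply ContinuousAt.rpow_const (by fun_prop); left; simpa using hj.ne'
    have := this.tendsto.mono_left (nhdsWithin_le_nhds (s := Set.Ioi 0))
    simpa using this
  have hpow0 : ∀ γ : ℝ, 0 < γ → Filter.Tendsto (fun t : ℝ => t ^ γ) (nhdsWithin 0 (Set.Ioi 0))
      (nhds 0) := by
    intro γ hγ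
    have : ContinuousAt (fun t : ℝ => t ^ γ) 0 :=
      ContinuousAt.rpow_const (by fun_prop) (Or.inr hγ.le)
    have := this.tendsto.mono_left (nhdsWithin_le_nhds (s := Set.Ioi 0))
    simpa [Real.zero_rpow hγ.ne'] using this
  have hneg : ∀ᶠ t in nhdsWithin (0:ℝ) (Set.Ioi 0),
      -T t * (t ^ (α - 1) - (p j - t) ^ (α - 1)) - c * (Real.log t - Real.log (p j - t)) < 0 := by
    rcases hc with ⟨hα1, hc⟩ | ⟨hα1, hc⟩
    · have hlim : Filter.Tendsto (fun t : ℝ => -T t * (1 - t ^ (1 - α) * (p j - t) ^ (α - 1))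
          - c * (Real.log t * t ^ (1 - α) - t ^ (1 - α) * Real.log (p j - t)))
          (nhdsWithin 0 (Set.Ioi 0))
          (nhds (-T 0 * (1 - 0 * p j ^ (α - 1)) - c * (0 - 0 * Real.log (p j)))) := by
        have hp1 := hpow0 (1 - α) (by linarith)
        exact (hTc.neg.mul (tendsto_const_nhds.sub (hp1.mul hpowc))).sub
          (((tendsto_log_mul_rpow_nhdsGT_zero (by linarith)).sub (hp1.mul hlogc)).const_mul c)
      have hlt : -T 0 * (1 - 0 * p j ^ (α - 1)) - c * (0 - 0 * Real.log (p j)) < 0 := by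
        simpa using hT0
      filter_upwards [hlim.eventually (gt_mem_nhds hlt), self_mem_nhdsWithin] with t ht ht0
      have ht0 : 0 < t := ht0
      have hpp : 0 < t ^ (1 - α) := Real.rpow_pos_of_pos ht0 _
      have e : t ^ (1 - α) * t ^ (α - 1) = 1 := by
        rw [← Real.rpow_add ht0]; simp
      by_contra hcon
      push Not at hcon
      have := mul_nonneg hpp.le hcon
      have e2 : t ^ (1 - α) * (-T t * (t ^ (α - 1) - (p j - t) ^ (α - 1)) -
          c * (Real.log t - Real.log (p j - t))) =
          -T t * (1 - t ^ (1 - α) * (p j - t) ^ (α - 1))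
          - c * (Real.log t * t ^ (1 - α) - t ^ (1 - α) * Real.log (p j - t)) := by
        linear_combination (-T t) * e
      linarith
    · have hlim : Filter.Tendsto (fun t : ℝ => (-T t * (t ^ (α - 1) - (p j - t) ^ (α - 1))
          + c * Real.log (p j - t)) + (-c) * Real.log t)
          (nhdsWithin 0 (Set.Ioi 0)) Filter.atBot := by
        have hp1 := hpow0 (α - 1) (by linarith)
        exact ((hTc.neg.mul (hp1.sub hpowc)).add (hlogc.const_mul c)).add_atBot
          (Real.tendsto_log_nhdsGT_zero.const_mul_atBot (by linarith))
      filter_upwards [hlim.eventually (Filter.eventually_lt_atBot 0)] with t ht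
      linarith
  have hlt : ∀ᶠ t in nhdsWithin (0:ℝ) (Set.Ioi 0), t < p j :=
    (gt_mem_nhds hj).filter_mono nhdsWithin_le_nhds
  obtain ⟨ε, hε, hsub⟩ := mem_nhdsGT_iff_exists_Ioo_subset.1 (hneg.and hlt)
  have hε : (0:ℝ) < ε := hε
  have hfc : Continuous f := by
    have h1 : ∀ l : Fin n, Continuous (fun t : ℝ => (p l + t * d l) * Real.log (p l + t * d l)) :=
      fun l => Real.continuous_mul_log.comp (g := fun x => x * Real.log x)
        (f := fun t : ℝ => p l + t * d l) (by fun_prop)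
    have h3 : Continuous (fun t : ℝ => (∑ i, (p i + t * d i) ^ α) ^ (1 / α)) :=
      hScont.rpow_const (fun _ => Or.inr (by positivity))
    exact (h3.const_mul (-1)).add ((continuous_finsetSum _ (fun i _ => h1 i)).const_mul (-c))
  have hanti : StrictAntiOn f (Set.Icc 0 (ε / 2)) := by
    apply strictAntiOn_of_deriv_neg (convex_Icc _ _) hfc.continuousOn
    intro t ht
    rw [interior_Icc] at ht
    have := hsub (show t ∈ Set.Ioo 0 ε from ⟨ht.1, by linarith [ht.2]⟩)
    rw [(hder t ht.1 this.2).deriv]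
    exact this.1
  have h2 := hsub (show ε / 2 ∈ Set.Ioo 0 ε from ⟨by linarith, by linarith⟩)
  have h3 := hanti (show (0:ℝ) ∈ Set.Icc 0 (ε / 2) from ⟨le_rfl, by linarith⟩)
    (show ε / 2 ∈ Set.Icc 0 (ε / 2) from ⟨by linarith, le_rfl⟩) (by linarith)
  have h4 := hmin _ (hpv (ε / 2) (by linarith) h2.2)
  simp only [hf, zero_mul, add_zero] at h3
  linarith

lemma lemB (n : ℕ) (hn : 2 ≤ n) (α c : ℝ) (hα : 0 < α)
    (hc : (α < 1 ∧ 0 < c) ∨ (1 < α ∧ c < 0)) :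
    ∃ s ∈ Set.Icc (0:ℝ) (1 / (n:ℝ)), ∀ p : Fin n → ℝ, IsProbVec p →
      lNorm α p - c * shannonEntropy p ≤ lNorm α (vVec n s) - c * shannonEntropy (vVec n s) := by
  obtain ⟨p, hp, hmin⟩ := exists_min (n := n) (by omega) (-1) (-c) α hα
  have hα1 : α ≠ 1 := by rcases hc with h | h <;> [exact h.1.ne; exact h.1.ne']
  have hn0 : (0:ℝ) < n := by positivity
  have hn2 : (2:ℝ) ≤ n := by exact_mod_cast hn
  suffices h : ∃ s ∈ Set.Icc (0:ℝ) (1 / (n:ℝ)), FF (-1) (-c) α p = FF (-1) (-c) α (vVec n s) by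
    obtain ⟨s, hs, hs2⟩ := h
    refine ⟨s, hs, fun p' hp' => ?_⟩
    have := hmin p' hp'
    rw [hs2] at this
    unfold FF at this
    unfold shannonEntropy
    linarith
  have hpos := max_pos α c hα hc p hp hmin
  have hT : 0 < (∑ i, p i ^ α) ^ (1 / α - 1) := Real.rpow_pos_of_pos (sum_rpow_pos α p hp) _
  have hsumform : ∀ (i : Fin n) (s : ℝ), (∀ l, l ≠ i → p l = s) → p i = 1 - ((n:ℝ) - 1) * s := by
    intro i s h
    have := sum_form (Finset.univ.erase i) i
      (Finset.notMem_erase _ _) p (p i) s rfl (by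
        intro l hl
        simp [h l (Finset.mem_erase.1 hl).1]) (by
        intro l h1 h2
        exact absurd (Finset.mem_erase.2 ⟨h1, Finset.mem_univ _⟩) h2)
    rw [Finset.card_erase_of_mem (Finset.mem_univ _), hp.2] at this
    simp only [Finset.card_univ, Fintype.card_fin] at this
    rw [Nat.cast_sub (by omega)] at this
    simp at this
    linarith
  by_cases heq : ∀ i j, p i = p j
  · set i0 : Fin n := ⟨0, by omega⟩
    have h1 := hsumform i0 (p i0) (fun l _ => heq l i0)
    have h2 : p i0 = 1 / (n:ℝ) := by field_simp; linarith
    refine ⟨p i0, ⟨(hpos i0).le, h2.le⟩, FF_v n hn _ _ _ _ p i0 h1 (fun l _ => heq l i0)⟩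
  · have : ∃ i j, p j < p i := by
      push Not at heq
      obtain ⟨i, j, h3⟩ := heq
      rcases lt_or_gt_of_ne h3 with h | h
      · exact ⟨j, i, h⟩
      · exact ⟨i, j, h⟩
    obtain ⟨i, j, hji⟩ := this
    have cp := crit_pair (-1) (-c) α hα p hp hmin
    have hpair : ∀ x y, p x < p y →
        (∑ i, p i ^ α) ^ (1 / α - 1) * (α - 1) * (p x) ^ (α - 1) + c < 0 ∧
        0 < (∑ i, p i ^ α) ^ (1 / α - 1) * (α - 1) * (p y) ^ (α - 1) + c := by
      intro x y hxy
      apply convex_pair α c _ _ _ hα1 hT (hpos x) hxy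
      have := (cp x y (by rintro rfl; exact lt_irrefl _ hxy) (hpos x) (hpos y)).1
      linarith
    have huniq : ∀ l, l ≠ i → p l = p j := by
      intro l hli
      rcases lt_trichotomy (p l) (p i) with h | h | h
      · rcases lt_trichotomy (p l) (p j) with h' | h' | h'
        · have := (hpair l j h').2
          have := (hpair j i hji).1
          linarith
        · exact h'
        · have := (hpair j l h').2
          have := (hpair l i h).1
          linarith
      · have := (cp l i hli (hpos l) (hpos i)).2 h
        rw [h] at this
        have := (hpair j i hji).2
        linarith
      · have := (hpair i l h).1
        have := (hpair j i hji).2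
        linarith
    have h1 := hsumform i (p j) huniq
    refine ⟨p j, ⟨(hpos j).le, ?_⟩, FF_v n hn _ _ _ _ p i h1 huniq⟩
    rw [le_div_iff₀ hn0]
    linarith


lemma tangent_abs (b : ℝ) (H N D H' : ℝ → ℝ)
    (hHc : ContinuousOn H (Set.Icc 0 b)) (hNc : ContinuousOn N (Set.Icc 0 b))
    (hH : ∀ s ∈ Set.Ioo 0 b, HasDerivAt H (H' s) s) (hH' : ∀ s ∈ Set.Ioo 0 b, 0 < H' s)
    (hN : ∀ s ∈ Set.Ioo 0 b, HasDerivAt N (D s * H' s) s)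
    (hq : ∀ x y z, 0 < x → x < y → y < z → z < b → D y < max (D x) (D z))
    (st : ℝ) (hst : st ∈ Set.Ioo 0 b) (tang : (H b - H st) * D st = N b - N st)
    (s0 : ℝ) (hs0 : 0 < s0) (hs0' : s0 ≤ st) (s : ℝ) (hs : s ∈ Set.Icc 0 b) :
    N s - D s0 * H s ≤ N s0 - D s0 * H s0 := by
  have hGd : ∀ c, ∀ s ∈ Set.Ioo 0 b, HasDerivAt (fun s => N s - c * H s) ((D s - c) * H' s) s := by
    intro c s hs
    refine HasDerivAt.congr_deriv ((hN s hs).sub ((hH s hs).const_mul c)) (by ring)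
  have hGc : ∀ c, ContinuousOn (fun s => N s - c * H s) (Set.Icc 0 b) := fun c =>
    hNc.sub (continuousOn_const.mul hHc)
  have hdec : ∀ c x y, 0 ≤ x → x ≤ y → y ≤ b → (∀ s, x < s → s < y → D s ≤ c) →
      N y - c * H y ≤ N x - c * H x := by
    intro c x y hx hxy hy hD
    have : AntitoneOn (fun s => N s - c * H s) (Set.Icc x y) := by
      apply antitoneOn_of_deriv_nonpos (convex_Icc _ _)
      · exact (hGc c).mono (Set.Icc_subset_Icc hx hy)
      · intro s hs
        rw [interior_Icc] at hs
        exact (hGd c s ⟨by linarith [hs.1], by linarith [hs.2]⟩).differentiableAt.differentiableWithinAt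
      · intro s hs
        rw [interior_Icc] at hs
        have hs' : s ∈ Set.Ioo 0 b := ⟨by linarith [hs.1], by linarith [hs.2]⟩
        rw [(hGd c s hs').deriv]
        exact mul_nonpos_of_nonpos_of_nonneg (sub_nonpos.2 (hD s hs.1 hs.2)) (hH' s hs').le
    exact this (Set.left_mem_Icc.2 hxy) (Set.right_mem_Icc.2 hxy) hxy
  have hinc : ∀ c x y, 0 ≤ x → x ≤ y → y ≤ b → (∀ s, x < s → s < y → c ≤ D s) →
      N x - c * H x ≤ N y - c * H y := by
    intro c x y hx hxy hy hD
    have : MonotoneOn (fun s => N s - c * H s) (Set.Icc x y) := by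
      apply monotoneOn_of_deriv_nonneg (convex_Icc _ _)
      · exact (hGc c).mono (Set.Icc_subset_Icc hx hy)
      · intro s hs
        rw [interior_Icc] at hs
        exact (hGd c s ⟨by linarith [hs.1], by linarith [hs.2]⟩).differentiableAt.differentiableWithinAt
      · intro s hs
        rw [interior_Icc] at hs
        have hs' : s ∈ Set.Ioo 0 b := ⟨by linarith [hs.1], by linarith [hs.2]⟩
        rw [(hGd c s hs').deriv]
        exact mul_nonneg (sub_nonneg.2 (hD s hs.1 hs.2)) (hH' s hs').le
    exact this (Set.left_mem_Icc.2 hxy) (Set.right_mem_Icc.2 hxy) hxy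
  have hHm : ∀ x y, 0 ≤ x → x ≤ y → y ≤ b → H x ≤ H y := by
    intro x y hx hxy hy
    have : MonotoneOn H (Set.Icc x y) := by
      apply monotoneOn_of_deriv_nonneg (convex_Icc _ _)
      · exact hHc.mono (Set.Icc_subset_Icc hx hy)
      · intro s hs
        rw [interior_Icc] at hs
        exact (hH s ⟨by linarith [hs.1], by linarith [hs.2]⟩).differentiableAt.differentiableWithinAt
      · intro s hs
        rw [interior_Icc] at hs
        have hs' : s ∈ Set.Ioo 0 b := ⟨by linarith [hs.1], by linarith [hs.2]⟩
        rw [(hH s hs').deriv]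
        exact (hH' s hs').le
    exact this (Set.left_mem_Icc.2 hxy) (Set.right_mem_Icc.2 hxy) hxy
  obtain ⟨ξ, hξ, hξ2⟩ := exists_hasDerivAt_eq_zero (f := fun s => N s - D st * H s)
    (f' := fun s => (D s - D st) * H' s) hst.2
    ((hGc (D st)).mono (Set.Icc_subset_Icc hst.1.le le_rfl)) (by linarith)
    (fun x hx => hGd _ x ⟨hst.1.trans hx.1, hx.2⟩)
  have hξ0 : ξ ∈ Set.Ioo 0 b := ⟨hst.1.trans hξ.1, hξ.2⟩
  have hDξ : D ξ = D st := by
    rcases mul_eq_zero.1 hξ2 with h | h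
    · linarith
    · exact absurd h (hH' ξ hξ0).ne'
  have hleft : ∀ x, 0 < x → x < st → D st < D x := by
    intro x h0 h1
    have := hq x st ξ h0 h1 hξ.1 hξ.2
    rw [hDξ] at this
    rcases lt_max_iff.1 this with h | h
    · exact h
    · exact absurd h (lt_irrefl _)
  have hanti : ∀ x y, 0 < x → x < y → y ≤ st → D y < D x := by
    intro x y h0 h1 h2
    rcases eq_or_lt_of_le h2 with h | h
    · rw [h]; exact hleft x h0 (by linarith)
    · have := hq x y st h0 h1 h hst.2
      rcases lt_max_iff.1 this with h' | h'
      · exact h'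
      · exact absurd h' (not_lt.2 (hleft y (by linarith) h).le)
  have hmid : ∀ x, st < x → x < ξ → D x ≤ D st := by
    intro x h1 h2
    have := hq st x ξ hst.1 h1 h2 hξ.2
    rw [hDξ, max_self] at this
    exact this.le
  have hright : ∀ x, ξ < x → x < b → D st ≤ D x := by
    intro x h1 h2
    have := hq st ξ x hst.1 hξ.1 h1 h2
    rw [hDξ] at this
    rcases lt_max_iff.1 this with h | h
    · exact absurd h (lt_irrefl _)
    · exact h.le
  have hstar : ∀ s, st ≤ s → s ≤ b → N s - D st * H s ≤ N st - D st * H st := by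
    intro s h1 h2
    rcases le_total s ξ with h | h
    · exact hdec _ _ _ hst.1.le h1 h2 (fun x hx hx' => hmid x hx (by linarith))
    · have := hinc (D st) s b (by linarith [hξ0.1]) h2 le_rfl
        (fun x hx hx' => hright x (by linarith) hx')
      linarith
  have hcc : D st ≤ D s0 := by
    rcases eq_or_lt_of_le hs0' with h | h
    · rw [h]
    · exact (hleft s0 hs0 h).le
  rcases le_total s s0 with h | h
  · exact hinc _ _ _ hs.1 h (by linarith [hst.2])
      (fun x hx hx' => (hanti x s0 (by linarith [hs.1]) hx' hs0').le)
  · rcases le_total s st with h' | h'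
    · exact hdec _ _ _ hs0.le h hs.2 (fun x hx hx' => (hanti s0 x hs0 hx (by linarith)).le)
    · have h1 := hdec (D s0) s0 st hs0.le hs0' hst.2.le
        (fun x hx hx' => (hanti s0 x hs0 hx hx'.le).le)
      have h2 := hstar s h' hs.2
      have h3 := mul_nonneg (sub_nonneg.2 hcc) (sub_nonneg.2 (hHm st s hst.1.le h' hs.2))
      linarith

lemma quasi_convex_of (b : ℝ) (D D' : ℝ → ℝ) (hD : ∀ s ∈ Set.Ioo 0 b, HasDerivAt D (D' s) s)
    (hP : ∀ x y, 0 < x → x < y → y < b → 0 ≤ D' x → 0 < D' y) :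
    ∀ x y z, 0 < x → x < y → y < z → z < b → D y < max (D x) (D z) := by
  intro x y z hx hxy hyz hzb
  rw [lt_max_iff]
  by_contra hcon
  push Not at hcon
  have hmvt : ∀ u v, 0 < u → u < v → v < b → ∃ ξ ∈ Set.Ioo u v, D' ξ = (D v - D u) / (v - u) := by
    intro u v hu huv hv
    apply exists_hasDerivAt_eq_slope D D' huv
    · intro t ht
      exact (hD t ⟨by linarith [ht.1], by linarith [ht.2]⟩).continuousAt.continuousWithinAt
    · intro t ht
      exact hD t ⟨by linarith [ht.1], by linarith [ht.2]⟩
  obtain ⟨ξ, h1, h2⟩ := hmvt x y hx hxy (by linarith)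
  obtain ⟨η, h3, h4⟩ := hmvt y z (by linarith) hyz hzb
  have h5 : 0 ≤ D' ξ := by rw [h2]; exact div_nonneg (by linarith) (by linarith)
  have h6 := hP ξ η (by linarith [h1.1]) (by linarith [h1.2, h3.1]) (by linarith [h3.2]) h5
  rw [h4] at h6
  have h7 : (D z - D y) / (z - y) ≤ 0 := div_nonpos_of_nonpos_of_nonneg (by linarith) (by linarith)
  linarith

lemma log_ineq4 (v : ℝ) (hv : 1 ≤ v) : v * Real.log v ^ 2 ≤ (v - 1) ^ 2 := by
  have h0 : 0 < v := by linarith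
  have hs0 : 0 < Real.sqrt v := Real.sqrt_pos.2 h0
  have hs1 : 1 ≤ Real.sqrt v := Real.one_le_sqrt.2 hv
  have h := log_ineq2 (Real.sqrt v)⁻¹ (by positivity) (inv_le_one_of_one_le₀ hs1)
  have hsq : Real.sqrt v ^ 2 = v := Real.sq_sqrt h0.le
  rw [Real.log_inv, Real.log_sqrt h0.le, one_div, inv_inv] at h
  have hl : 0 ≤ Real.log v := Real.log_nonneg hv
  have h1 : Real.sqrt v * Real.log v ≤ v - 1 := by
    have := mul_le_mul_of_nonneg_left (show Real.log v ≤ Real.sqrt v - (Real.sqrt v)⁻¹ by linarith)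
      hs0.le
    have e : Real.sqrt v * (Real.sqrt v - (Real.sqrt v)⁻¹) = v - 1 := by
      rw [mul_sub, mul_inv_cancel₀ hs0.ne', ← sq, hsq]
    linarith
  have h2 := pow_le_pow_left₀ (mul_nonneg hs0.le hl) h1 2
  rwa [mul_pow, hsq] at h2

lemma P_pos (v : ℝ) (h0 : 0 < v) (hv : v ≠ 1) : 0 < v - 1 - Real.log v := by
  have := Real.log_lt_sub_one_of_pos h0 hv
  linarith

lemma ratio1 (v w : ℝ) (hv : 1 < v) (hvw : v ≤ w) :
    v * (1 / v - 1 + Real.log v) * (w - 1 - Real.log w) ≤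
      w * (1 / w - 1 + Real.log w) * (v - 1 - Real.log v) := by
  have hd : ∀ x : ℝ, 1 < x → HasDerivAt
      (fun x : ℝ => (1 - x + x * Real.log x) / (x - 1 - Real.log x))
      (((-1 + (1 * Real.log x + x * x⁻¹)) * (x - 1 - Real.log x) -
        (1 - x + x * Real.log x) * (1 - x⁻¹)) / (x - 1 - Real.log x) ^ 2) x := by
    intro x hx
    have h0 : x ≠ 0 := by linarith
    exact ((((hasDerivAt_id x).const_sub 1)).add ((hasDerivAt_id x).mul
      (Real.hasDerivAt_log h0))).div (((hasDerivAt_id x).sub_const 1).sub (Real.hasDerivAt_log h0))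
      (P_pos x (by linarith) hx.ne').ne'
  have hm : MonotoneOn (fun x : ℝ => (1 - x + x * Real.log x) / (x - 1 - Real.log x))
      (Set.Ioi 1) := by
    apply monotoneOn_of_deriv_nonneg (convex_Ioi 1)
    · intro x hx
      exact (hd x hx).continuousAt.continuousWithinAt
    · intro x hx
      rw [interior_Ioi] at hx
      exact (hd x hx).differentiableAt.differentiableWithinAt
    · intro x hx
      rw [interior_Ioi] at hx
      rw [(hd x hx).deriv]
      apply div_nonneg _ (sq_nonneg _)
      have hx1 : 1 < x := hx
      have h0 : 0 < x := by linarith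
      have h4 := log_ineq4 x hx1.le
      have e : ((-1 + (1 * Real.log x + x * x⁻¹)) * (x - 1 - Real.log x) -
        (1 - x + x * Real.log x) * (1 - x⁻¹)) = ((x - 1) ^ 2 - x * Real.log x ^ 2) / x := by
        field_simp
        ring
      rw [e]
      exact div_nonneg (by linarith) h0.le
  have hw : 1 < w := by linarith
  have := hm (Set.mem_Ioi.2 hv) (Set.mem_Ioi.2 hw) hvw
  simp only at this
  rw [div_le_div_iff₀ (P_pos v (by linarith) hv.ne') (P_pos w (by linarith) hw.ne')] at this
  have e1 : v * (1 / v - 1 + Real.log v) = 1 - v + v * Real.log v := by field_simp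
  have e2 : w * (1 / w - 1 + Real.log w) = 1 - w + w * Real.log w := by field_simp
  rw [e1, e2]; exact this

lemma ratio2 (v w : ℝ) (hv : 1 < v) (hvw : v ≤ w) :
    (v - 1 - Real.log v) * (1 / w - 1 + Real.log w) ≤
      (w - 1 - Real.log w) * (1 / v - 1 + Real.log v) := by
  have hd : ∀ x : ℝ, 1 < x → HasDerivAt
      (fun x : ℝ => (x - 1 - Real.log x) / (x⁻¹ - 1 + Real.log x))
      (((1 - x⁻¹) * (x⁻¹ - 1 + Real.log x) -
        (x - 1 - Real.log x) * (-(x ^ 2)⁻¹ + x⁻¹)) / (x⁻¹ - 1 + Real.log x) ^ 2) x := by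
    intro x hx
    have h0 : x ≠ 0 := by linarith
    have h3 := log_ineq3 x (by linarith) hx.ne'
    rw [one_div] at h3
    exact (((hasDerivAt_id x).sub_const 1).sub (Real.hasDerivAt_log h0)).div
      (((hasDerivAt_inv h0).sub_const 1).add (Real.hasDerivAt_log h0)) h3.ne'
  have hm : MonotoneOn (fun x : ℝ => (x - 1 - Real.log x) / (x⁻¹ - 1 + Real.log x))
      (Set.Ioi 1) := by
    apply monotoneOn_of_deriv_nonneg (convex_Ioi 1)
    · intro x hx
      exact (hd x hx).continuousAt.continuousWithinAt
    · intro x hx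
      rw [interior_Ioi] at hx
      exact (hd x hx).differentiableAt.differentiableWithinAt
    · intro x hx
      rw [interior_Ioi] at hx
      rw [(hd x hx).deriv]
      apply div_nonneg _ (sq_nonneg _)
      have hx1 : 1 < x := hx
      have h0 : 0 < x := by linarith
      have h4 := log_ineq1 x hx1.le
      have e : ((1 - x⁻¹) * (x⁻¹ - 1 + Real.log x) -
        (x - 1 - Real.log x) * (-(x ^ 2)⁻¹ + x⁻¹)) =
          (x - 1) * ((x + 1) * Real.log x - 2 * (x - 1)) / x ^ 2 := by
        field_simp
        ring
      rw [e]
      exact div_nonneg (mul_nonneg (by linarith) (by linarith)) (sq_nonneg _)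
  have hw : 1 < w := by linarith
  have := hm (Set.mem_Ioi.2 hv) (Set.mem_Ioi.2 hw) hvw
  have h3 := log_ineq3 v (by linarith) hv.ne'
  have h4 := log_ineq3 w (by linarith) hw.ne'
  simp only [one_div] at *
  rw [div_le_div_iff₀ h3 h4] at this
  exact this

/-- Strict monotonicity of the ratio controlling the inflection point. -/
lemma ratio_main (α z1 z2 : ℝ) (hα : 0 < α) (hα1 : α ≠ 1) (h2 : 1 < z2) (h12 : z2 < z1) :
    z2 * (1 / z2 ^ (1 - α) - 1 + Real.log (z2 ^ (1 - α))) *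
        (z1 ^ (1 - α) - 1 - Real.log (z1 ^ (1 - α))) <
      z1 * (1 / z1 ^ (1 - α) - 1 + Real.log (z1 ^ (1 - α))) *
        (z2 ^ (1 - α) - 1 - Real.log (z2 ^ (1 - α))) := by
  have hz2 : 0 < z2 := by linarith
  have hz1 : 0 < z1 := by linarith
  have hv1 : 0 < z1 ^ (1 - α) := Real.rpow_pos_of_pos hz1 _
  have hv2 : 0 < z2 ^ (1 - α) := Real.rpow_pos_of_pos hz2 _
  have hw : z2 ^ α < z1 ^ α := Real.rpow_lt_rpow hz2.le h12 hα
  have hw2 : 0 < z2 ^ α := Real.rpow_pos_of_pos hz2 _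
  have e1 : z1 = z1 ^ α * z1 ^ (1 - α) := by rw [← Real.rpow_add hz1]; simp
  have e2 : z2 = z2 ^ α * z2 ^ (1 - α) := by rw [← Real.rpow_add hz2]; simp
  rcases lt_or_gt_of_ne hα1 with h | h
  · have hlt : z2 ^ (1 - α) < z1 ^ (1 - α) := Real.rpow_lt_rpow hz2.le h12 (by linarith)
    have hgt : 1 < z2 ^ (1 - α) := Real.one_lt_rpow h2 (by linarith)
    have hr := ratio1 _ _ hgt hlt.le
    have hM := log_ineq3 _ hv1 (by linarith : z1 ^ (1 - α) ≠ 1 )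
    have hP := P_pos _ hv2 hgt.ne'
    generalize z2 ^ (1 - α) = v at *
    generalize z1 ^ (1 - α) = w at *
    generalize z2 ^ α = A at *
    generalize z1 ^ α = B at *
    rw [e1, e2]
    have h3 := mul_le_mul_of_nonneg_left hr hw2.le
    have h4 := mul_lt_mul_of_pos_right hw (mul_pos (mul_pos hv1 hM) hP)
    linarith
  · have hlt : z1 ^ (1 - α) < z2 ^ (1 - α) := Real.rpow_lt_rpow_of_neg hz2 h12 (by linarith)
    have hgt : z2 ^ (1 - α) < 1 := Real.rpow_lt_one_of_one_lt_of_neg h2 (by linarith)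
    have hM := log_ineq3 _ hv1 (by linarith : z1 ^ (1 - α) ≠ 1 )
    have hP := P_pos _ hv2 hgt.ne
    generalize z2 ^ (1 - α) = v at *
    generalize z1 ^ (1 - α) = w at *
    have hr := ratio2 v⁻¹ w⁻¹ (one_lt_inv₀ hv2 |>.2 hgt) (inv_anti₀ hv1 hlt.le)
    simp only [Real.log_inv, one_div, inv_inv] at hr
    simp only [one_div] at *
    have h3 := mul_le_mul_of_nonneg_left hr hz2.le
    have h4 := mul_lt_mul_of_pos_right h12 (mul_pos hM hP)
    linarith


lemma lNorm_v (n : ℕ) (hn : 2 ≤ n) (α s : ℝ) :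
    lNorm α (vVec n s) = (((n:ℝ) - 1) * s ^ α + (1 - ((n:ℝ) - 1) * s) ^ α) ^ (1 / α) := by
  unfold lNorm
  rw [vsum n hn s (fun x => x ^ α), add_comm]

lemma Hv_v (n : ℕ) (hn : 2 ≤ n) (s : ℝ) :
    Hv n s = -((1 - ((n:ℝ) - 1) * s) * Real.log (1 - ((n:ℝ) - 1) * s)
      + ((n:ℝ) - 1) * (s * Real.log s)) := by
  unfold Hv shannonEntropy
  rw [vsum n hn s (fun x => x * Real.log x)]

lemma Hv_cont (n : ℕ) (hn : 2 ≤ n) : Continuous (Hv n) := by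
  have : Hv n = fun s => -((1 - ((n:ℝ) - 1) * s) * Real.log (1 - ((n:ℝ) - 1) * s)
      + ((n:ℝ) - 1) * (s * Real.log s)) := funext (Hv_v n hn)
  rw [this]
  have h1 : Continuous fun s : ℝ => (1 - ((n:ℝ) - 1) * s) * Real.log (1 - ((n:ℝ) - 1) * s) :=
    Real.continuous_mul_log.comp (by fun_prop : Continuous fun s : ℝ => 1 - ((n:ℝ) - 1) * s)
  exact (h1.add (Real.continuous_mul_log.const_mul _)).neg

lemma lNorm_cont (n : ℕ) (hn : 2 ≤ n) (α : ℝ) (hα : 0 < α) :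
    Continuous (fun s => lNorm α (vVec n s)) := by
  have : (fun s => lNorm α (vVec n s)) = fun s =>
      (((n:ℝ) - 1) * s ^ α + (1 - ((n:ℝ) - 1) * s) ^ α) ^ (1 / α) := funext (lNorm_v n hn α)
  rw [this]
  have h1 : Continuous fun s : ℝ => s ^ α := Real.continuous_rpow_const hα.le
  have h2 : Continuous fun s : ℝ => (1 - ((n:ℝ) - 1) * s) ^ α :=
    h1.comp (by fun_prop : Continuous fun s : ℝ => 1 - ((n:ℝ) - 1) * s)
  exact (Real.continuous_rpow_const (by positivity)).comp ((h1.const_mul _).add h2)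

lemma r_gt (n : ℕ) (hn : 2 ≤ n) (s : ℝ) (hs : s ∈ Set.Ioo (0:ℝ) (1 / (n:ℝ))) :
    s < 1 - ((n:ℝ) - 1) * s := by
  have hn0 : (0:ℝ) < n := by positivity
  have := (lt_div_iff₀ hn0).1 hs.2
  nlinarith

lemma Hv_deriv (n : ℕ) (hn : 2 ≤ n) (s : ℝ) (hs : s ∈ Set.Ioo (0:ℝ) (1 / (n:ℝ))) :
    HasDerivAt (Hv n) (((n:ℝ) - 1) * (Real.log (1 - ((n:ℝ) - 1) * s) - Real.log s)) s := by
  have hr := r_gt n hn s hs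
  have hs0 := hs.1
  have : Hv n = fun s => -((1 - ((n:ℝ) - 1) * s) * Real.log (1 - ((n:ℝ) - 1) * s)
      + ((n:ℝ) - 1) * (s * Real.log s)) := funext (Hv_v n hn)
  rw [this]
  have hl : HasDerivAt (fun s : ℝ => 1 - ((n:ℝ) - 1) * s) (-((n:ℝ) - 1)) s := by
    simpa using ((hasDerivAt_id s).const_mul ((n:ℝ) - 1)).const_sub 1
  have h1 := (Real.hasDerivAt_mul_log (x := 1 - ((n:ℝ) - 1) * s) (by linarith)).comp s hl
  have h2 := (Real.hasDerivAt_mul_log (x := s) (by linarith)).const_mul ((n:ℝ) - 1)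
  refine HasDerivAt.congr_deriv (h1.add h2).neg ?_
  ring

lemma Hv_deriv_pos (n : ℕ) (hn : 2 ≤ n) (s : ℝ) (hs : s ∈ Set.Ioo (0:ℝ) (1 / (n:ℝ))) :
    0 < ((n:ℝ) - 1) * (Real.log (1 - ((n:ℝ) - 1) * s) - Real.log s) := by
  have hr := r_gt n hn s hs
  have hn2 : (2:ℝ) ≤ n := by exact_mod_cast hn
  have := Real.log_lt_log hs.1 hr
  apply mul_pos <;> linarith

lemma lin_deriv (k s : ℝ) : HasDerivAt (fun s : ℝ => 1 - k * s) (-k) s := by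
  simpa using ((hasDerivAt_id s).const_mul k).const_sub 1

lemma S_deriv (k s α : ℝ) (hs : 0 < s) (hr : 0 < 1 - k * s) :
    HasDerivAt (fun s : ℝ => k * s ^ α + (1 - k * s) ^ α)
      (k * (α * s ^ (α - 1)) + -k * α * (1 - k * s) ^ (α - 1)) s :=
  ((Real.hasDerivAt_rpow_const (Or.inl hs.ne')).const_mul k).add
    ((lin_deriv k s).rpow_const (Or.inl hr.ne'))

lemma lNorm_deriv (n : ℕ) (hn : 2 ≤ n) (α : ℝ) (hα : 0 < α) (s : ℝ)
    (hs : s ∈ Set.Ioo (0:ℝ) (1 / (n:ℝ))) :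
    HasDerivAt (fun s => lNorm α (vVec n s))
      (Dva n α s * (((n:ℝ) - 1) * (Real.log (1 - ((n:ℝ) - 1) * s) - Real.log s))) s := by
  have hr := r_gt n hn s hs
  have hs0 := hs.1
  have hn2 : (2:ℝ) ≤ n := by exact_mod_cast hn
  have hlog := Real.log_lt_log hs.1 hr
  have : (fun s => lNorm α (vVec n s)) = fun s =>
      (((n:ℝ) - 1) * s ^ α + (1 - ((n:ℝ) - 1) * s) ^ α) ^ (1 / α) := funext (lNorm_v n hn α)
  rw [this]
  unfold Dva
  have hk : 0 < (n:ℝ) - 1 := by linarith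
  generalize (n:ℝ) - 1 = k at *
  have hr0 : 0 < 1 - k * s := by linarith
  have hS : 0 < k * s ^ α + (1 - k * s) ^ α := by positivity
  refine HasDerivAt.congr_deriv ((S_deriv k s α hs0 hr0).rpow_const (p := 1 / α)
    (Or.inl hS.ne')) ?_
  have hL : Real.log (1 - k * s) - Real.log s ≠ 0 := by linarith
  generalize Real.log (1 - k * s) - Real.log s = L at *
  generalize (k * s ^ α + (1 - k * s) ^ α) ^ (1 / α - 1) = T
  field_simp
  ring

/-- the sign factor -/
noncomputable def Psi (k α s : ℝ) : ℝ :=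
  k * s * (((1 - k * s) / s) ^ (1 - α) - 1 - Real.log (((1 - k * s) / s) ^ (1 - α))) -
    (1 - k * s) * (1 / ((1 - k * s) / s) ^ (1 - α) - 1 + Real.log (((1 - k * s) / s) ^ (1 - α)))

lemma Dva_deriv (n : ℕ) (hn : 2 ≤ n) (α : ℝ) (hα : 0 < α) (s : ℝ)
    (hs : s ∈ Set.Ioo (0:ℝ) (1 / (n:ℝ))) :
    ∃ C : ℝ, 0 < C ∧ HasDerivAt (Dva n α) (C * Psi ((n:ℝ) - 1) α s) s := by
  have hr := r_gt n hn s hs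
  have hs0 := hs.1
  have hn2 : (2:ℝ) ≤ n := by exact_mod_cast hn
  have hlog := Real.log_lt_log hs.1 hr
  have hD : Dva n α = fun p => (((n : ℝ) - 1) * p ^ α + (1 - ((n : ℝ) - 1) * p) ^ α) ^ (1 / α - 1) *
    ((p ^ (α - 1) - (1 - ((n : ℝ) - 1) * p) ^ (α - 1)) /
      (Real.log (1 - ((n : ℝ) - 1) * p) - Real.log p)) := rfl
  rw [hD]
  have hk : 0 < (n:ℝ) - 1 := by linarith
  generalize (n:ℝ) - 1 = k at *
  have hr0 : 0 < 1 - k * s := by linarith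
  have hS : 0 < k * s ^ α + (1 - k * s) ^ α := by positivity
  have hL : 0 < Real.log (1 - k * s) - Real.log s := by linarith
  have h1 := (S_deriv k s α hs0 hr0).rpow_const (p := 1 / α - 1) (Or.inl hS.ne')
  have h2 := (Real.hasDerivAt_rpow_const (x := s) (p := α - 1) (Or.inl hs0.ne')).sub
    ((lin_deriv k s).rpow_const (p := α - 1) (Or.inl hr0.ne'))
  have h3 := ((lin_deriv k s).log hr0.ne').sub (Real.hasDerivAt_log hs0.ne')
  have h := h1.mul (h2.div h3 hL.ne')
  have hX : 0 < s ^ (α - 1) := by positivity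
  have hY : 0 < (1 - k * s) ^ (α - 1) := by positivity
  have hT : 0 < (k * s ^ α + (1 - k * s) ^ α) ^ (1 / α - 1) := by positivity
  refine ⟨(k * s ^ α + (1 - k * s) ^ α) ^ (1 / α - 1) / (k * s ^ α + (1 - k * s) ^ α) /
    (Real.log (1 - k * s) - Real.log s) ^ 2 * (s ^ (α - 1) * (1 - k * s) ^ (α - 1)) /
      ((1 - k * s) * s), by positivity, ?_⟩
  refine HasDerivAt.congr_deriv h ?_
  have e1 : s ^ α = s * s ^ (α - 1) := by
    rw [Real.rpow_sub_one hs0.ne']; field_simp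
  have e2 : (1 - k * s) ^ α = (1 - k * s) * (1 - k * s) ^ (α - 1) := by
    rw [Real.rpow_sub_one hr0.ne']; field_simp
  have e3 : s ^ (α - 1 - 1) = s ^ (α - 1) / s := Real.rpow_sub_one hs0.ne' _
  have e4 : (1 - k * s) ^ (α - 1 - 1) = (1 - k * s) ^ (α - 1) / (1 - k * s) :=
    Real.rpow_sub_one hr0.ne' _
  have e5 := Real.rpow_sub_one hS.ne' (1 / α - 1)
  have e6 : ((1 - k * s) / s) ^ (1 - α) = s ^ (α - 1) / (1 - k * s) ^ (α - 1) := by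
    rw [Real.div_rpow hr0.le hs0.le, show 1 - α = -(α - 1) by ring, Real.rpow_neg hr0.le,
      Real.rpow_neg hs0.le]
    field_simp
  have e7 : Real.log (((1 - k * s) / s) ^ (1 - α)) =
      (1 - α) * (Real.log (1 - k * s) - Real.log s) := by
    rw [Real.log_rpow (by positivity), Real.log_div hr0.ne' hs0.ne']
  unfold Psi
  rw [e7, e6, e3, e4, e5]
  clear h h1 h2 h3 e3 e4 e5 e6 e7 hD
  simp only [Pi.sub_apply, Pi.div_apply]
  generalize (k * s ^ α + (1 - k * s) ^ α) ^ (1 / α - 1) = T at *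
  rw [e1, e2] at hS ⊢
  clear e1 e2
  generalize s ^ (α - 1) = X at *
  generalize (1 - k * s) ^ (α - 1) = Y at *
  generalize Real.log (1 - k * s) - Real.log s = L at *
  obtain ⟨r, hrd⟩ : ∃ r, r = 1 - k * s := ⟨_, rfl⟩
  rw [← hrd] at hr0 hS ⊢
  obtain ⟨S, hSd⟩ : ∃ S, S = k * (s * X) + r * Y := ⟨_, rfl⟩
  rw [← hSd] at hS ⊢
  have key : (1 / α - 1) * (k * (α * X) + -k * α * Y) = (1 - α) * (k * (X - Y)) := by
    field_simp; ring
  have lhs : (k * (α * X) + -k * α * Y) * (1 / α - 1) * (T / S) * ((X - Y) / L) +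
      T * ((((α - 1) * (X / s) - -k * (α - 1) * (Y / r)) * L - (X - Y) * (-k / r - s⁻¹)) / L ^ 2)
      = (T / S) / L ^ 2 / (r * s) * ((1 - α) * k * (X - Y) ^ 2 * L * (r * s)
        + S * ((α - 1) * (X * r + k * Y * s) * L + (X - Y) * (k * s + r))) := by
    rw [mul_comm (k * (α * X) + -k * α * Y), key]
    field_simp
    ring
  refine Eq.trans ?_ (lhs.trans ?_)
  · ring
  · have hkr : k * s + r = 1 := by rw [hrd]; ring
    have e8 : (1 - α) * k * (X - Y) ^ 2 * L * (r * s)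
        + S * ((α - 1) * (X * r + k * Y * s) * L + (X - Y) * (k * s + r)) =
        X * Y * (k * s * (X / Y - 1 - (1 - α) * L) - r * (1 / (X / Y) - 1 + (1 - α) * L)) := by
      have : X * Y * (k * s * (X / Y - 1 - (1 - α) * L) - r * (1 / (X / Y) - 1 + (1 - α) * L))
        = k * s * (X * X - X * Y) - r * (Y * Y - X * Y) - X * Y * (k * s + r) * (1 - α) * L := by
        field_simp
        ring
      rw [this, hSd]
      have hr' : r = 1 - k * s := hrd
      subst hr'
      ring
    rw [e8]
    ring

lemma Psi_cross (k α x y : ℝ) (hα : 0 < α) (hα1 : α ≠ 1) (hk : 0 < k) (hx : 0 < x) (hxy : x < y)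
    (hy : y < 1 - k * y) (h : 0 ≤ Psi k α x) : 0 < Psi k α y := by
  have hy0 : 0 < y := hx.trans hxy
  have hkk : k * x < k * y := by gcongr
  have hrx : 0 < 1 - k * x := by linarith
  have hry : 0 < 1 - k * y := by linarith
  have hz2 : 1 < (1 - k * y) / y := by rwa [one_lt_div hy0]
  have hz12 : (1 - k * y) / y < (1 - k * x) / x := by
    rw [div_lt_div_iff₀ hy0 hx]; nlinarith
  have hR := ratio_main α _ _ hα hα1 hz2 hz12
  have hz1 : 1 < (1 - k * x) / x := hz2.trans hz12
  have key : ∀ s, 0 < s → Psi k α s = s * (k * (((1 - k * s) / s) ^ (1 - α) - 1 -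
      Real.log (((1 - k * s) / s) ^ (1 - α))) - (1 - k * s) / s *
      (1 / ((1 - k * s) / s) ^ (1 - α) - 1 + Real.log (((1 - k * s) / s) ^ (1 - α)))) := by
    intro s hs
    unfold Psi
    generalize (((1 - k * s) / s) ^ (1 - α)) = v
    generalize 1 / v - 1 + Real.log v = M
    field_simp
  rw [key x hx] at h
  rw [key y hy0]
  have hne : ∀ z : ℝ, 1 < z → z ^ (1 - α) ≠ 1 := by
    intro z hz
    rcases lt_or_gt_of_ne hα1 with h | h
    · exact (Real.one_lt_rpow hz (by linarith)).ne'
    · exact (Real.rpow_lt_one_of_one_lt_of_neg hz (by linarith)).ne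
  have hP1 := P_pos _ (by positivity) (hne _ hz1)
  have hP2 := P_pos _ (by positivity) (hne _ hz2)
  apply mul_pos hy0
  have h' := nonneg_of_mul_nonneg_right h hx
  generalize ((1 - k * x) / x) = z1 at *
  generalize ((1 - k * y) / y) = z2 at *
  generalize z1 ^ (1 - α) - 1 - Real.log (z1 ^ (1 - α)) = P1 at *
  generalize z2 ^ (1 - α) - 1 - Real.log (z2 ^ (1 - α)) = P2 at *
  generalize (1 / z1 ^ (1 - α) - 1 + Real.log (z1 ^ (1 - α))) = M1 at *
  generalize (1 / z2 ^ (1 - α) - 1 + Real.log (z2 ^ (1 - α))) = M2 at *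
  have := mul_nonneg h' hP2.le
  have hpp : 0 < P1 * (k * P2 - z2 * M2) := by nlinarith
  exact (mul_pos_iff_of_pos_left hP1).1 hpp

lemma Dva_quasi (n : ℕ) (hn : 2 ≤ n) (α : ℝ) (hα : 0 < α) (hα1 : α ≠ 1) :
    ∀ x y z, 0 < x → x < y → y < z → z < 1 / (n:ℝ) →
      Dva n α y < max (Dva n α x) (Dva n α z) := by
  have hn2 : (2:ℝ) ≤ n := by exact_mod_cast hn
  have hd := Dva_deriv n hn α hα
  refine quasi_convex_of (1 / (n:ℝ)) (Dva n α) (fun s => deriv (Dva n α) s) ?_ ?_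
  · intro s hs
    obtain ⟨C, hC, h⟩ := hd s hs
    rw [h.deriv]; exact h
  · intro x y hx hxy hy h
    obtain ⟨C, hC, h1⟩ := hd x ⟨hx, hxy.trans hy⟩
    obtain ⟨C', hC', h2⟩ := hd y ⟨hx.trans hxy, hy⟩
    rw [h1.deriv] at h
    rw [h2.deriv]
    exact mul_pos hC' (Psi_cross _ α x y hα hα1 (by linarith) hx hxy
      (r_gt n hn y ⟨hx.trans hxy, hy⟩) (nonneg_of_mul_nonneg_right h hC))

lemma end_vals (n : ℕ) (hn : 2 ≤ n) (α : ℝ) (hα : 0 < α) :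
    Hv n (1 / (n:ℝ)) = Real.log n ∧ lNorm α (vVec n (1 / (n:ℝ))) = (n:ℝ) ^ (1 / α - 1) := by
  have hn0 : (0:ℝ) < n := by positivity
  have e : 1 - ((n:ℝ) - 1) * (1 / n) = 1 / n := by field_simp; ring
  constructor
  · rw [Hv_v n hn, e, one_div, Real.log_inv]
    field_simp; ring
  · rw [lNorm_v n hn, e]
    have : ((n:ℝ) - 1) * (1 / (n:ℝ)) ^ α + (1 / (n:ℝ)) ^ α = (n:ℝ) ^ (1 - α) := by
      rw [one_div, Real.inv_rpow hn0.le, Real.rpow_sub hn0, Real.rpow_one]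
      have : 0 < (n:ℝ) ^ α := by positivity
      field_simp; ring
    rw [this, ← Real.rpow_mul hn0.le]
    congr 1
    field_simp

lemma Dva_sign (n : ℕ) (hn : 2 ≤ n) (α : ℝ) (hα1 : α ≠ 1) (s : ℝ)
    (hs : s ∈ Set.Ioo (0:ℝ) (1 / (n:ℝ))) :
    (α < 1 ∧ 0 < Dva n α s) ∨ (1 < α ∧ Dva n α s < 0) := by
  have hr := r_gt n hn s hs
  have hs0 := hs.1
  have hn2 : (2:ℝ) ≤ n := by exact_mod_cast hn
  have hlog := Real.log_lt_log hs.1 hr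
  unfold Dva
  have hk : 0 < (n:ℝ) - 1 := by linarith
  generalize (n:ℝ) - 1 = k at *
  have hr0 : 0 < 1 - k * s := by linarith
  have hT : 0 < (k * s ^ α + (1 - k * s) ^ α) ^ (1 / α - 1) := by positivity
  have hL : 0 < Real.log (1 - k * s) - Real.log s := by linarith
  rcases lt_or_gt_of_ne hα1 with h | h
  · left
    refine ⟨h, mul_pos hT (div_pos ?_ hL)⟩
    have := Real.rpow_lt_rpow_of_neg hs0 hr (show α - 1 < 0 by linarith)
    linarith
  · right
    refine ⟨h, mul_neg_of_pos_of_neg hT (div_neg_of_neg_of_pos ?_ hL)⟩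
    have := Real.rpow_lt_rpow hs0.le hr (show 0 < α - 1 by linarith)
    linarith

lemma support (n : ℕ) (hn : 2 ≤ n) (α : ℝ) (hα : 0 < α) (hα1 : α ≠ 1) (st : ℝ)
    (hst : st ∈ Set.Ioo (0:ℝ) (1 / (n:ℝ))) (ht : TangencyEq n α st) (s0 : ℝ) (hs0 : 0 < s0)
    (hs0' : s0 ≤ st) (m : ℕ) (q : Fin m → ℝ) (p : Fin m → Fin n → ℝ)
    (hq0 : ∀ y, 0 ≤ q y) (hq1 : ∑ y, q y = 1) (hp : ∀ y, IsProbVec (p y)) :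
    ∑ y, q y * lNorm α (p y) ≤ lNorm α (vVec n s0) +
      Dva n α s0 * (∑ y, q y * shannonEntropy (p y) - Hv n s0) := by
  obtain ⟨hb1, hb2⟩ := end_vals n hn α hα
  obtain ⟨s, hs, hB⟩ := lemB n hn α (Dva n α s0) hα
    (Dva_sign n hn α hα1 s0 ⟨hs0, hs0'.trans_lt hst.2⟩)
  have hC := tangent_abs (1 / (n:ℝ)) (Hv n) (fun s => lNorm α (vVec n s)) (Dva n α)
    (fun s => ((n:ℝ) - 1) * (Real.log (1 - ((n:ℝ) - 1) * s) - Real.log s))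
    (Hv_cont n hn).continuousOn (lNorm_cont n hn α hα).continuousOn
    (Hv_deriv n hn) (Hv_deriv_pos n hn) (lNorm_deriv n hn α hα) (Dva_quasi n hn α hα hα1)
    st hst (by rw [hb1, hb2]; exact ht) s0 hs0 hs0' s hs
  have hall : ∀ y, q y * lNorm α (p y) ≤ q y * (lNorm α (vVec n s0) - Dva n α s0 * Hv n s0)
      + Dva n α s0 * (q y * shannonEntropy (p y)) := by
    intro y
    have h1 := hB (p y) (hp y)
    have h2 : lNorm α (p y) ≤ (lNorm α (vVec n s0) - Dva n α s0 * Hv n s0)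
        + Dva n α s0 * shannonEntropy (p y) := by
      have : shannonEntropy (vVec n s) = Hv n s := rfl
      rw [this] at h1
      linarith
    have := mul_le_mul_of_nonneg_left h2 (hq0 y)
    linarith
  have := Finset.sum_le_sum (fun y (_ : y ∈ Finset.univ) => hall y)
  rw [Finset.sum_add_distrib, ← Finset.sum_mul, ← Finset.mul_sum, hq1] at this
  linarith

lemma partB (n : ℕ) (hn : 2 ≤ n) (α : ℝ) (hα : 0 < α) (hα1 : α ≠ 1)
    (m : ℕ) (q : Fin m → ℝ) (p : Fin m → Fin n → ℝ)
    (hq0 : ∀ y, 0 ≤ q y) (hq1 : ∑ y, q y = 1) (hp : ∀ y, IsProbVec (p y))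
    (st : ℝ) (hst : st ∈ Set.Ioo (0:ℝ) (1 / (n:ℝ))) (ht : TangencyEq n α st) (L : ℝ → ℝ)
    (hL1 : ∀ r ∈ Set.Icc (0 : ℝ) (1 / (n : ℝ)), Hv n r ≤ Hv n st →
          L (Hv n r) = lNorm α (vVec n r))
    (hL2 : ∀ h ∈ Set.Icc (0 : ℝ) (Real.log n), Hv n st < h →
          L h = ((Real.log n - h) / (Real.log n - Hv n st)) * lNorm α (vVec n st) +
            (1 - (Real.log n - h) / (Real.log n - Hv n st)) * (n : ℝ) ^ (1 / α - 1))
    (h'' : ℝ) (hh : h'' ∈ Set.Icc (0 : ℝ) (Real.log n))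
    (hE : L h'' = ∑ y, q y * lNorm α (p y)) :
    (α < 1 → h'' ≤ ∑ y, q y * shannonEntropy (p y)) ∧
          (1 < α → ∑ y, q y * shannonEntropy (p y) ≤ h'') := by
  have hsup := fun s0 h1 h2 => support n hn α hα hα1 st hst ht s0 h1 h2 m q p hq0 hq1 hp
  have hH0 : Hv n 0 = 0 := by rw [Hv_v n hn]; simp
  have fin : ∀ s0, 0 < s0 → s0 ≤ st → 0 ≤ Dva n α s0 * (∑ y, q y * shannonEntropy (p y) - h'') →
      (α < 1 → h'' ≤ ∑ y, q y * shannonEntropy (p y)) ∧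
          (1 < α → ∑ y, q y * shannonEntropy (p y) ≤ h'') := by
    intro s0 h1 h2 h3
    rcases Dva_sign n hn α hα1 s0 ⟨h1, h2.trans_lt hst.2⟩ with ⟨ha, hd⟩ | ⟨ha, hd⟩
    · refine ⟨fun _ => ?_, fun h => by linarith⟩
      have := nonneg_of_mul_nonneg_right h3 hd
      linarith
    · refine ⟨fun h => by linarith, fun _ => ?_⟩
      by_contra hcon
      push Not at hcon
      nlinarith
  rcases le_or_gt h'' (Hv n st) with hle | hgt
  · obtain ⟨r, hr, hre⟩ := intermediate_value_Icc hst.1.le (Hv_cont n hn).continuousOn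
      (show h'' ∈ Set.Icc (Hv n 0) (Hv n st) from ⟨by rw [hH0]; exact hh.1, hle⟩)
    have hLr := hL1 r ⟨hr.1, hr.2.trans hst.2.le⟩ (by rw [hre]; exact hle)
    rw [hre, hE] at hLr
    rcases hr.1.eq_or_lt with h0 | h0
    · subst h0
      have h0'' : h'' = 0 := by rw [← hre, hH0]
      constructor
      · intro _
        rw [h0'']
        refine Finset.sum_nonneg fun y _ => mul_nonneg (hq0 y) ?_
        unfold shannonEntropy
        rw [neg_nonneg]
        refine Finset.sum_nonpos fun i _ => ?_
        have hi0 := (hp y).1 i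
        have hi1 : p y i ≤ 1 := by
          rw [← (hp y).2]
          exact Finset.single_le_sum (fun j _ => (hp y).1 j) (Finset.mem_univ i)
        exact mul_nonpos_of_nonneg_of_nonpos hi0 (Real.log_nonpos hi0 hi1)
      · intro h1
        have hN0 : lNorm α (vVec n 0) = 1 := by
          rw [lNorm_v n hn]; simp [Real.zero_rpow hα.ne']
        have hbd : ∀ s0 ∈ Set.Ioo 0 st, ∑ y, q y * shannonEntropy (p y) ≤ Hv n s0 := by
          intro s0 hs0
          have hmem : s0 ∈ Set.Ioo (0:ℝ) (1 / (n:ℝ)) := ⟨hs0.1, hs0.2.trans hst.2⟩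
          have h := hsup s0 hs0.1 hs0.2.le
          rw [hLr, hN0] at h
          have hD : Dva n α s0 < 0 := by
            rcases Dva_sign n hn α hα1 s0 hmem with h | h
            · linarith [h.1]
            · exact h.2
          have hN1 : lNorm α (vVec n s0) ≤ 1 := by
            have hrr := r_gt n hn s0 hmem
            have hn2 : (2:ℝ) ≤ n := by exact_mod_cast hn
            rw [lNorm_v n hn]
            have hk : 0 < (n:ℝ) - 1 := by linarith
            generalize (n:ℝ) - 1 = k at *
            have hs00 := hs0.1
            have hks : 0 < k * s0 := mul_pos hk hs0.1
            have hr0 : 0 < 1 - k * s0 := by linarith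
            have a1 : s0 ^ α ≤ s0 := by
              have := Real.rpow_le_rpow_of_exponent_ge hs0.1 (by linarith) h1.le
              rwa [Real.rpow_one] at this
            have a2 : (1 - k * s0) ^ α ≤ 1 - k * s0 := by
              have := Real.rpow_le_rpow_of_exponent_ge hr0 (by linarith) h1.le
              rwa [Real.rpow_one] at this
            have a3 := mul_le_mul_of_nonneg_left a1 hk.le
            exact Real.rpow_le_one (by positivity) (by linarith) (by positivity)
          by_contra hcon
          push Not at hcon
          nlinarith
        rw [← hre]
        refine ge_of_tendsto ((Hv_cont n hn).continuousWithinAt (s := Set.Ioi 0) (x := 0)) ?_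
        filter_upwards [Ioo_mem_nhdsGT hst.1] with s hs using hbd s hs
    · apply fin r h0 hr.2
      have := hsup r h0 hr.2
      rw [hLr, hre] at this
      linarith
  · apply fin st hst.1 le_rfl
    have h := hsup st hst.1 le_rfl
    have hlt : 0 < Real.log n - Hv n st := by linarith [hh.2]
    have hLh := hL2 h'' hh hgt
    have ht' : (Real.log n - Hv n st) * Dva n α st =
      (n : ℝ) ^ (1 / α - 1) - lNorm α (vVec n st) := ht
    have : L h'' = lNorm α (vVec n st) + Dva n α st * (h'' - Hv n st) := by
      rw [hLh, show (n : ℝ) ^ (1 / α - 1) = lNorm α (vVec n st) +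
        (Real.log n - Hv n st) * Dva n α st by linarith]
      field_simp
      ring
    rw [← hE, this] at h
    linarith


theorem stmt13 (n : ℕ) (hn : 2 ≤ n) (α : ℝ) (hα : α ∈ Set.Ioo (0 : ℝ) 1 ∪ Set.Ioi 1)
    (m : ℕ) (hm : 0 < m) (q : Fin m → ℝ) (p : Fin m → Fin n → ℝ)
    (hq0 : ∀ y, 0 ≤ q y) (hq1 : ∑ y, q y = 1) (hp : ∀ y, IsProbVec (p y)) :
    (∀ h' ∈ Set.Icc (0 : ℝ) (Real.log n),
      Lmin α h' = ∑ y, q y * lNorm α (p y) →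
      (α < 1 → ∑ y, q y * shannonEntropy (p y) ≤ h') ∧
      (1 < α → h' ≤ ∑ y, q y * shannonEntropy (p y))) ∧
    (3 ≤ n → α ∈ Set.Ico (1 / 2 : ℝ) 1 ∪ Set.Ioi 1 →
      ∀ pstar ∈ Set.Ioo (0 : ℝ) (1 / (n : ℝ)), TangencyEq n α pstar →
      ∀ L : ℝ → ℝ,
        (∀ r ∈ Set.Icc (0 : ℝ) (1 / (n : ℝ)), Hv n r ≤ Hv n pstar →
          L (Hv n r) = lNorm α (vVec n r)) →
        (∀ h ∈ Set.Icc (0 : ℝ) (Real.log n), Hv n pstar < h →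
          L h = ((Real.log n - h) / (Real.log n - Hv n pstar)) * lNorm α (vVec n pstar) +
            (1 - (Real.log n - h) / (Real.log n - Hv n pstar)) * (n : ℝ) ^ (1 / α - 1)) →
        ∀ h'' ∈ Set.Icc (0 : ℝ) (Real.log n),
          L h'' = ∑ y, q y * lNorm α (p y) →
          (α < 1 → h'' ≤ ∑ y, q y * shannonEntropy (p y)) ∧
          (1 < α → ∑ y, q y * shannonEntropy (p y) ≤ h'')) := by
  have hα0 : 0 < α := by
    rcases hα with h | h
    · exact h.1
    · exact lt_trans one_pos h
  have hα1 : α ≠ 1 := by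
    rcases hα with h | h
    · exact h.2.ne
    · exact (ne_of_gt h)
  refine ⟨fun h' hh' hL => partA n hn α hα0 hα1 m q p hq0 hq1 hp h' hh'.1 hL, ?_⟩
  intro _ _ st hst ht L hL1 hL2 h'' hh hE
  exact partB n hn α hα0 hα1 m q p hq0 hq1 hp st hst ht L hL1 hL2 h'' hh hE
end

section
/- Let n ≥ 2 be an integer, consider a finite joint source with X-alphabet of size n, set h = ∑_{y∈Y} q_y·H(p_y), and for α ∈ (0,1) ∪ (1,∞) define H_α(X|Y) = (α/(1−α))·ln(∑_{y∈Y} q_y·‖p_y‖_α). Then: (a) H_α(X|Y) ≥ (α/(1−α))·ln L_min^α(h) if α ∈ (0,1), and H_α(X|Y) ≤ (α/(1−α))·ln L_min^α(h) if α > 1. (b) If n ≥ 3, α ∈ [1/2, 1) ∪ (1, ∞), and p* ∈ (0, 1/n) satisfies the tangency equation, then H_α(X|Y) ≤ (α/(1−α))·ln L_max^α(h) if α ∈ [1/2, 1), and H_α(X|Y) ≥ (α/(1−α))·ln L_max^α(h) if α > 1. -/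
open Real

namespace S15

/-- norm of the two-block vector with `m` entries `1/(m+e^x)` and one entry `e^x/(m+e^x)` -/
noncomputable def NN (m α x : ℝ) : ℝ := (m + exp (α * x)) ^ (1 / α) / (m + exp x)

/-- entropy of the two-block vector -/
noncomputable def HH (m x : ℝ) : ℝ := log (m + exp x) - x * exp x / (m + exp x)

/-- derivative of norm with respect to entropy -/
noncomputable def DD (m α x : ℝ) : ℝ :=
  (m + exp (α * x)) ^ (1 / α - 1) * ((1 - exp (-((1 - α) * x))) / x)

/-- the sign of the derivative of `DD` -/
noncomputable def WW (m α x : ℝ) : ℝ :=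
  exp (α * x) * (exp ((1 - α) * x) * ((1 - α) * x - 1) + 1)
    - m * (exp ((1 - α) * x) - 1 - (1 - α) * x)

lemma hasDerivAt_HH {m : ℝ} (hm : 0 < m) (x : ℝ) :
    HasDerivAt (HH m) (-x * (m * exp x / (m + exp x) ^ 2)) x := by
  have hpos : 0 < m + exp x := by positivity
  have h1 : HasDerivAt (fun x => m + exp x) (exp x) x := (Real.hasDerivAt_exp x).const_add m
  have h2 := (h1.log hpos.ne').sub (((hasDerivAt_id x).mul (Real.hasDerivAt_exp x)).div h1 hpos.ne')
  refine (h2.congr_deriv ?_)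
  simp only [id, Pi.mul_apply]
  field_simp
  ring

lemma hasDerivAt_NN {m α : ℝ} (hm : 0 < m) (hα : 0 < α) (x : ℝ) :
    HasDerivAt (NN m α) (m * exp x / (m + exp x) ^ 2 *
      ((m + exp (α * x)) ^ (1 / α - 1) * (exp (-((1 - α) * x)) - 1))) x := by
  have hpos : 0 < m + exp x := by positivity
  have hpos2 : 0 < m + exp (α * x) := by positivity
  have h1 : HasDerivAt (fun x => m + exp x) (exp x) x := (Real.hasDerivAt_exp x).const_add m
  have h3 : HasDerivAt (fun x => m + exp (α * x)) (exp (α * x) * α) x := by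
    have := (((hasDerivAt_id x).const_mul α).exp).const_add m
    simpa using this
  have h4 := (h3.rpow_const (p := 1 / α) (Or.inl hpos2.ne')).div h1 hpos.ne'
  refine (h4.congr_deriv ?_)
  have e1 : (m + exp (α * x)) ^ (1 / α) = (m + exp (α * x)) ^ (1 / α - 1) * (m + exp (α * x)) := by
    rw [← Real.rpow_add_one hpos2.ne']; congr 1; ring
  have e2 : exp x * exp (-((1 - α) * x)) = exp (α * x) := by
    rw [← Real.exp_add]; congr 1; ring
  rw [e1]
  generalize (m + exp (α * x)) ^ (1 / α - 1) = T
  generalize exp (-((1 - α) * x)) = U at *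
  generalize exp (α * x) = Z at *
  generalize exp x = X at *
  have : X + m ≠ 0 := by linarith
  field_simp
  linear_combination (-m * T) * e2

lemma hasDerivAt_NN' {m α : ℝ} (hm : 0 < m) (hα : 0 < α) {x : ℝ} (hx : x ≠ 0) :
    HasDerivAt (NN m α) (-x * (m * exp x / (m + exp x) ^ 2) * DD m α x) x := by
  refine (hasDerivAt_NN hm hα x).congr_deriv ?_
  unfold DD
  have hpos : 0 < m + exp x := by positivity
  field_simp
  ring

lemma hasDerivAt_DD {m α : ℝ} (hm : 0 < m) (hα : 0 < α) {x : ℝ} (hx : x ≠ 0) :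
    HasDerivAt (DD m α) ((m + exp (α * x)) ^ (1 / α - 1) / (x ^ 2 * (m + exp (α * x)))
      * exp (-((1 - α) * x)) * WW m α x) x := by
  have hpos2 : 0 < m + exp (α * x) := by positivity
  have h3 : HasDerivAt (fun x => m + exp (α * x)) (exp (α * x) * α) x := by
    have := (((hasDerivAt_id x).const_mul α).exp).const_add m
    simpa using this
  have h5 : HasDerivAt (fun x => 1 - exp (-((1 - α) * x))) (exp (-((1 - α) * x)) * (1 - α)) x := by
    have := ((((hasDerivAt_id x).const_mul (1 - α)).neg).exp).const_sub 1
    refine this.congr_deriv ?_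
    simp only [Pi.neg_apply, id]
    ring
  have h4 := (h3.rpow_const (p := 1 / α - 1) (Or.inl hpos2.ne')).mul (h5.div (hasDerivAt_id x) hx)
  refine (h4.congr_deriv ?_)
  have e1 : (m + exp (α * x)) ^ (1 / α - 1)
      = (m + exp (α * x)) ^ (1 / α - 1 - 1) * (m + exp (α * x)) := by
    rw [← Real.rpow_add_one hpos2.ne']; congr 1; ring
  have e2 : exp (-((1 - α) * x)) * exp ((1 - α) * x) = 1 := by
    rw [← Real.exp_add]; simp
  unfold WW
  simp only [id, e1, Pi.div_apply]
  clear h4 h5 h3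
  generalize (m + exp (α * x)) ^ (1 / α - 1 - 1) = T
  generalize exp (-((1 - α) * x)) = U at *
  generalize exp ((1 - α) * x) = V at *
  generalize exp (α * x) = Z at *
  have : Z + m ≠ 0 := by linarith
  field_simp
  linear_combination (- (T * (Z * ((1 - α) * x - 1) - m))) * e2

lemma WW_neg_of_neg {m α : ℝ} (hm : 1 ≤ m) (hα : 0 < α) (hα1 : α ≠ 1) {x : ℝ} (hx : x < 0) :
    WW m α x < 0 := by
  unfold WW
  set k := (1 - α) * x with hk
  have hk0 : k ≠ 0 := mul_ne_zero (sub_ne_zero.mpr hα1.symm) hx.ne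
  have hB : 0 < exp k - 1 - k := by have := Real.add_one_lt_exp hk0; linarith
  have hA : 0 < exp k * (k - 1) + 1 := by
    have h := Real.add_one_lt_exp (neg_ne_zero.mpr hk0)
    have e2 : exp k * exp (-k) = 1 := by rw [← Real.exp_add]; simp
    have := mul_lt_mul_of_pos_left h (Real.exp_pos k)
    nlinarith
  suffices exp (α * x) * (exp k * (k - 1) + 1) < exp k - 1 - k by nlinarith
  rcases lt_or_gt_of_ne hα1 with h | h
  · have hkn : k < 0 := mul_neg_of_pos_of_neg (by linarith) hx
    have h1 : exp (α * x) ≤ 1 := Real.exp_le_one_iff.mpr (by nlinarith)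
    -- A < B for k<0
    have key : exp k * (k - 1) + 1 < exp k - 1 - k := by
      have hs : StrictMonoOn (fun y : ℝ => exp y * (y - 2) + 2 + y) (Set.Iic 0) := by
        refine strictMonoOn_of_hasDerivWithinAt_pos (f' := fun y => exp y * (y - 1) + 1)
          (convex_Iic 0) (by fun_prop) ?_ ?_
        · intro y _
          have := (((Real.hasDerivAt_exp y).mul ((hasDerivAt_id y).sub_const 2)).add_const 2).add
            (hasDerivAt_id y)
          refine (this.congr_deriv ?_).hasDerivWithinAt
          simp; ring
        · intro y hy
          rw [interior_Iic] at hy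
          have h := Real.add_one_lt_exp (neg_ne_zero.mpr (ne_of_lt hy))
          have e2 : exp y * exp (-y) = 1 := by rw [← Real.exp_add]; simp
          have := mul_lt_mul_of_pos_left h (Real.exp_pos y)
          nlinarith
      have := hs (Set.mem_Iic.mpr hkn.le) (Set.mem_Iic.mpr le_rfl) hkn
      simp at this
      nlinarith
    nlinarith
  · have hkp : 0 < k := mul_pos_of_neg_of_neg (by linarith) hx
    have e3 : exp (α * x) = exp x * exp (-k) := by
      rw [← Real.exp_add]; congr 1; rw [hk]; ring
    have e2 : exp (-k) * exp k = 1 := by rw [← Real.exp_add]; simp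
    have h1 : exp x < 1 := by simpa using hx
    have h2 : k < sinh k := Real.self_lt_sinh_iff.mpr hkp
    rw [Real.sinh_eq] at h2
    have e4 : exp (α * x) * (exp k * (k - 1) + 1) = exp x * (k - 1 + exp (-k)) := by
      rw [e3]; linear_combination (exp x * (k - 1)) * e2
    rw [e4]
    have h5 : 0 < k - 1 + exp (-k) := by
      have h := Real.add_one_lt_exp (neg_ne_zero.mpr hk0); linarith
    nlinarith

/-- ratio function -/
lemma R_mono {k : ℝ} (hk : k ≠ 0) : HasDerivAt (fun k => (exp k * (k - 1) + 1) / (exp k - 1 - k))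
    (((exp k - 1) ^ 2 - k ^ 2 * exp k) / (exp k - 1 - k) ^ 2) k := by
  have hB : 0 < exp k - 1 - k := by have := Real.add_one_lt_exp hk; linarith
  have h1 := ((Real.hasDerivAt_exp k).mul ((hasDerivAt_id k).sub_const 1)).add_const 1
  have h2 := ((Real.hasDerivAt_exp k).sub_const 1).sub (hasDerivAt_id k)
  refine (h1.div h2 hB.ne').congr_deriv ?_
  simp
  congr 1
  ring

lemma exp_sq_ge (k : ℝ) : 0 ≤ (exp k - 1) ^ 2 - k ^ 2 * exp k := by
  have e : exp k = exp (k / 2) ^ 2 := by rw [← Real.exp_nat_mul]; congr 1; push_cast; ring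
  have e2 : exp (k / 2) * exp (-(k / 2)) = 1 := by rw [← Real.exp_add]; simp
  have h : k ^ 2 ≤ (exp (k / 2) - exp (-(k / 2))) ^ 2 := by
    have h1 : |k / 2| ≤ |sinh (k / 2)| := by
      rcases le_total 0 (k / 2) with h | h
      · rw [abs_of_nonneg h]; exact (Real.self_le_sinh_iff.mpr h).trans (le_abs_self _)
      · rw [abs_of_nonpos h]; exact (neg_le_neg (Real.sinh_le_self_iff.mpr h)).trans (neg_le_abs _)
    have := sq_le_sq.mpr h1
    rw [Real.sinh_eq] at this
    nlinarith
  have h3 : (exp k - 1) ^ 2 = (exp (k / 2) - exp (-(k / 2))) ^ 2 * exp k := by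
    rw [e]
    have : exp (k/2) ^ 2 - 1 = (exp (k / 2) - exp (-(k / 2))) * exp (k/2) := by
      linear_combination e2
    rw [this]; ring
  rw [h3]
  nlinarith [Real.exp_pos k]

lemma exp_lin (k : ℝ) : (exp k - 1) * (2 * (exp k - 1) - k * (exp k + 1)) ≤ 0 := by
  have hs : Antitone (fun y : ℝ => 2 * (exp y - 1) - y * (exp y + 1)) := by
    refine antitone_of_hasDerivAt_nonpos (f' := fun y => exp y - 1 - y * exp y) ?_ ?_
    · intro y
      have := (((Real.hasDerivAt_exp y).sub_const 1).const_mul 2).sub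
        ((hasDerivAt_id y).mul ((Real.hasDerivAt_exp y).add_const 1))
      refine this.congr_deriv ?_
      simp; ring
    · intro y
      have h := Real.add_one_le_exp (-y)
      have e2 : exp y * exp (-y) = 1 := by rw [← Real.exp_add]; simp
      have := mul_le_mul_of_nonneg_left h (Real.exp_pos y).le
      simp only [Pi.zero_apply]
      nlinarith
  rcases le_total 0 k with h | h
  · have := hs h
    simp at this
    have h1 : 1 ≤ exp k := Real.one_le_exp h
    nlinarith
  · have := hs h
    simp at this
    have h1 : exp k ≤ 1 := Real.exp_le_one_iff.mpr h
    nlinarith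

/-- the ratio controlling the sign of WW is strictly monotone on positive reals -/
lemma WW_single {m α : ℝ} (_hm : 0 < m) (hα : 0 < α) (hα1 : α ≠ 1) {x y : ℝ} (hx : 0 < x)
    (hxy : x < y) (h : 0 ≤ WW m α x) : 0 < WW m α y := by
  have hmono : StrictMonoOn (fun x => exp (α * x) *
      ((exp ((1 - α) * x) * ((1 - α) * x - 1) + 1) / (exp ((1 - α) * x) - 1 - (1 - α) * x)))
      (Set.Ioi 0) := by
    refine strictMonoOn_of_hasDerivWithinAt_pos (f' := fun x => exp (α * x) * α *
      ((exp ((1 - α) * x) * ((1 - α) * x - 1) + 1) / (exp ((1 - α) * x) - 1 - (1 - α) * x)) +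
       exp (α * x) * ((((exp ((1 - α) * x) - 1) ^ 2 - ((1 - α) * x) ^ 2 * exp ((1 - α) * x))
        / (exp ((1 - α) * x) - 1 - (1 - α) * x) ^ 2) * (1 - α))) (convex_Ioi 0) ?_ ?_ ?_
    · intro z hz
      have hk0 : (1 - α) * z ≠ 0 := mul_ne_zero (sub_ne_zero.mpr hα1.symm) (ne_of_gt hz)
      have hB : 0 < exp ((1 - α) * z) - 1 - (1 - α) * z := by
        have := Real.add_one_lt_exp hk0; linarith
      refine ContinuousAt.continuousWithinAt ?_
      refine ContinuousAt.mul (by fun_prop) (ContinuousAt.div (by fun_prop) (by fun_prop) hB.ne')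
    · intro z hz
      rw [interior_Ioi] at hz
      have hk0 : (1 - α) * z ≠ 0 := mul_ne_zero (sub_ne_zero.mpr hα1.symm) (ne_of_gt hz)
      have h3 : HasDerivAt (fun x => exp (α * x)) (exp (α * z) * α) z := by
        have := (((hasDerivAt_id z).const_mul α).exp)
        simpa using this
      have h4 : HasDerivAt (fun x => (1 - α) * x) (1 - α) z := by
        simpa using (hasDerivAt_id z).const_mul (1 - α)
      have h5 := HasDerivAt.comp z (R_mono hk0) h4
      exact (h3.mul h5).hasDerivWithinAt
    · intro z hz
      rw [interior_Ioi] at hz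
      have hk0 : (1 - α) * z ≠ 0 := mul_ne_zero (sub_ne_zero.mpr hα1.symm) (ne_of_gt hz)
      set k := (1 - α) * z with hk
      have hB : 0 < exp k - 1 - k := by have := Real.add_one_lt_exp hk0; linarith
      have hA : 0 < exp k * (k - 1) + 1 := by
        have h := Real.add_one_lt_exp (neg_ne_zero.mpr hk0)
        have e2 : exp k * exp (-k) = 1 := by rw [← Real.exp_add]; simp
        have := mul_lt_mul_of_pos_left h (Real.exp_pos k)
        nlinarith
      have hE := Real.exp_pos (α * z)
      have hC := exp_sq_ge k
      have hD := exp_lin k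
      have hid : exp (α * z) * α * ((exp k * (k - 1) + 1) / (exp k - 1 - k)) +
          exp (α * z) * ((((exp k - 1) ^ 2 - k ^ 2 * exp k) / (exp k - 1 - k) ^ 2) * (1 - α))
          = exp (α * z) / (exp k - 1 - k) ^ 2 * (α * ((exp k * (k - 1) + 1) * (exp k - 1 - k))
            + (1 - α) * ((exp k - 1) ^ 2 - k ^ 2 * exp k)) := by
        field_simp
      rw [hid]
      refine mul_pos (by positivity) ?_
      have hAB := mul_pos hA hB
      have hCAB : ((exp k - 1) ^ 2 - k ^ 2 * exp k) ≤ (exp k * (k - 1) + 1) * (exp k - 1 - k) := by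
        nlinarith
      rcases lt_or_gt_of_ne hα1 with h | h
      · have := mul_nonneg (sub_nonneg.mpr h.le) hC
        have := mul_pos hα hAB
        linarith
      · have := mul_le_mul_of_nonneg_left hCAB (sub_nonneg.mpr h.le)
        nlinarith
  have hlt := hmono (Set.mem_Ioi.mpr hx) (Set.mem_Ioi.mpr (hx.trans hxy)) hxy
  simp only at hlt
  have hBx : 0 < exp ((1 - α) * x) - 1 - (1 - α) * x := by
    have := Real.add_one_lt_exp (mul_ne_zero (sub_ne_zero.mpr hα1.symm) hx.ne')
    linarith
  have hBy : 0 < exp ((1 - α) * y) - 1 - (1 - α) * y := by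
    have := Real.add_one_lt_exp (mul_ne_zero (sub_ne_zero.mpr hα1.symm) (hx.trans hxy).ne')
    linarith
  unfold WW at h ⊢
  have h1 : m ≤ exp (α * x) * ((exp ((1 - α) * x) * ((1 - α) * x - 1) + 1) /
      (exp ((1 - α) * x) - 1 - (1 - α) * x)) := by
    rw [← mul_div_assoc, le_div_iff₀ hBx]; linarith
  have h2 := h1.trans_lt hlt
  rw [← mul_div_assoc, lt_div_iff₀ hBy] at h2
  linarith

lemma DD_strictAnti_neg {m α : ℝ} (hm : 1 ≤ m) (hα : 0 < α) (hα1 : α ≠ 1) :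
    StrictAntiOn (DD m α) (Set.Iio 0) := by
  have hm0 : 0 < m := by linarith
  refine strictAntiOn_of_hasDerivWithinAt_neg (convex_Iio 0)
    (fun x hx => (hasDerivAt_DD hm0 hα (ne_of_lt hx)).continuousAt.continuousWithinAt)
    (fun x hx => (hasDerivAt_DD hm0 hα (ne_of_lt (by simpa using hx))).hasDerivWithinAt) ?_
  intro x hx
  rw [interior_Iio] at hx
  have hx' : x < 0 := hx
  have : x ≠ 0 := hx'.ne
  refine mul_neg_of_pos_of_neg ?_ (WW_neg_of_neg hm hα hα1 hx')
  have hpos2 : 0 < m + exp (α * x) := by positivity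
  positivity

/-- DD is strictly decreasing up to a point where `WW ≤ 0`. -/
lemma DD_anti {m α : ℝ} (hm : 0 < m) (hα : 0 < α) (hα1 : α ≠ 1) {y : ℝ} (hW : WW m α y ≤ 0) :
    StrictAntiOn (DD m α) (Set.Ioc 0 y) := by
  refine strictAntiOn_of_hasDerivWithinAt_neg (convex_Ioc 0 y)
    (fun x hx => (hasDerivAt_DD hm hα (ne_of_gt hx.1)).continuousAt.continuousWithinAt)
    (fun x hx => (hasDerivAt_DD hm hα (ne_of_gt (interior_subset hx).1)).hasDerivWithinAt) ?_
  intro x hx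
  rw [interior_Ioc] at hx
  have : x ≠ 0 := hx.1.ne'
  have hpos2 : 0 < m + exp (α * x) := by positivity
  refine mul_neg_of_pos_of_neg (by positivity) ?_
  by_contra hcon
  exact absurd (WW_single hm hα hα1 hx.1 hx.2 (not_lt.mp hcon)) (not_lt.mpr hW)

lemma DD_mono {m α : ℝ} (hm : 0 < m) (hα : 0 < α) (hα1 : α ≠ 1) {y : ℝ} (hy : 0 < y)
    (hW : 0 ≤ WW m α y) : StrictMonoOn (DD m α) (Set.Ici y) := by
  have hpos : ∀ x ∈ Set.Ici y, x ≠ 0 := fun x hx => (hy.trans_le hx).ne'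
  refine strictMonoOn_of_hasDerivWithinAt_pos (convex_Ici y)
    (fun x hx => (hasDerivAt_DD hm hα (hpos x hx)).continuousAt.continuousWithinAt)
    (fun x hx => (hasDerivAt_DD hm hα (hpos x (interior_subset hx))).hasDerivWithinAt) ?_
  intro x hx
  have : x ≠ 0 := hpos x (interior_subset hx)
  rw [interior_Ici] at hx
  have hpos2 : 0 < m + exp (α * x) := by positivity
  exact mul_pos (by positivity) (WW_single hm hα hα1 hy hx hW)

/-! ### One-dimensional analysis -/

lemma hasDerivAt_g {m α t : ℝ} (hm : 0 < m) (hα : 0 < α) {x : ℝ} (hx : x ≠ 0) :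
    HasDerivAt (fun x => NN m α x - t * HH m x)
      (-x * (m * exp x / (m + exp x) ^ 2) * (DD m α x - t)) x := by
  refine ((hasDerivAt_NN' hm hα hx).sub ((hasDerivAt_HH hm x).const_mul t)).congr_deriv ?_
  ring

lemma continuous_g {m α t : ℝ} (hm : 0 < m) (hα : 0 < α) :
    Continuous (fun x => NN m α x - t * HH m x) := by
  refine continuous_iff_continuousAt.mpr fun x => ?_
  exact ((hasDerivAt_NN hm hα x).sub ((hasDerivAt_HH hm x).const_mul t)).continuousAt

lemma HH_anti {m : ℝ} (hm : 0 < m) : StrictAntiOn (HH m) (Set.Ici 0) := by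
  refine strictAntiOn_of_hasDerivWithinAt_neg (convex_Ici 0)
    (fun x _ => (hasDerivAt_HH hm x).continuousAt.continuousWithinAt)
    (fun x _ => (hasDerivAt_HH hm x).hasDerivWithinAt) ?_
  intro x hx
  rw [interior_Ici] at hx
  have hx' : 0 < x := hx
  have : 0 < x * (m * exp x / (m + exp x) ^ 2) := by positivity
  linarith

/-- No interior minimum on the negative side. -/
lemma no_min_neg {m α t : ℝ} (hm : 1 ≤ m) (hα : 0 < α) (hα1 : α ≠ 1) {x : ℝ} (hx : x < 0)
    (hmin : ∀ y, NN m α x - t * HH m x ≤ NN m α y - t * HH m y) : False := by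
  have hm0 : 0 < m := by linarith
  have hd := hasDerivAt_g (t := t) hm0 hα hx.ne
  have h0 := (IsLocalMin.hasDerivAt_eq_zero (Filter.Eventually.of_forall hmin) hd)
  have hw : 0 < m * exp x / (m + exp x) ^ 2 := by positivity
  have hD : DD m α x = t := by
    have : -x * (m * exp x / (m + exp x) ^ 2) ≠ 0 := mul_ne_zero (by linarith) hw.ne'
    have := (mul_eq_zero.mp h0).resolve_left this
    linarith
  have hs : StrictMonoOn (fun x => NN m α x - t * HH m x) (Set.Iic x) := by
    refine strictMonoOn_of_hasDerivWithinAt_pos (convex_Iic x)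
      (continuous_g hm0 hα).continuousOn
      (fun y hy => (hasDerivAt_g hm0 hα
        (ne_of_lt (lt_of_le_of_lt (Set.mem_Iic.mp (interior_subset hy)) hx))).hasDerivWithinAt) ?_
    intro y hy
    rw [interior_Iic] at hy
    have hy' : y < x := hy
    have h1 := DD_strictAnti_neg hm hα hα1 (Set.mem_Iio.mpr (hy'.trans hx)) (Set.mem_Iio.mpr hx) hy'
    have hw : 0 < m * exp y / (m + exp y) ^ 2 := by positivity
    have h3 : 0 < -y := by linarith
    have h4 : 0 < DD m α y - t := by linarith
    positivity
  have := hs (Set.mem_Iic.mpr (by linarith : x - 1 ≤ x)) (Set.mem_Iic.mpr le_rfl) (by linarith)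
  have h5 := hmin (x - 1)
  simp only at this
  linarith

/-- The tangent bound on the positive side. -/
lemma tangent_1d {m α : ℝ} (hm : 0 < m) (hα : 0 < α) (hα1 : α ≠ 1) {xs x0 : ℝ} (hxs : 0 < xs)
    (hx0 : xs ≤ x0)
    (htan : NN m α 0 - DD m α xs * HH m 0 = NN m α xs - DD m α xs * HH m xs)
    {x : ℝ} (hx : 0 ≤ x) :
    NN m α x - DD m α x0 * HH m x ≤ NN m α x0 - DD m α x0 * HH m x0 := by
  have hw : ∀ y, 0 < y → 0 < y * (m * exp y / (m + exp y) ^ 2) := by intro y hy; positivity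
  -- step 1
  have hW : 0 < WW m α xs := by
    by_contra hcon
    have hanti := DD_anti hm hα hα1 (not_lt.mp hcon)
    have hs : StrictAntiOn (fun x => NN m α x - DD m α xs * HH m x) (Set.Icc 0 xs) := by
      refine strictAntiOn_of_hasDerivWithinAt_neg (convex_Icc 0 xs)
        (continuous_g hm hα).continuousOn
        (fun y hy => (hasDerivAt_g hm hα (ne_of_gt (by
          rw [interior_Icc] at hy; exact hy.1))).hasDerivWithinAt) ?_
      intro y hy
      rw [interior_Icc] at hy
      have h1 := hanti ⟨hy.1, hy.2.le⟩ ⟨hxs, le_rfl⟩ hy.2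
      have := mul_pos (hw y hy.1) (sub_pos.mpr h1)
      linarith
    have := hs ⟨le_rfl, hxs.le⟩ ⟨hxs.le, le_rfl⟩ hxs
    simp only at this
    linarith
  have hmono := DD_mono hm hα hα1 hxs hW.le
  have hx0p : 0 < x0 := hxs.trans_le hx0
  -- step 2
  have step2 : ∀ y, xs ≤ y →
      NN m α y - DD m α x0 * HH m y ≤ NN m α x0 - DD m α x0 * HH m x0 := by
    intro y hy
    rcases le_total y x0 with h | h
    · have hs : MonotoneOn (fun x => NN m α x - DD m α x0 * HH m x) (Set.Icc xs x0) := by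
        refine monotoneOn_of_hasDerivWithinAt_nonneg (convex_Icc xs x0)
          (continuous_g hm hα).continuousOn
          (fun y hy => (hasDerivAt_g hm hα (ne_of_gt (hxs.trans_le
            (interior_subset hy).1))).hasDerivWithinAt) ?_
        intro y hy
        rw [interior_Icc] at hy
        have h1 := hmono (Set.mem_Ici.mpr hy.1.le) (Set.mem_Ici.mpr hx0) hy.2
        have := mul_pos (hw y (hxs.trans hy.1)) (sub_pos.mpr h1)
        linarith
      exact hs ⟨hy, h⟩ ⟨hx0, le_rfl⟩ h
    · have hs : AntitoneOn (fun x => NN m α x - DD m α x0 * HH m x) (Set.Ici x0) := by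
        refine antitoneOn_of_hasDerivWithinAt_nonpos (convex_Ici x0)
          (continuous_g hm hα).continuousOn
          (fun y hy => (hasDerivAt_g hm hα (ne_of_gt (hx0p.trans_le
            (interior_subset hy)))).hasDerivWithinAt) ?_
        intro y hy
        rw [interior_Ici] at hy
        have hy' : x0 < y := hy
        have h1 := hmono (Set.mem_Ici.mpr hx0) (Set.mem_Ici.mpr (hx0.trans hy'.le)) hy'
        have := mul_pos (hw y (hx0p.trans hy')) (sub_pos.mpr h1)
        linarith
      exact hs (Set.mem_Ici.mpr le_rfl) (Set.mem_Ici.mpr h) h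
  rcases le_or_gt xs x with hxx | hxx
  · exact step2 x hxx
  -- step 3
  have step3 : NN m α x - DD m α xs * HH m x ≤ NN m α xs - DD m α xs * HH m xs := by
    rcases hx.eq_or_lt with h | h
    · rw [← h]; exact htan.le
    by_contra hcon
    push Not at hcon
    obtain ⟨a, ha, hga⟩ := exists_hasDerivAt_eq_slope (fun x => NN m α x - DD m α xs * HH m x)
      (fun x => -x * (m * exp x / (m + exp x) ^ 2) * (DD m α x - DD m α xs)) h
      (continuous_g hm hα).continuousOn (fun y hy => hasDerivAt_g hm hα hy.1.ne')
    obtain ⟨b, hb, hgb⟩ := exists_hasDerivAt_eq_slope (fun x => NN m α x - DD m α xs * HH m x)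
      (fun x => -x * (m * exp x / (m + exp x) ^ 2) * (DD m α x - DD m α xs)) hxx
      (continuous_g hm hα).continuousOn (fun y hy => hasDerivAt_g hm hα (h.trans hy.1).ne')
    have hb0 : 0 < b := h.trans hb.1
    have h1 : DD m α a < DD m α xs := by
      by_contra hc
      have h2 : 0 < (NN m α x - DD m α xs * HH m x - (NN m α 0 - DD m α xs * HH m 0)) / (x - 0) :=
        div_pos (by linarith) (by linarith)
      rw [← hga] at h2
      have := mul_nonneg (hw a ha.1).le (sub_nonneg.mpr (not_lt.mp hc))
      linarith
    have h2 : DD m α xs < DD m α b := by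
      by_contra hc
      have h2 : (NN m α xs - DD m α xs * HH m xs - (NN m α x - DD m α xs * HH m x)) / (xs - x) < 0 :=
        div_neg_of_neg_of_pos (by linarith) (by linarith)
      rw [← hgb] at h2
      have := mul_nonneg (hw b hb0).le (sub_nonneg.mpr (not_lt.mp hc))
      linarith
    rcases le_total (WW m α b) 0 with h3 | h3
    · have := DD_anti hm hα hα1 h3 ⟨ha.1, (ha.2.trans hb.1).le⟩ ⟨hb0, le_rfl⟩ (ha.2.trans hb.1)
      linarith
    · have := DD_mono hm hα hα1 hb0 h3 (Set.mem_Ici.mpr le_rfl) (Set.mem_Ici.mpr hb.2.le) hb.2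
      linarith
  have hH : HH m xs < HH m x := HH_anti hm hx (Set.mem_Ici.mpr hxs.le) hxx
  have ht : DD m α xs ≤ DD m α x0 := hmono.monotoneOn (Set.mem_Ici.mpr le_rfl)
    (Set.mem_Ici.mpr hx0) hx0
  have h2 := step2 xs le_rfl
  nlinarith

/-! ### Moving mass between two coordinates -/

/-- the objective as mass moves between two coordinates -/
noncomputable def FF (K a b α t : ℝ) (ε : ℝ) : ℝ :=
  (K + (a + ε) ^ α + (b - ε) ^ α) ^ (1 / α) +
    t * ((a + ε) * log (a + ε) + (b - ε) * log (b - ε))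

/-- its derivative -/
noncomputable def FF' (K a b α t : ℝ) (ε : ℝ) : ℝ :=
  (K + (a + ε) ^ α + (b - ε) ^ α) ^ (1 / α - 1) * ((a + ε) ^ (α - 1) - (b - ε) ^ (α - 1)) +
    t * (log (a + ε) - log (b - ε))

lemma hasDerivAt_FF {K a b α t ε : ℝ} (hK : 0 ≤ K) (hα : 0 < α) (ha : 0 < a + ε)
    (hb : 0 < b - ε) : HasDerivAt (FF K a b α t) (FF' K a b α t ε) ε := by
  have h1 : HasDerivAt (fun ε => a + ε) 1 ε := (hasDerivAt_id ε).const_add a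
  have h2 : HasDerivAt (fun ε => b - ε) (-1) ε := (hasDerivAt_id ε).const_sub b
  have hS : 0 < K + (a + ε) ^ α + (b - ε) ^ α := by positivity
  have h3 := (((h1.rpow_const (p := α) (Or.inl ha.ne')).const_add K).add
    (h2.rpow_const (p := α) (Or.inl hb.ne'))).rpow_const (p := 1 / α) (Or.inl hS.ne')
  have h4 := ((h1.mul (h1.log ha.ne')).add (h2.mul (h2.log hb.ne'))).const_mul t
  refine (h3.add h4).congr_deriv ?_
  unfold FF'
  simp only [Pi.add_apply]
  generalize (K + (a + ε) ^ α + (b - ε) ^ α) ^ (1 / α - 1) = T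
  generalize (a + ε) ^ (α - 1) = A
  generalize (b - ε) ^ (α - 1) = B
  field_simp
  ring

lemma FF_crit {K a b α t : ℝ} (hK : 0 ≤ K) (hα : 0 < α) (ha : 0 < a) (hb : 0 < b)
    (h : IsLocalExtr (FF K a b α t) 0) :
    (K + a ^ α + b ^ α) ^ (1 / α - 1) * (a ^ (α - 1) - b ^ (α - 1)) + t * (log a - log b) = 0 := by
  have := h.hasDerivAt_eq_zero (hasDerivAt_FF (t := t) hK hα (by linarith : 0 < a + 0)
    (by linarith : 0 < b - 0))
  simpa [FF'] using this

lemma hasDerivAt_FF' {K a α t : ℝ} (hK : 0 ≤ K) (hα : 0 < α) (ha : 0 < a) :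
    HasDerivAt (FF' K a a α t)
      (2 / a * (t - (1 - α) * (K + a ^ α + a ^ α) ^ (1 / α - 1) * a ^ (α - 1))) 0 := by
  have ha1 : 0 < a + 0 := by linarith
  have hb1 : 0 < a - 0 := by linarith
  have h1 : HasDerivAt (fun ε => a + ε) 1 0 := (hasDerivAt_id (0:ℝ)).const_add a
  have h2 : HasDerivAt (fun ε => a - ε) (-1) 0 := (hasDerivAt_id (0:ℝ)).const_sub a
  have hS : 0 < K + (a + 0) ^ α + (a - 0) ^ α := by positivity
  have h3 := (((h1.rpow_const (p := α) (Or.inl ha1.ne')).const_add K).add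
    (h2.rpow_const (p := α) (Or.inl hb1.ne'))).rpow_const (p := 1 / α - 1) (Or.inl hS.ne')
  have h4 := ((h1.log ha1.ne').sub (h2.log hb1.ne')).const_mul t
  have h5 := (h1.rpow_const (p := α - 1) (Or.inl ha1.ne')).sub
    (h2.rpow_const (p := α - 1) (Or.inl hb1.ne'))
  refine ((h3.mul h5).add h4).congr_deriv ?_
  have e1 : a ^ (α - 1) = a ^ (α - 1 - 1) * a := by
    rw [← Real.rpow_add_one ha.ne']; congr 1; ring
  simp only [Pi.add_apply, Pi.sub_apply, add_zero, sub_zero, sub_self, mul_zero, zero_add, e1]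
  field_simp
  ring

/-- second order obstruction -/
lemma not_localMax {f f' : ℝ → ℝ} {s : ℝ} (hf : ∀ᶠ x in nhds (0:ℝ), HasDerivAt f (f' x) x)
    (hf' : HasDerivAt f' s 0) (hs : 0 < s) : ¬ IsLocalMax f 0 := by
  intro hmax
  have h0 : f' 0 = 0 := hmax.hasDerivAt_eq_zero hf.self_of_nhds
  have hd : deriv f =ᶠ[nhds 0] f' := hf.mono fun x hx => hx.deriv
  have hdd : deriv (deriv f) 0 = s := by rw [hd.deriv_eq]; exact hf'.deriv
  have hmin : IsLocalMin f 0 := isLocalMin_of_deriv_deriv_pos (by rw [hdd]; exact hs)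
    (by rw [hd.self_of_nhds, h0]) hf.self_of_nhds.continuousAt
  have hc : f =ᶠ[nhds 0] fun _ => f 0 := by
    filter_upwards [hmax, hmin] with x h1 h2 using le_antisymm h1 h2
  have : deriv (deriv f) 0 = 0 := by
    rw [hc.deriv.deriv_eq]; simp
  linarith

lemma FF_second {K a α t : ℝ} (hK : 0 ≤ K) (hα : 0 < α) (ha : 0 < a)
    (h : IsLocalMax (FF K a a α t) 0) :
    t - (1 - α) * (K + a ^ α + a ^ α) ^ (1 / α - 1) * a ^ (α - 1) ≤ 0 := by
  by_contra hcon
  refine not_localMax ?_ (hasDerivAt_FF' hK hα ha)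
    (mul_pos (by positivity) (not_le.mp hcon)) h
  have : Set.Ioo (-a) a ∈ nhds (0:ℝ) := Ioo_mem_nhds (by linarith) ha
  filter_upwards [this] with x hx
  exact hasDerivAt_FF hK hα (by linarith [hx.1]) (by linarith [hx.2])

lemma FF_second' {K a α t : ℝ} (hK : 0 ≤ K) (hα : 0 < α) (ha : 0 < a)
    (h : IsLocalMin (FF K a a α t) 0) :
    0 ≤ t - (1 - α) * (K + a ^ α + a ^ α) ^ (1 / α - 1) * a ^ (α - 1) := by
  by_contra hcon
  have hn := (hasDerivAt_FF' (t := t) hK hα ha).neg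
  refine not_localMax (f := fun x => - FF K a a α t x) ?_ hn
    (neg_pos.mpr (mul_neg_of_pos_of_neg (by positivity) (not_le.mp hcon))) h.neg
  have : Set.Ioo (-a) a ∈ nhds (0:ℝ) := Ioo_mem_nhds (by linarith) ha
  filter_upwards [this] with x hx
  exact (hasDerivAt_FF hK hα (by linarith [hx.1]) (by linarith [hx.2])).neg

/-- boundary: a zero entry is never optimal for maximisation -/
lemma FF_zero {K b α t : ℝ} (hK : 0 ≤ K) (hα : 0 < α) (hα1 : α ≠ 1) (ht : 0 < t * (1 - α))
    (hb : 0 < b) (h : ∀ ε, 0 ≤ ε → ε ≤ b → FF K 0 b α t ε ≤ FF K 0 b α t 0) : False := by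
  have hid : Filter.Tendsto (fun ε : ℝ => ε) (nhdsWithin 0 (Set.Ioi 0)) (nhds 0) :=
    nhdsWithin_le_nhds
  have hSb : Filter.Tendsto (fun ε : ℝ => (K + ε ^ α + (b - ε) ^ α) ^ (1 / α - 1))
      (nhdsWithin 0 (Set.Ioi 0)) (nhds ((K + 0 ^ α + (b - 0) ^ α) ^ (1 / α - 1))) := by
    refine Filter.Tendsto.rpow_const ?_ (Or.inl ?_)
    · refine (Filter.Tendsto.add (tendsto_const_nhds.add (hid.rpow_const (Or.inr hα.le))) ?_)
      exact (tendsto_const_nhds.sub hid).rpow_const (Or.inr hα.le)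
    · rw [Real.zero_rpow hα.ne', sub_zero]; positivity
  have hc0 : 0 < (K + 0 ^ α + (b - 0) ^ α) ^ (1 / α - 1) := by
    rw [Real.zero_rpow hα.ne', sub_zero]; positivity
  set c0 := (K + 0 ^ α + (b - 0) ^ α) ^ (1 / α - 1) with hc0def
  have hbr : Filter.Tendsto (fun ε : ℝ => -((K + ε ^ α + (b - ε) ^ α) ^ (1 / α - 1) *
      (b - ε) ^ (α - 1)) - t * log (b - ε)) (nhdsWithin 0 (Set.Ioi 0))
      (nhds (-(c0 * (b - 0) ^ (α - 1)) - t * log (b - 0))) := by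
    have h1 : Filter.Tendsto (fun ε : ℝ => b - ε) (nhdsWithin 0 (Set.Ioi 0)) (nhds (b - 0)) :=
      tendsto_const_nhds.sub hid
    have hb0 : b - 0 ≠ 0 := by linarith
    exact ((hSb.mul (h1.rpow_const (Or.inl hb0))).neg).sub ((h1.log hb0).const_mul t)
  have hmain : Filter.Tendsto (fun ε : ℝ => (K + ε ^ α + (b - ε) ^ α) ^ (1 / α - 1) * ε ^ (α - 1)
      + t * log ε) (nhdsWithin 0 (Set.Ioi 0)) Filter.atTop := by
    rcases lt_or_gt_of_ne hα1 with hlt | hgt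
    · have h1 : Filter.Tendsto (fun ε : ℝ => (K + ε ^ α + (b - ε) ^ α) ^ (1 / α - 1) +
          t * (log ε * ε ^ (1 - α))) (nhdsWithin 0 (Set.Ioi 0)) (nhds (c0 + t * 0)) :=
        hSb.add ((tendsto_log_mul_rpow_nhdsGT_zero (by linarith)).const_mul t)
      have h2 : Filter.Tendsto (fun ε : ℝ => ε ^ (α - 1)) (nhdsWithin 0 (Set.Ioi 0))
          Filter.atTop := tendsto_rpow_neg_nhdsGT_zero (by linarith)
      refine (h1.pos_mul_atTop (by simpa using hc0) h2).congr' ?_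
      filter_upwards [self_mem_nhdsWithin] with ε hε
      have hε' : (0:ℝ) < ε := hε
      have : ε ^ (1 - α) * ε ^ (α - 1) = 1 := by
        rw [← Real.rpow_add hε']; simp
      linear_combination (t * log ε) * this
    · have htn : t < 0 := by nlinarith
      have h1 : Filter.Tendsto (fun ε : ℝ => (K + ε ^ α + (b - ε) ^ α) ^ (1 / α - 1) * ε ^ (α - 1))
          (nhdsWithin 0 (Set.Ioi 0)) (nhds (c0 * 0 ^ (α - 1))) :=
        hSb.mul (hid.rpow_const (Or.inr (by linarith)))
      exact h1.add_atTop (Real.tendsto_log_nhdsGT_zero.const_mul_atBot_of_neg htn)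
  have htot := hmain.atTop_add hbr
  have hpos := htot.eventually_gt_atTop 0
  obtain ⟨δ, hδ, hδ'⟩ := mem_nhdsGT_iff_exists_Ioo_subset.mp hpos
  have hδ0 : (0:ℝ) < δ := hδ
  set η := min δ b with hη
  have hη0 : 0 < η := lt_min hδ0 hb
  have hs : StrictMonoOn (FF K 0 b α t) (Set.Icc 0 η) := by
    refine strictMonoOn_of_hasDerivWithinAt_pos (f' := FF' K 0 b α t) (convex_Icc 0 η) ?_ ?_ ?_
    · unfold FF
      have e1 : Continuous fun x : ℝ => (0 + x) * log (0 + x) :=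
        Real.continuous_mul_log.comp (by fun_prop)
      have e2 : Continuous fun x : ℝ => (b - x) * log (b - x) :=
        Real.continuous_mul_log.comp (by fun_prop)
      refine Continuous.continuousOn ?_
      refine Continuous.add ?_ ((e1.add e2).const_smul t)
      refine Continuous.rpow_const ?_ (fun _ => Or.inr (by positivity))
      refine (continuous_const.add ?_).add ?_
      · exact Continuous.rpow_const (by fun_prop) (fun _ => Or.inr hα.le)
      · exact Continuous.rpow_const (by fun_prop) (fun _ => Or.inr hα.le)
    · intro x hx
      rw [interior_Icc] at hx
      exact (hasDerivAt_FF hK hα (by linarith [hx.1])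
        (by linarith [hx.2, min_le_right δ b])).hasDerivWithinAt
    · intro x hx
      rw [interior_Icc] at hx
      have := hδ' ⟨hx.1, hx.2.trans_le (min_le_left δ b)⟩
      unfold FF'
      rw [zero_add]
      simp only [Set.mem_ofPred_eq] at this
      linarith
  have h1 := hs ⟨le_rfl, hη0.le⟩ ⟨hη0.le, le_rfl⟩ hη0
  have h2 := h η hη0.le (min_le_right _ _)
  linarith

/-! ### Vectors -/

/-- the Lagrangian objective -/
noncomputable def GG {n : ℕ} (α t : ℝ) (p : Fin n → ℝ) : ℝ := lNorm α p - t * shannonEntropy p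

/-- move mass `ε` from `j` to `i` -/
noncomputable def mv {n : ℕ} (p : Fin n → ℝ) (i j : Fin n) (ε : ℝ) : Fin n → ℝ :=
  fun k => if k = i then p i + ε else if k = j then p j - ε else p k

lemma sum_split {n : ℕ} (g : Fin n → ℝ) {i j : Fin n} (hij : i ≠ j) :
    ∑ k, g k = ∑ k ∈ (Finset.univ.erase i).erase j, g k + g i + g j := by
  rw [← Finset.sum_erase_add _ _ (Finset.mem_univ i),
    ← Finset.sum_erase_add (Finset.univ.erase i) _ (Finset.mem_erase.mpr ⟨hij.symm, Finset.mem_univ j⟩)]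
  ring

lemma sum_mv {n : ℕ} (p : Fin n → ℝ) {i j : Fin n} (hij : i ≠ j) (ε : ℝ) (f : ℝ → ℝ) :
    ∑ k, f (mv p i j ε k) = ∑ k ∈ (Finset.univ.erase i).erase j, f (p k)
      + f (p i + ε) + f (p j - ε) := by
  rw [sum_split _ hij]
  congr 1
  · congr 1
    · refine Finset.sum_congr rfl fun k hk => ?_
      simp only [Finset.mem_erase, Finset.mem_univ, and_true] at hk
      simp [mv, hk.1, hk.2]
    · simp [mv]
  · simp [mv, hij.symm]

lemma mv_prob {n : ℕ} {p : Fin n → ℝ} (hp : IsProbVec p) {i j : Fin n} (hij : i ≠ j) {ε : ℝ}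
    (h1 : 0 ≤ p i + ε) (h2 : 0 ≤ p j - ε) : IsProbVec (mv p i j ε) := by
  constructor
  · intro k
    unfold mv
    split_ifs
    · exact h1
    · exact h2
    · exact hp.1 k
  · have := sum_mv p hij ε id
    simp only [id] at this
    rw [this]
    have h3 := sum_split p hij
    rw [hp.2] at h3
    linarith

lemma GG_mv {n : ℕ} (p : Fin n → ℝ) {i j : Fin n} (hij : i ≠ j) (α t ε : ℝ) :
    GG α t (mv p i j ε) = FF (∑ k ∈ (Finset.univ.erase i).erase j, p k ^ α) (p i) (p j) α t ε
      + t * ∑ k ∈ (Finset.univ.erase i).erase j, p k * log (p k) := by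
  unfold GG lNorm shannonEntropy FF
  rw [sum_mv p hij ε (fun x => x ^ α), sum_mv p hij ε (fun x => x * log x)]
  ring

lemma mv_zero {n : ℕ} (p : Fin n → ℝ) {i j : Fin n} : mv p i j 0 = p := by
  funext k
  unfold mv
  split_ifs with h1 h2
  · simp [h1]
  · simp [h2]
  · rfl

lemma K_nonneg {n : ℕ} {p : Fin n → ℝ} (hp : IsProbVec p) (α : ℝ) (A : Finset (Fin n)) :
    0 ≤ ∑ k ∈ A, p k ^ α :=
  Finset.sum_nonneg fun k _ => Real.rpow_nonneg (hp.1 k) α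

lemma exists_pos {n : ℕ} {p : Fin n → ℝ} (hp : IsProbVec p) : ∃ i, 0 < p i := by
  by_contra hcon
  push Not at hcon
  have : ∑ i, p i ≤ 0 := Finset.sum_nonpos fun i _ => hcon i
  rw [hp.2] at this
  linarith

lemma S_pos {n : ℕ} {p : Fin n → ℝ} (hp : IsProbVec p) (α : ℝ) : 0 < ∑ k, p k ^ α := by
  obtain ⟨i, hi⟩ := exists_pos hp
  exact Finset.sum_pos' (fun k _ => Real.rpow_nonneg (hp.1 k) α)
    ⟨i, Finset.mem_univ i, Real.rpow_pos_of_pos hi α⟩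

lemma lNorm_pos {n : ℕ} {p : Fin n → ℝ} (hp : IsProbVec p) (α : ℝ) : 0 < lNorm α p :=
  Real.rpow_pos_of_pos (S_pos hp α) _

lemma continuous_GG {n : ℕ} {α : ℝ} (hα : 0 < α) (t : ℝ) :
    Continuous (GG α t : (Fin n → ℝ) → ℝ) := by
  unfold GG lNorm shannonEntropy
  refine Continuous.sub ?_ ?_
  · refine Continuous.rpow_const ?_ (fun _ => Or.inr (by positivity))
    exact continuous_finsetSum _ fun i _ =>
      (continuous_apply i).rpow_const (fun _ => Or.inr hα.le)
  · refine continuous_const.mul (Continuous.neg ?_)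
    exact continuous_finsetSum _ fun i _ => Real.continuous_mul_log.comp (continuous_apply i)

lemma prob_iff {n : ℕ} (p : Fin n → ℝ) : IsProbVec p ↔ p ∈ stdSimplex ℝ (Fin n) := Iff.rfl

lemma uniform_prob {n : ℕ} (hn : 0 < n) : IsProbVec (fun _ : Fin n => (1 : ℝ) / n) := by
  refine ⟨fun _ => by positivity, ?_⟩
  have : (n : ℝ) ≠ 0 := by positivity
  simp [this]

lemma exists_max {n : ℕ} (hn : 0 < n) {α : ℝ} (hα : 0 < α) (t : ℝ) :
    ∃ p : Fin n → ℝ, IsProbVec p ∧ ∀ p' : Fin n → ℝ, IsProbVec p' → GG α t p' ≤ GG α t p := by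
  obtain ⟨p, hp, hmax⟩ := (isCompact_stdSimplex ℝ (Fin n)).exists_isMaxOn
    ⟨_, (prob_iff _).mp (uniform_prob hn)⟩ (continuous_GG hα t).continuousOn
  exact ⟨p, hp, fun p' hp' => hmax hp'⟩

lemma exists_min {n : ℕ} (hn : 0 < n) {α : ℝ} (hα : 0 < α) (t : ℝ) :
    ∃ p : Fin n → ℝ, IsProbVec p ∧ ∀ p' : Fin n → ℝ, IsProbVec p' → GG α t p ≤ GG α t p' := by
  obtain ⟨p, hp, hmin⟩ := (isCompact_stdSimplex ℝ (Fin n)).exists_isMinOn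
    ⟨_, (prob_iff _).mp (uniform_prob hn)⟩ (continuous_GG hα t).continuousOn
  exact ⟨p, hp, fun p' hp' => hmin hp'⟩

lemma crit_sign {c a b α t : ℝ} (hc : 0 < c) (ha : 0 < a) (hab : a < b) (hα1 : α ≠ 1)
    (h : c * (a ^ (α - 1) - b ^ (α - 1)) + t * (log a - log b) = 0) :
    t - (1 - α) * c * a ^ (α - 1) < 0 ∧ 0 < t - (1 - α) * c * b ^ (α - 1) := by
  have hb : 0 < b := ha.trans hab
  have hξ : 0 < log b - log a := sub_pos.mpr (Real.log_lt_log ha hab)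
  set ξ := log b - log a with hξd
  have hk : (1 - α) * ξ ≠ 0 := mul_ne_zero (sub_ne_zero.mpr hα1.symm) hξ.ne'
  have hA : 0 < a ^ (α - 1) := Real.rpow_pos_of_pos ha _
  have hB : 0 < b ^ (α - 1) := Real.rpow_pos_of_pos hb _
  have e1 : b ^ (α - 1) = a ^ (α - 1) * exp (-((1 - α) * ξ)) := by
    rw [Real.rpow_def_of_pos ha, Real.rpow_def_of_pos hb, ← Real.exp_add, hξd]
    congr 1; ring
  have e2 : a ^ (α - 1) = b ^ (α - 1) * exp ((1 - α) * ξ) := by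
    rw [Real.rpow_def_of_pos ha, Real.rpow_def_of_pos hb, ← Real.exp_add, hξd]
    congr 1; ring
  have h1 := Real.add_one_lt_exp hk
  have h2 := Real.add_one_lt_exp (neg_ne_zero.mpr hk)
  have h' : t * ξ = c * (a ^ (α - 1) - b ^ (α - 1)) := by linarith
  constructor
  · have : t * ξ < ((1 - α) * c * a ^ (α - 1)) * ξ := by
      rw [h', e1]
      have := mul_pos (mul_pos hc hA) (sub_pos.mpr h2)
      nlinarith
    have := lt_of_mul_lt_mul_right this hξ.le
    linarith
  · have : ((1 - α) * c * b ^ (α - 1)) * ξ < t * ξ := by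
      rw [h', e2]
      have := mul_pos (mul_pos hc hB) (sub_pos.mpr h1)
      nlinarith
    have := lt_of_mul_lt_mul_right this hξ.le
    linarith

lemma FF_localMax {n : ℕ} {α t : ℝ} {p : Fin n → ℝ} (hp : IsProbVec p)
    (hmax : ∀ p' : Fin n → ℝ, IsProbVec p' → GG α t p' ≤ GG α t p) {i j : Fin n} (hij : i ≠ j)
    (hi : 0 < p i) (hj : 0 < p j) :
    IsLocalMax (FF (∑ k ∈ (Finset.univ.erase i).erase j, p k ^ α) (p i) (p j) α t) 0 := by
  have : Set.Ioo (-p i) (p j) ∈ nhds (0:ℝ) := Ioo_mem_nhds (by linarith) hj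
  filter_upwards [this] with ε hε
  have h1 := hmax _ (mv_prob hp hij (ε := ε) (by linarith [hε.1]) (by linarith [hε.2]))
  have h2 := GG_mv p hij α t ε
  have h3 := GG_mv p hij α t 0
  rw [mv_zero] at h3
  linarith

lemma FF_localMin {n : ℕ} {α t : ℝ} {p : Fin n → ℝ} (hp : IsProbVec p)
    (hmin : ∀ p' : Fin n → ℝ, IsProbVec p' → GG α t p ≤ GG α t p') {i j : Fin n} (hij : i ≠ j)
    (hi : 0 < p i) (hj : 0 < p j) :
    IsLocalMin (FF (∑ k ∈ (Finset.univ.erase i).erase j, p k ^ α) (p i) (p j) α t) 0 := by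
  have : Set.Ioo (-p i) (p j) ∈ nhds (0:ℝ) := Ioo_mem_nhds (by linarith) hj
  filter_upwards [this] with ε hε
  have h1 := hmin _ (mv_prob hp hij (ε := ε) (by linarith [hε.1]) (by linarith [hε.2]))
  have h2 := GG_mv p hij α t ε
  have h3 := GG_mv p hij α t 0
  rw [mv_zero] at h3
  linarith

/-- the sign quantity -/
noncomputable def rho {n : ℕ} (α t : ℝ) (p : Fin n → ℝ) (x : ℝ) : ℝ :=
  t - (1 - α) * (∑ k, p k ^ α) ^ (1 / α - 1) * x ^ (α - 1)

lemma rho_sign {n : ℕ} {α t : ℝ} (hα : 0 < α) (hα1 : α ≠ 1) {p : Fin n → ℝ} (hp : IsProbVec p)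
    {i j : Fin n} (hi : 0 < p i) (hij : p i < p j)
    (h : IsLocalExtr (FF (∑ k ∈ (Finset.univ.erase i).erase j, p k ^ α) (p i) (p j) α t) 0) :
    rho α t p (p i) < 0 ∧ 0 < rho α t p (p j) := by
  have hne : i ≠ j := by rintro rfl; exact lt_irrefl _ hij
  have h1 := FF_crit (K_nonneg hp α _) hα hi (hi.trans hij) h
  rw [← sum_split (fun k => p k ^ α) hne] at h1
  exact crit_sign (Real.rpow_pos_of_pos (S_pos hp α) _) hi hij hα1 h1

/-- two-valued vectors -/
lemma two_val {n : ℕ} {α : ℝ} (hα : 0 < α) {p : Fin n → ℝ} (hp : IsProbVec p) {A : Finset (Fin n)}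
    {i0 : Fin n} (hi0 : i0 ∉ A) {a b : ℝ} (ha : 0 < a) (hb : 0 < b) (hA : ∀ k ∈ A, p k = a)
    (hb' : p i0 = b) (h0 : ∀ k, k ∉ A → k ≠ i0 → p k = 0) :
    lNorm α p = NN A.card α (log (b / a)) ∧ shannonEntropy p = HH A.card (log (b / a)) := by
  have hsum : ∀ f : ℝ → ℝ, f 0 = 0 → ∑ k, f (p k) = A.card * f a + f b := by
    intro f hf
    rw [← Finset.sum_subset (Finset.subset_univ (insert i0 A)), Finset.sum_insert hi0, hb',
      Finset.sum_congr rfl (fun k hk => by rw [hA k hk]), Finset.sum_const, nsmul_eq_mul]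
    · ring
    · intro k _ hk
      simp only [Finset.mem_insert, not_or] at hk
      rw [h0 k hk.2 hk.1, hf]
  have h1 : (A.card : ℝ) * a + b = 1 := by
    have := hsum id rfl
    simp only [id] at this
    rw [← this, hp.2]
  set m : ℝ := (A.card : ℝ) with hm
  have hm0 : 0 ≤ m := by positivity
  have hxe : exp (log (b / a)) = b / a := Real.exp_log (by positivity)
  set x := log (b / a) with hx
  have hbx : b = a * exp x := by rw [hxe]; field_simp
  clear_value m x
  have hpos : 0 < m + exp x := add_pos_of_nonneg_of_pos hm0 (Real.exp_pos x)
  have hpos' : 0 ≤ m + exp (α * x) := add_nonneg hm0 (Real.exp_pos _).le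
  have hax : a * (m + exp x) = 1 := by rw [← h1, hbx]; ring
  have ha' : a = (m + exp x)⁻¹ := eq_inv_of_mul_eq_one_left hax
  constructor
  · unfold lNorm NN
    rw [hsum (fun x => x ^ α) (Real.zero_rpow hα.ne')]
    have e : b ^ α = a ^ α * exp (α * x) := by
      rw [hbx, Real.mul_rpow ha.le (Real.exp_pos x).le, ← Real.exp_mul, mul_comm x α]
    have e2 : m * a ^ α + b ^ α = a ^ α * (m + exp (α * x)) := by rw [e]; ring
    rw [e2, Real.mul_rpow (Real.rpow_nonneg ha.le _) hpos', ← Real.rpow_mul ha.le,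
      mul_one_div_cancel hα.ne', Real.rpow_one, ha', mul_comm, ← div_eq_mul_inv]
  · unfold shannonEntropy HH
    rw [hsum (fun x => x * log x) (by simp)]
    have l1 : log b = log a + x := by rw [hbx, Real.log_mul ha.ne' (Real.exp_pos x).ne', Real.log_exp]
    have l2 : log a = - log (m + exp x) := by rw [ha', Real.log_inv]
    rw [l1, l2]
    have : b = exp x / (m + exp x) := by rw [hbx, ha', div_eq_mul_inv, mul_comm]
    have h3 : m * a = 1 - b := by linarith
    have : x * exp x / (m + exp x) = x * b := by rw [this]; ring
    rw [this]
    linear_combination (log (m + exp x)) * h3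

/-- block vector -/
noncomputable def blk {n : ℕ} (A : Finset (Fin n)) (i0 : Fin n) (x : ℝ) : Fin n → ℝ :=
  fun k => if k = i0 then exp x / (A.card + exp x) else if k ∈ A then 1 / (A.card + exp x) else 0

lemma blk_spec {n : ℕ} {α : ℝ} (hα : 0 < α) {A : Finset (Fin n)} {i0 : Fin n} (hi0 : i0 ∉ A)
    (x : ℝ) : IsProbVec (blk A i0 x) ∧ lNorm α (blk A i0 x) = NN A.card α x ∧
      shannonEntropy (blk A i0 x) = HH A.card x := by
  have hpos : 0 < (A.card : ℝ) + exp x := by positivity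
  have hA : ∀ k ∈ A, blk A i0 x k = 1 / (A.card + exp x) := by
    intro k hk
    have : k ≠ i0 := by rintro rfl; exact hi0 hk
    simp [blk, this, hk]
  have hi : blk A i0 x i0 = exp x / (A.card + exp x) := by simp [blk]
  have h0 : ∀ k, k ∉ A → k ≠ i0 → blk A i0 x k = 0 := by
    intro k hk hk'
    simp [blk, hk, hk']
  have hprob : IsProbVec (blk A i0 x) := by
    constructor
    · intro k
      unfold blk
      split_ifs <;> positivity
    · rw [← Finset.sum_subset (Finset.subset_univ (insert i0 A)), Finset.sum_insert hi0, hi,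
        Finset.sum_congr rfl hA, Finset.sum_const, nsmul_eq_mul]
      · field_simp
        ring
      · intro k _ hk
        simp only [Finset.mem_insert, not_or] at hk
        exact h0 k hk.2 hk.1
  have := two_val hα hprob hi0 (by positivity) (by positivity) hA hi h0
  have e : exp x / (A.card + exp x) / (1 / (A.card + exp x)) = exp x := by field_simp
  rw [e, Real.log_exp] at this
  exact ⟨hprob, this⟩

/-- structure of maximisers -/
lemma max_struct {n : ℕ} (hn : 2 ≤ n) {α t : ℝ} (hα : 0 < α) (hα1 : α ≠ 1)
    (ht : 0 < t * (1 - α)) {p : Fin n → ℝ} (hp : IsProbVec p)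
    (hmax : ∀ p' : Fin n → ℝ, IsProbVec p' → GG α t p' ≤ GG α t p) :
    ∃ x, 0 ≤ x ∧ GG α t p = NN ((n : ℝ) - 1) α x - t * HH ((n : ℝ) - 1) x := by
  -- all entries positive
  have hpos : ∀ i, 0 < p i := by
    intro i
    by_contra hcon
    have hi0 : p i = 0 := le_antisymm (not_lt.mp hcon) (hp.1 i)
    obtain ⟨j, hj⟩ := exists_pos hp
    have hij : i ≠ j := by rintro rfl; linarith
    refine FF_zero (K_nonneg hp α ((Finset.univ.erase i).erase j)) hα hα1 ht hj ?_
    intro ε h0 h1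
    have h2 := hmax _ (mv_prob hp hij (ε := ε) (by linarith) (by linarith))
    have h3 := GG_mv p hij α t ε
    have h4 := GG_mv p hij α t 0
    rw [mv_zero] at h4
    rw [hi0] at h3 h4
    linarith
  have hsign : ∀ i j, p i < p j → rho α t p (p i) < 0 ∧ 0 < rho α t p (p j) := by
    intro i j h
    have hne : i ≠ j := by rintro rfl; exact lt_irrefl _ h
    exact rho_sign hα hα1 hp (hpos i) h (Or.inr (FF_localMax hp hmax hne (hpos i) (hpos j)))
  have hsec : ∀ i j, i ≠ j → p i = p j → rho α t p (p j) ≤ 0 := by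
    intro i j hne h
    have h1 := FF_localMax hp hmax hne (hpos i) (hpos j)
    rw [h] at h1
    have h2 := FF_second (K_nonneg hp α _) hα (hpos j) h1
    have h3 := sum_split (fun k => p k ^ α) hne
    simp only [h] at h3
    rw [← h3] at h2
    exact h2
  have : Nonempty (Fin n) := ⟨⟨0, by omega⟩⟩
  obtain ⟨i0, -, hi0⟩ := Finset.exists_max_image Finset.univ p Finset.univ_nonempty
  have : Nontrivial (Fin n) := Fin.nontrivial_iff_two_le.mpr hn
  obtain ⟨j, hj⟩ := exists_ne i0
  have hle : p j ≤ p i0 := hi0 j (Finset.mem_univ j)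
  have hA : ∀ k ∈ Finset.univ.erase i0, p k = p j := by
    intro k hk
    have hk' : k ≠ i0 := (Finset.mem_erase.mp hk).1
    have hkle : p k ≤ p i0 := hi0 k (Finset.mem_univ k)
    by_contra hne
    -- the max strictly exceeds one of them, hence rho i0 > 0
    have hr0 : 0 < rho α t p (p i0) := by
      rcases lt_or_gt_of_ne hne with h | h
      · exact (hsign k i0 (h.trans_le hle)).2
      · exact (hsign j i0 (h.trans_le hkle)).2
    have hk2 : p k < p i0 := by
      refine lt_of_le_of_ne hkle fun h => ?_
      have := hsec k i0 hk' h
      linarith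
    have hj2 : p j < p i0 := by
      refine lt_of_le_of_ne hle fun h => ?_
      have := hsec j i0 hj h
      linarith
    rcases lt_or_gt_of_ne hne with h | h
    · have h1 := (hsign k j h).2
      have h2 := (hsign j i0 hj2).1
      linarith
    · have h1 := (hsign j k h).2
      have h2 := (hsign k i0 hk2).1
      linarith
  have htv := two_val hα hp (Finset.notMem_erase i0 _) (hpos j) (hpos i0) hA rfl
    (fun k hk hk' => absurd (Finset.mem_erase.mpr ⟨hk', Finset.mem_univ k⟩) hk)
  have hcard : (((Finset.univ.erase i0).card : ℕ) : ℝ) = (n : ℝ) - 1 := by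
    rw [Finset.card_erase_of_mem (Finset.mem_univ i0), Finset.card_univ, Fintype.card_fin,
      Nat.cast_sub (by omega)]
    simp
  rw [hcard] at htv
  refine ⟨log (p i0 / p j), Real.log_nonneg ?_, ?_⟩
  · rw [le_div_iff₀ (hpos j)]; linarith
  · unfold GG; rw [htv.1, htv.2]

/-- structure of minimisers: uniform on the support -/
lemma min_struct {n : ℕ} {α t : ℝ} (hα : 0 < α) (hα1 : α ≠ 1)
    {p : Fin n → ℝ} (hp : IsProbVec p)
    (hmin : ∀ p' : Fin n → ℝ, IsProbVec p' → GG α t p ≤ GG α t p') :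
    ∃ j : ℕ, 1 ≤ j ∧ GG α t p = (j : ℝ) ^ (1 / α - 1) - t * log j := by
  have hsign : ∀ i j, 0 < p i → p i < p j → rho α t p (p i) < 0 ∧ 0 < rho α t p (p j) := by
    intro i j hi h
    have hne : i ≠ j := by rintro rfl; exact lt_irrefl _ h
    exact rho_sign hα hα1 hp hi h (Or.inl (FF_localMin hp hmin hne hi (hi.trans h)))
  have hsec : ∀ i j, 0 < p i → i ≠ j → p i = p j → 0 ≤ rho α t p (p j) := by
    intro i j hi hne h
    have h1 := FF_localMin hp hmin hne hi (h ▸ hi)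
    rw [h] at h1
    have h2 := FF_second' (K_nonneg hp α _) hα (h ▸ hi) h1
    have h3 := sum_split (fun k => p k ^ α) hne
    simp only [h] at h3
    rw [← h3] at h2
    exact h2
  obtain ⟨i1, hi1⟩ := exists_pos hp
  obtain ⟨i0, hi0m, hi0⟩ := Finset.exists_min_image (Finset.univ.filter fun k => 0 < p k) p
    ⟨i1, by simpa using hi1⟩
  have hi0p : 0 < p i0 := by simpa using hi0m
  have hi0' : ∀ k, 0 < p k → p i0 ≤ p k := fun k hk => hi0 k (by simpa using hk)
  set A := (Finset.univ.filter fun k => 0 < p k).erase i0 with hAdef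
  have hnot : i0 ∉ A := Finset.notMem_erase i0 _
  have hmem : ∀ k, k ∈ A ↔ k ≠ i0 ∧ 0 < p k := by intro k; simp [hAdef]
  have hout : ∀ k, k ∉ A → k ≠ i0 → p k = 0 := by
    intro k hk hk'
    rw [hmem] at hk
    push Not at hk
    exact le_antisymm (hk hk') (hp.1 k)
  by_cases hall : ∀ k ∈ A, p k = p i0
  · -- uniform
    have htv := two_val hα hp hnot hi0p hi0p hall rfl hout
    rw [div_self hi0p.ne', Real.log_one] at htv
    refine ⟨A.card + 1, by omega, ?_⟩
    unfold GG
    rw [htv.1, htv.2]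
    unfold NN HH
    have hpos : (0:ℝ) < (A.card : ℝ) + 1 := by positivity
    push_cast
    simp only [mul_zero, Real.exp_zero, zero_mul, zero_div, sub_zero]
    rw [Real.rpow_sub hpos, Real.rpow_one]
  · exfalso
    push Not at hall
    obtain ⟨j, hjA, hj⟩ := hall
    have hjp := ((hmem j).mp hjA).2
    have hlt : p i0 < p j := lt_of_le_of_ne (hi0' j hjp) (Ne.symm hj)
    have hr0 := (hsign i0 j hi0p hlt).1
    have hA : ∀ k ∈ A, p k = p j := by
      intro k hk
      obtain ⟨hk0, hkp⟩ := (hmem k).mp hk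
      have hk2 : p i0 < p k := by
        refine lt_of_le_of_ne (hi0' k hkp) fun h => ?_
        have := hsec k i0 hkp hk0 h.symm
        linarith
      by_contra hne
      rcases lt_or_gt_of_ne hne with h | h
      · have h1 := (hsign k j hkp h).1
        have h2 := (hsign i0 k hi0p hk2).2
        linarith
      · have h1 := (hsign j k hjp h).1
        have h2 := (hsign i0 j hi0p hlt).2
        linarith
    have htv := two_val hα hp hnot hjp hi0p hA rfl hout
    have hm : (1:ℝ) ≤ A.card := by
      have : 0 < A.card := Finset.card_pos.mpr ⟨j, hjA⟩
      exact_mod_cast this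
    have hx : log (p i0 / p j) < 0 := by
      refine Real.log_neg (by positivity) ?_
      rw [div_lt_one hjp]; exact hlt
    refine no_min_neg (t := t) hm hα hα1 hx fun y => ?_
    have hb := blk_spec hα hnot y
    have := hmin _ hb.1
    unfold GG at this
    rw [htv.1, htv.2, hb.2.1, hb.2.2] at this
    exact this

/-! ### Entropy facts -/

lemma le_one {n : ℕ} {p : Fin n → ℝ} (hp : IsProbVec p) (i : Fin n) : p i ≤ 1 := by
  rw [← hp.2]
  exact Finset.single_le_sum (fun k _ => hp.1 k) (Finset.mem_univ i)

lemma ent_nonneg {n : ℕ} {p : Fin n → ℝ} (hp : IsProbVec p) : 0 ≤ shannonEntropy p := by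
  unfold shannonEntropy
  rw [neg_nonneg]
  exact Finset.sum_nonpos fun i _ => Real.mul_log_nonpos (hp.1 i) (le_one hp i)

lemma ent_le {n : ℕ} (hn : 0 < n) {p : Fin n → ℝ} (hp : IsProbVec p) :
    shannonEntropy p ≤ log n := by
  have hn' : (0:ℝ) < n := by exact_mod_cast hn
  have h1 : ∀ i, -(p i * log (p i)) - p i * log n ≤ 1 / n - p i := by
    intro i
    rcases (hp.1 i).eq_or_lt with h | h
    · rw [← h]; simp
    · have := Real.log_le_sub_one_of_pos (x := 1 / (n * p i)) (by positivity)
      rw [one_div, Real.log_inv, Real.log_mul hn'.ne' h.ne'] at this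
      have h2 := mul_le_mul_of_nonneg_left this h.le
      have h3 : p i * ((n * p i)⁻¹ - 1) = 1 / n - p i := by field_simp
      rw [h3] at h2
      linarith
  have h2 := Finset.sum_le_sum (fun i (_ : i ∈ Finset.univ) => h1 i)
  rw [Finset.sum_sub_distrib, Finset.sum_sub_distrib, Finset.sum_neg_distrib,
    ← Finset.sum_mul, hp.2, Finset.sum_const, Finset.card_univ, Fintype.card_fin,
    nsmul_eq_mul, mul_one_div_cancel hn'.ne'] at h2
  unfold shannonEntropy
  linarith

lemma norm_of_ent_zero {n : ℕ} {p : Fin n → ℝ} (hp : IsProbVec p) (h : shannonEntropy p = 0)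
    {α : ℝ} (hα : 0 < α) : lNorm α p = 1 := by
  unfold shannonEntropy at h
  rw [neg_eq_zero, Finset.sum_eq_zero_iff_of_nonpos
    (fun i _ => Real.mul_log_nonpos (hp.1 i) (le_one hp i))] at h
  have h1 : ∀ i, p i ^ α = p i := by
    intro i
    have h2 := h i (Finset.mem_univ i)
    rcases mul_eq_zero.mp h2 with h3 | h3
    · rw [h3, Real.zero_rpow hα.ne']
    · rcases (hp.1 i).eq_or_lt with h4 | h4
      · rw [← h4, Real.zero_rpow hα.ne']
      · rw [Real.eq_one_of_pos_of_log_eq_zero h4 h3, Real.one_rpow]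
  unfold lNorm
  rw [Finset.sum_congr rfl (fun i _ => h1 i), hp.2, Real.one_rpow]

/-! ### Part (a) -/

lemma convex_exp_int {θ : ℝ} {k j : ℕ} (hk : 1 ≤ k) (hj : 1 ≤ j) :
    (k : ℝ) ^ θ - (((k : ℝ) + 1) ^ θ - (k : ℝ) ^ θ) / (log ((k : ℝ) + 1) - log k) * log k ≤
    (j : ℝ) ^ θ - (((k : ℝ) + 1) ^ θ - (k : ℝ) ^ θ) / (log ((k : ℝ) + 1) - log k) * log j := by
  have hconv : ConvexOn ℝ Set.univ (fun h : ℝ => exp (h * θ)) := by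
    have := convexOn_exp.comp_linearMap (LinearMap.mulRight ℝ θ)
    exact this
  have hk0 : (0:ℝ) < k := by exact_mod_cast hk
  have hj0 : (0:ℝ) < j := by exact_mod_cast hj
  rw [Real.rpow_def_of_pos hk0, Real.rpow_def_of_pos hj0,
    Real.rpow_def_of_pos (by positivity : (0:ℝ) < (k:ℝ) + 1)]
  have huv : log (k : ℝ) < log ((k : ℝ) + 1) := Real.log_lt_log hk0 (by linarith)
  have hcase : j < k ∨ j = k ∨ j = k + 1 ∨ k + 1 < j := by omega
  set u := log (k : ℝ)
  set v := log ((k : ℝ) + 1) with hv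
  set w := log (j : ℝ) with hw
  have hvu : v - u ≠ 0 := by linarith
  have ht : (exp (v * θ) - exp (u * θ)) / (v - u) * (v - u) = exp (v * θ) - exp (u * θ) :=
    div_mul_cancel₀ _ hvu
  rcases hcase with h | h | h | h
  · have hwu : w < u := Real.log_lt_log hj0 (by exact_mod_cast h)
    have := hconv.slope_mono_adjacent (Set.mem_univ w) (Set.mem_univ v) hwu huv
    rw [div_le_iff₀ (by linarith)] at this
    linarith
  · have : w = u := by rw [hw, h]
    rw [this]
  · have : w = v := by rw [hw, h, hv]; push_cast; rfl
    rw [this]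
    linarith
  · have hvw : v < w := Real.log_lt_log (by positivity) (by exact_mod_cast h)
    have := hconv.slope_mono_adjacent (Set.mem_univ u) (Set.mem_univ w) huv hvw
    rw [le_div_iff₀ (by linarith)] at this
    linarith

lemma part_a {n : ℕ} (hn : 2 ≤ n) {m : ℕ} {q : Fin m → ℝ} {p : Fin m → Fin n → ℝ}
    (hq0 : ∀ y, 0 ≤ q y) (hq1 : ∑ y, q y = 1) (hp : ∀ y, IsProbVec (p y))
    {α : ℝ} (hα : 0 < α) (hα1 : α ≠ 1) :
    0 < Lmin α (∑ y, q y * shannonEntropy (p y)) ∧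
    Lmin α (∑ y, q y * shannonEntropy (p y)) ≤ ∑ y, q y * lNorm α (p y) := by
  have hh : 0 ≤ ∑ y, q y * shannonEntropy (p y) :=
    Finset.sum_nonneg fun y _ => mul_nonneg (hq0 y) (ent_nonneg (hp y))
  set h := ∑ y, q y * shannonEntropy (p y) with hdef
  unfold Lmin
  have hk : 1 ≤ ⌊exp h⌋₊ := Nat.one_le_floor_iff _ |>.mpr (Real.one_le_exp hh)
  have hk1 : (⌊exp h⌋₊ : ℝ) ≤ exp h := Nat.floor_le (Real.exp_pos h).le
  have hk2 : exp h < (⌊exp h⌋₊ : ℝ) + 1 := Nat.lt_floor_add_one _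
  generalize ⌊exp h⌋₊ = k at *
  have hk0 : (0:ℝ) < k := by exact_mod_cast hk
  have hl1 : log (k : ℝ) ≤ h := (Real.log_le_iff_le_exp hk0).mpr hk1
  have hl2 : h ≤ log ((k : ℝ) + 1) := ((Real.lt_log_iff_exp_lt (by positivity)).mpr hk2).le
  have huv : log (k : ℝ) < log ((k : ℝ) + 1) := Real.log_lt_log hk0 (by linarith)
  have hconv := fun j : ℕ => fun hj : 1 ≤ j => convex_exp_int (θ := 1 / α - 1) hk hj
  have hA : 0 < (k : ℝ) ^ (1 / α - 1) := by positivity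
  have hB : 0 < ((k : ℝ) + 1) ^ (1 / α - 1) := by positivity
  generalize (k : ℝ) ^ (1 / α - 1) = A at *
  generalize ((k : ℝ) + 1) ^ (1 / α - 1) = B at *
  generalize log (k : ℝ) = u at *
  generalize log ((k : ℝ) + 1) = v at *
  have hvu : 0 < v - u := by linarith
  constructor
  · have h1 : 0 ≤ (v - h) / (v - u) := div_nonneg (by linarith) hvu.le
    have h2 : (v - h) / (v - u) ≤ 1 := by rw [div_le_one hvu]; linarith
    rcases h1.eq_or_lt with h3 | h3
    · rw [← h3]; simpa using hB
    · have := mul_pos h3 hA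
      have := mul_nonneg (sub_nonneg.mpr h2) hB.le
      linarith
  · set t := (B - A) / (v - u) with ht
    have key : ∀ y, A + t * (shannonEntropy (p y) - u) ≤ lNorm α (p y) := by
      intro y
      obtain ⟨p0, hp0, hmin⟩ := exists_min (n := n) (by omega) hα t
      obtain ⟨j, hj, hj'⟩ := min_struct hα hα1 hp0 hmin
      have h1 := hmin _ (hp y)
      have h2 := hconv j hj
      rw [hj'] at h1
      unfold GG at h1
      linarith
    have hsum : ∑ y, q y * (A + t * (shannonEntropy (p y) - u)) ≤ ∑ y, q y * lNorm α (p y) :=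
      Finset.sum_le_sum fun y _ => mul_le_mul_of_nonneg_left (key y) (hq0 y)
    have e : ∑ y, q y * (A + t * (shannonEntropy (p y) - u)) = A + t * (h - u) := by
      have : ∀ y, q y * (A + t * (shannonEntropy (p y) - u))
          = q y * (A - t * u) + t * (q y * shannonEntropy (p y)) := by intro y; ring
      rw [Finset.sum_congr rfl (fun y _ => this y), Finset.sum_add_distrib, ← Finset.sum_mul, hq1,
        ← Finset.mul_sum, ← hdef]
      ring
    rw [e] at hsum
    refine le_trans (le_of_eq ?_) hsum
    rw [ht]
    field_simp
    ring

/-! ### Part (b) -/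

/-- log ratio parameter -/
noncomputable def xx (n : ℕ) (r : ℝ) : ℝ := log ((1 - ((n : ℝ) - 1) * r) / r)

lemma vVec_prob {n : ℕ} (hn : 2 ≤ n) {r : ℝ} (hr : 0 ≤ r) (hr' : r ≤ 1 / n) :
    IsProbVec (vVec n r) := by
  have hn' : (0:ℝ) < n := by positivity
  have h1 : n * r ≤ 1 := by rw [le_div_iff₀ hn'] at hr'; linarith
  obtain ⟨k, rfl⟩ : ∃ k, n = k + 1 := ⟨n - 1, by omega⟩
  constructor
  · intro i
    unfold vVec
    split_ifs
    · push_cast at *; nlinarith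
    · exact hr
  · rw [Fin.sum_univ_succ]
    simp [vVec]

lemma vVec_spec {n : ℕ} (hn : 2 ≤ n) {α : ℝ} (hα : 0 < α) {r : ℝ} (hr : 0 < r)
    (hr' : r ≤ 1 / n) :
    lNorm α (vVec n r) = NN ((n : ℝ) - 1) α (xx n r) ∧ Hv n r = HH ((n : ℝ) - 1) (xx n r) := by
  have hn' : (0:ℝ) < n := by positivity
  have h1 : n * r ≤ 1 := by rw [le_div_iff₀ hn'] at hr'; linarith
  set i0 : Fin n := ⟨0, by omega⟩ with hi0
  have htv := two_val hα (vVec_prob hn hr.le hr') (Finset.notMem_erase i0 Finset.univ) hr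
    (b := 1 - ((n : ℝ) - 1) * r) (by nlinarith)
    (by
      intro k hk
      have hk' : k ≠ i0 := (Finset.mem_erase.mp hk).1
      have : (k : ℕ) ≠ 0 := fun h => hk' (Fin.ext h)
      simp [vVec, this])
    (by simp [vVec, hi0])
    (fun k hk hk' => absurd (Finset.mem_erase.mpr ⟨hk', Finset.mem_univ k⟩) hk)
  have hcard : (((Finset.univ.erase i0).card : ℕ) : ℝ) = (n : ℝ) - 1 := by
    rw [Finset.card_erase_of_mem (Finset.mem_univ i0), Finset.card_univ, Fintype.card_fin,
      Nat.cast_sub (by omega)]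
    simp
  rw [hcard] at htv
  exact htv

lemma xx_pos {n : ℕ} (hn : 2 ≤ n) {r : ℝ} (hr : 0 < r) (hr' : r < 1 / n) : 0 < xx n r := by
  have hn' : (0:ℝ) < n := by positivity
  have h1 : n * r < 1 := by rw [lt_div_iff₀ hn'] at hr'; linarith
  refine Real.log_pos ?_
  rw [lt_div_iff₀ hr]
  linarith

lemma xx_anti {n : ℕ} (hn : 2 ≤ n) {r s : ℝ} (hr : 0 < r) (hrs : r ≤ s) (hs : s < 1 / n) :
    xx n s ≤ xx n r := by
  have hn' : (0:ℝ) < n := by positivity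
  have h1 : n * s < 1 := by rw [lt_div_iff₀ hn'] at hs; linarith
  have hs0 : 0 < s := hr.trans_le hrs
  refine Real.log_le_log (div_pos (by linarith) hs0) ?_
  rw [div_le_div_iff₀ hs0 hr]
  nlinarith

lemma Dva_eq {n : ℕ} (hn : 2 ≤ n) {α : ℝ} (hα : 0 < α) {r : ℝ} (hr : 0 < r)
    (hr' : r < 1 / n) : Dva n α r = DD ((n : ℝ) - 1) α (xx n r) := by
  have hn' : (0:ℝ) < n := by positivity
  have hn2 : (2:ℝ) ≤ n := by exact_mod_cast hn
  have h1 : n * r < 1 := by rw [lt_div_iff₀ hn'] at hr'; linarith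
  have hb : 0 < 1 - ((n : ℝ) - 1) * r := by linarith
  unfold Dva DD xx
  generalize 1 - ((n : ℝ) - 1) * r = b at *
  have hm : 0 ≤ (n : ℝ) - 1 := by linarith
  generalize (n : ℝ) - 1 = m at *
  have hx : log (b / r) = log b - log r := Real.log_div hb.ne' hr.ne'
  rw [hx]
  have e1 : b ^ α = r ^ α * exp (α * (log b - log r)) := by
    rw [Real.rpow_def_of_pos hr, Real.rpow_def_of_pos hb, ← Real.exp_add]; congr 1; ring
  have e2 : b ^ (α - 1) = r ^ (α - 1) * exp (-((1 - α) * (log b - log r))) := by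
    rw [Real.rpow_def_of_pos hr, Real.rpow_def_of_pos hb, ← Real.exp_add]; congr 1; ring
  have e3 : m * r ^ α + r ^ α * exp (α * (log b - log r))
      = r ^ α * (m + exp (α * (log b - log r))) := by ring
  have e4 : (r ^ α) ^ (1 / α - 1) * r ^ (α - 1) = 1 := by
    rw [← Real.rpow_mul hr.le, ← Real.rpow_add hr]
    have : α * (1 / α - 1) + (α - 1) = 0 := by field_simp; ring
    rw [this, Real.rpow_zero]
  rw [e1, e2, e3, Real.mul_rpow (by positivity) (add_nonneg hm (Real.exp_pos _).le)]
  generalize (m + exp (α * (log b - log r))) ^ (1 / α - 1) = T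
  generalize exp (-((1 - α) * (log b - log r))) = U
  rw [show r ^ (α - 1) - r ^ (α - 1) * U = r ^ (α - 1) * (1 - U) by ring]
  rw [mul_div_assoc]
  linear_combination (T * ((1 - U) / (log b - log r))) * e4

lemma DD_sign {m α x : ℝ} (hm : 0 < m) (hα1 : α ≠ 1) (hx : 0 < x) :
    0 < DD m α x * (1 - α) := by
  unfold DD
  have hP : 0 < (m + exp (α * x)) ^ (1 / α - 1) := by positivity
  have h2 : 0 < (1 - exp (-((1 - α) * x))) * (1 - α) := by
    rcases lt_or_gt_of_ne hα1 with h | h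
    · have h1 : 0 < (1 - α) * x := mul_pos (by linarith) hx
      have : exp (-((1 - α) * x)) < 1 := by rw [Real.exp_lt_one_iff]; linarith
      exact mul_pos (by linarith) (by linarith)
    · have h1 : (1 - α) * x < 0 := mul_neg_of_neg_of_pos (by linarith) hx
      have : 1 < exp (-((1 - α) * x)) := by rw [Real.one_lt_exp_iff]; linarith
      exact mul_pos_of_neg_of_neg (by linarith) (by linarith)
  have : (m + exp (α * x)) ^ (1 / α - 1) * ((1 - exp (-((1 - α) * x))) / x) * (1 - α)
    = (m + exp (α * x)) ^ (1 / α - 1) * (((1 - exp (-((1 - α) * x))) * (1 - α)) / x) := by ring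
  rw [this]
  positivity

/-- the tangent line bound for all probability vectors -/
lemma tangent_vec {n : ℕ} (hn : 2 ≤ n) {α : ℝ} (hα : 0 < α) (hα1 : α ≠ 1) {ps r : ℝ}
    (hps : ps ∈ Set.Ioo (0:ℝ) (1 / n)) (htan : TangencyEq n α ps) (hr : 0 < r) (hrp : r ≤ ps)
    {p : Fin n → ℝ} (hp : IsProbVec p) :
    lNorm α p ≤ lNorm α (vVec n r) + Dva n α r * (shannonEntropy p - Hv n r) := by
  have hn2 : (2:ℝ) ≤ n := by exact_mod_cast hn
  have hm : (0:ℝ) < (n : ℝ) - 1 := by linarith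
  have hr' : r < 1 / n := hrp.trans_lt hps.2
  have hxs := xx_pos hn hps.1 hps.2
  have hx0 := xx_anti hn hr hrp hps.2
  have s1 := vVec_spec hn hα hps.1 hps.2.le
  have s2 := vVec_spec hn hα hr hr'.le
  have hN0 : NN ((n : ℝ) - 1) α 0 = (n : ℝ) ^ (1 / α - 1) := by
    unfold NN
    have hn0 : (0:ℝ) < n := by linarith
    simp only [mul_zero, Real.exp_zero, sub_add_cancel]
    rw [Real.rpow_sub hn0, Real.rpow_one]
  have hH0 : HH ((n : ℝ) - 1) 0 = log n := by unfold HH; simp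
  unfold TangencyEq at htan
  rw [s1.1, s1.2, Dva_eq hn hα hps.1 hps.2, ← hN0, ← hH0] at htan
  obtain ⟨p0, hp0, hmax⟩ := exists_max (n := n) (by omega) hα (Dva n α r)
  have hsgn : 0 < Dva n α r * (1 - α) := by
    rw [Dva_eq hn hα hr hr']
    exact DD_sign hm hα1 (hxs.trans_le hx0)
  obtain ⟨x, hx, hGG⟩ := max_struct hn hα hα1 hsgn hp0 hmax
  have h1 := hmax p hp
  rw [hGG] at h1
  have h2 := tangent_1d hm hα hα1 hxs hx0 (by linarith) hx
  rw [← Dva_eq hn hα hr hr', ← s2.1, ← s2.2] at h2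
  unfold GG at h1
  linarith

lemma Hv_continuous (n : ℕ) : Continuous (Hv n) := by
  unfold Hv shannonEntropy
  refine Continuous.neg (continuous_finsetSum _ fun i _ => ?_)
  refine Real.continuous_mul_log.comp (f := fun q => vVec n q i) ?_
  unfold vVec
  split_ifs <;> fun_prop

lemma Hv_zero {n : ℕ} : Hv n 0 = 0 := by
  unfold Hv shannonEntropy
  rw [neg_eq_zero]
  refine Finset.sum_eq_zero fun i _ => ?_
  unfold vVec
  split_ifs <;> simp

lemma part_b {n : ℕ} (hn : 2 ≤ n) {m : ℕ} {q : Fin m → ℝ} {p : Fin m → Fin n → ℝ}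
    (hq0 : ∀ y, 0 ≤ q y) (hq1 : ∑ y, q y = 1) (hp : ∀ y, IsProbVec (p y))
    {α : ℝ} (hα : 0 < α) (hα1 : α ≠ 1) {ps : ℝ} (hps : ps ∈ Set.Ioo (0 : ℝ) (1 / (n : ℝ)))
    (htan : TangencyEq n α ps) (L : ℝ → ℝ)
    (hL1 : ∀ r ∈ Set.Icc (0 : ℝ) (1 / (n : ℝ)), Hv n r ≤ Hv n ps →
          L (Hv n r) = lNorm α (vVec n r))
    (hL2 : ∀ h ∈ Set.Icc (0 : ℝ) (Real.log n), Hv n ps < h →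
          L h = ((Real.log n - h) / (Real.log n - Hv n ps)) * lNorm α (vVec n ps) +
            (1 - (Real.log n - h) / (Real.log n - Hv n ps)) * (n : ℝ) ^ (1 / α - 1)) :
    ∑ y, q y * lNorm α (p y) ≤ L (∑ y, q y * shannonEntropy (p y)) := by
  have hh : 0 ≤ ∑ y, q y * shannonEntropy (p y) :=
    Finset.sum_nonneg fun y _ => mul_nonneg (hq0 y) (ent_nonneg (hp y))
  have hhn : ∑ y, q y * shannonEntropy (p y) ≤ log n := by
    calc _ ≤ ∑ y, q y * log n :=
          Finset.sum_le_sum fun y _ => mul_le_mul_of_nonneg_left (ent_le (by omega) (hp y)) (hq0 y)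
      _ = log n := by rw [← Finset.sum_mul, hq1, one_mul]
  -- general tangent bound
  have htl : ∀ r, 0 < r → r ≤ ps → ∑ y, q y * lNorm α (p y) ≤
      lNorm α (vVec n r) + Dva n α r * (∑ y, q y * shannonEntropy (p y) - Hv n r) := by
    intro r hr hrp
    have hsum : ∑ y, q y * lNorm α (p y) ≤
        ∑ y, q y * (lNorm α (vVec n r) + Dva n α r * (shannonEntropy (p y) - Hv n r)) :=
      Finset.sum_le_sum fun y _ => mul_le_mul_of_nonneg_left
        (tangent_vec hn hα hα1 hps htan hr hrp (hp y)) (hq0 y)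
    refine hsum.trans (le_of_eq ?_)
    have : ∀ y, q y * (lNorm α (vVec n r) + Dva n α r * (shannonEntropy (p y) - Hv n r))
        = q y * (lNorm α (vVec n r) - Dva n α r * Hv n r)
          + Dva n α r * (q y * shannonEntropy (p y)) := by intro y; ring
    rw [Finset.sum_congr rfl (fun y _ => this y), Finset.sum_add_distrib, ← Finset.sum_mul, hq1,
      ← Finset.mul_sum]
    ring
  rcases le_or_gt (∑ y, q y * shannonEntropy (p y)) (Hv n ps) with hle | hgt
  · obtain ⟨r, hr, hre⟩ := intermediate_value_Icc hps.1.le (Hv_continuous n).continuousOn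
      (show (∑ y, q y * shannonEntropy (p y)) ∈ Set.Icc (Hv n 0) (Hv n ps) from
        ⟨by rw [Hv_zero]; exact hh, hle⟩)
    have hLr := hL1 r ⟨hr.1, hr.2.trans hps.2.le⟩ (by rw [hre]; exact hle)
    rw [hre] at hLr
    rw [hLr]
    rcases hr.1.eq_or_lt with h0 | h0
    · -- zero entropy
      rw [← h0, Hv_zero] at hre
      rw [← h0, norm_of_ent_zero (vVec_prob hn le_rfl (by positivity)) (Hv_zero (n := n)) hα]
      have hz := (Finset.sum_eq_zero_iff_of_nonneg
        (fun y _ => mul_nonneg (hq0 y) (ent_nonneg (hp y)))).mp hre.symm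
      rw [← hq1]
      refine Finset.sum_le_sum fun y hy => ?_
      rcases mul_eq_zero.mp (hz y hy) with h | h
      · rw [h]; simp
      · rw [norm_of_ent_zero (hp y) h hα, mul_one]
    · have := htl r h0 hr.2
      rw [hre] at this
      simpa using this
  · rw [hL2 _ ⟨hh, hhn⟩ hgt]
    refine (htl ps hps.1 le_rfl).trans (le_of_eq ?_)
    have hlt : 0 < log n - Hv n ps := by linarith
    unfold TangencyEq at htan
    clear hL1 hL2 htl
    generalize ∑ y, q y * shannonEntropy (p y) = h at *
    generalize (n : ℝ) ^ (1 / α - 1) = B at htan ⊢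
    field_simp
    linear_combination (h - Hv n ps) * htan

end S15

theorem stmt15 (n : ℕ) (hn : 2 ≤ n)
    (m : ℕ) (hm : 0 < m) (q : Fin m → ℝ) (p : Fin m → Fin n → ℝ)
    (hq0 : ∀ y, 0 ≤ q y) (hq1 : ∑ y, q y = 1) (hp : ∀ y, IsProbVec (p y))
    (α : ℝ) (hα : α ∈ Set.Ioo (0 : ℝ) 1 ∪ Set.Ioi 1) :
    ((α < 1 →
        (α / (1 - α)) * Real.log (Lmin α (∑ y, q y * shannonEntropy (p y))) ≤
          (α / (1 - α)) * Real.log (∑ y, q y * lNorm α (p y))) ∧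
     (1 < α →
        (α / (1 - α)) * Real.log (∑ y, q y * lNorm α (p y)) ≤
          (α / (1 - α)) * Real.log (Lmin α (∑ y, q y * shannonEntropy (p y))))) ∧
    (3 ≤ n → α ∈ Set.Ico (1 / 2 : ℝ) 1 ∪ Set.Ioi 1 →
      ∀ pstar ∈ Set.Ioo (0 : ℝ) (1 / (n : ℝ)), TangencyEq n α pstar →
      ∀ L : ℝ → ℝ,
        (∀ r ∈ Set.Icc (0 : ℝ) (1 / (n : ℝ)), Hv n r ≤ Hv n pstar →
          L (Hv n r) = lNorm α (vVec n r)) →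
        (∀ h ∈ Set.Icc (0 : ℝ) (Real.log n), Hv n pstar < h →
          L h = ((Real.log n - h) / (Real.log n - Hv n pstar)) * lNorm α (vVec n pstar) +
            (1 - (Real.log n - h) / (Real.log n - Hv n pstar)) * (n : ℝ) ^ (1 / α - 1)) →
        (α < 1 →
          (α / (1 - α)) * Real.log (∑ y, q y * lNorm α (p y)) ≤
            (α / (1 - α)) * Real.log (L (∑ y, q y * shannonEntropy (p y)))) ∧
        (1 < α →
          (α / (1 - α)) * Real.log (L (∑ y, q y * shannonEntropy (p y))) ≤
            (α / (1 - α)) * Real.log (∑ y, q y * lNorm α (p y)))) := by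
  have hα0 : 0 < α := by
    rcases hα with h | h
    · exact h.1
    · exact lt_trans one_pos h
  have hα1 : α ≠ 1 := by
    rcases hα with h | h
    · exact h.2.ne
    · exact ne_of_gt h
  have hpos : 0 < ∑ y, q y * lNorm α (p y) := by
    have hnn : ∀ y ∈ Finset.univ, 0 ≤ q y * lNorm α (p y) :=
      fun y _ => mul_nonneg (hq0 y) (S15.lNorm_pos (hp y) α).le
    obtain ⟨y, hy⟩ : ∃ y, 0 < q y := by
      by_contra hcon
      push Not at hcon
      have : ∑ y, q y ≤ 0 := Finset.sum_nonpos fun y _ => hcon y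
      linarith
    exact Finset.sum_pos' hnn ⟨y, Finset.mem_univ y, mul_pos hy (S15.lNorm_pos (hp y) α)⟩
  have hup : ∀ A B : ℝ, 0 < A → A ≤ B → α < 1 →
      (α / (1 - α)) * Real.log A ≤ (α / (1 - α)) * Real.log B := by
    intro A B hA hAB h
    exact mul_le_mul_of_nonneg_left (Real.log_le_log hA hAB)
      (div_nonneg hα0.le (by linarith))
  have hdn : ∀ A B : ℝ, 0 < A → A ≤ B → 1 < α →
      (α / (1 - α)) * Real.log B ≤ (α / (1 - α)) * Real.log A := by
    intro A B hA hAB h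
    exact mul_le_mul_of_nonpos_left (Real.log_le_log hA hAB)
      (div_nonpos_of_nonneg_of_nonpos hα0.le (by linarith))
  obtain ⟨ha1, ha2⟩ := S15.part_a hn hq0 hq1 hp hα0 hα1
  refine ⟨⟨hup _ _ ha1 ha2, hdn _ _ ha1 ha2⟩, ?_⟩
  intro _ _ pstar hps htan L hL1 hL2
  have hb := S15.part_b hn hq0 hq1 hp hα0 hα1 hps htan L hL1 hL2
  exact ⟨hup _ _ hpos hb, hdn _ _ hpos hb⟩
end
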